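/- arXiv:math/0405298 — 2 statements merged into one kernel-verified Lean document; each statement's English description precedes it below -/
import Mathlib

section
/- In the good-path setting, let q ∈ (0, p) and M_q > 1 be constants such that every ζ ∈ B_L (for every L > 1) satisfies sup_{t∈[0,L]} ⟨1, ζ(t)⟩ ∨ ⟨χ, ζ(t)⟩ ∨ ⟨χ^{1+q}, ζ(t)⟩ ≤ M_q. Fix L > 1, let M_1 ≥ M_q and set M_ν^1 = {ξ ∈ M_ν : ⟨χ, ξ⟩ ≤ M_1}. Then for every ε > 0 there exists δ > 0 such that for every ζ ∈ B_L and every ξ ∈ M_ν^1 with d[ζ(0), ξ] ∨ |⟨χ, ζ(0)⟩ − ⟨χ, ξ⟩| ≤ δ, one has sup_{t∈[0,L]} d[ζ(t), ξ] ≤ ε (equivalently sup_{t∈[0,L]} d[ζ(t), ζ̄_ξ(t)] ≤ ε, since the fluid model solution ζ̄_ξ started from an invariant state ξ ∈ M_ν is constant in time). -/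
open MeasureTheory Filter Set
noncomputable section
namespace PSQ

/-- ⟨g, ζ⟩ = ∫ g dζ -/
def pair (g : ℝ → ℝ) (ζ : Measure ℝ) : ℝ := ∫ x, g x ∂ζ

/-- total mass ⟨1, ζ⟩ of a finite measure, as a real number -/
def mass (ζ : Measure ℝ) : ℝ := (ζ Set.univ).toReal

/-- truncated Dirac measure δ⁺ₓ -/
def dplus (x : ℝ) : Measure ℝ := if 0 < x then Measure.dirac x else 0

/-- positive part x⁺ -/
def pos (x : ℝ) : ℝ := max x 0

/-- the arrival counting process E(t) = sup{i : U i ≤ t} -/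
def Ecount (U : ℕ → ℝ) (t : ℝ) : ℕ := sSup {i : ℕ | U i ≤ t}

/-- the standing hypotheses on the data of a pathwise processor sharing queue:
nondecreasing arrival times with `U 0 = 0`, `U 1 > 0`, `U i → ∞`, and strictly positive
service times and initial service times. -/
def QueueHyps (U v : ℕ → ℝ) (Z0 : ℕ) (vt : ℕ → ℝ) : Prop :=
  U 0 = 0 ∧ Monotone U ∧ 0 < U 1 ∧ Tendsto U atTop atTop ∧
    (∀ i, 1 ≤ i → 0 < v i) ∧ (∀ j, 1 ≤ j → 0 < vt j)

/-- the defining equations of the state descriptor μ and the cumulative service per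
job S:  `S t = ∫_0^t φ(⟨1, μ(s)⟩) ds` (recall `(0:ℝ)⁻¹ = 0` in Lean, matching φ(0)=0)
and `μ(t) = Σ_j δ⁺_{(ṽ_j - S(t))⁺} + Σ_{i ≤ E(t)} δ⁺_{(v_i - S(t) + S(U_i))⁺}`. -/
def StateEqns (U v : ℕ → ℝ) (Z0 : ℕ) (vt : ℕ → ℝ)
    (μ : ℝ → Measure ℝ) (S : ℝ → ℝ) : Prop :=
  ∀ t, 0 ≤ t →
    (S t = ∫ s in (0:ℝ)..t, (mass (μ s))⁻¹) ∧
    μ t = (∑ j ∈ Finset.range Z0, dplus (pos (vt (j+1) - S t)))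
        + ∑ i ∈ Finset.range (Ecount U t), dplus (pos (v (i+1) - S t + S (U (i+1))))

/-- fluid scaled state descriptor μ̄^r(t) = r⁻¹ μ(rt) -/
def fmu (μ : ℝ → Measure ℝ) (r t : ℝ) : Measure ℝ := ENNReal.ofReal (1/r) • μ (r*t)

/-- fluid scaled arrival process Ē^r(t) = r⁻¹ E(rt) -/
def fE (U : ℕ → ℝ) (r t : ℝ) : ℝ := (Ecount U (r*t) : ℝ) / r

/-- fluid scaled cumulative service S̄^r_{t,t'} = S(r t') - S(r t) -/
def fS (S : ℝ → ℝ) (r t t' : ℝ) : ℝ := S (r*t') - S (r*t)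

end PSQ
end

namespace PSQ

/-- The constraints tying together the constants of the good-path properties:
`ε ∈ (0,1)`, `l, p, κ, γ > 0`, `M > 1`, `l < ε/(32α)`, `κ < l/(2M)`,
`γ < (κε/4) ∧ (l/4)`. -/
def GoodConsts (α ε l p κ γ M : ℝ) : Prop :=
  ε ∈ Set.Ioo (0:ℝ) 1 ∧ 0 < l ∧ 0 < p ∧ 0 < κ ∧ 0 < γ ∧ 1 < M ∧
    l < ε/(32*α) ∧ κ < l/(2*M) ∧ γ < min (κ*ε/4) (l/4)

/-- A processor sharing path satisfies the level-(ε, l, κ, γ, M) good-path properties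
(for r, T, L), with `N = ⌈64M²/(κε²)⌉ + 1`. -/
def GoodPath (U v : ℕ → ℝ) (μ : ℝ → Measure ℝ) (ν : Measure ℝ)
    (T L r ε l p κ γ M : ℝ) : Prop :=
  ∀ m : ℕ, m ≤ ⌊r * T⌋₊ →
    (∀ t ∈ Set.Icc (0:ℝ) L, fE U r ((m:ℝ) + t + l) - fE U r ((m:ℝ) + t) ≤ ε/16) ∧
    (∀ t ∈ Set.Icc (0:ℝ) L,
      max (max (mass (fmu μ r ((m:ℝ)+t))) (pair id (fmu μ r ((m:ℝ)+t))))
        (pair (fun x => x ^ ((1:ℝ)+p)) (fmu μ r ((m:ℝ)+t))) ≤ M) ∧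
    (∀ x : ℝ, 0 ≤ x → ((fmu μ r 0) (Set.Icc x (x+κ))).toReal ≤ ε/4) ∧
    (∀ t ∈ Set.Icc (0:ℝ) L,
      |pair id (fmu μ r ((m:ℝ)+t)) - pair id (fmu μ r (m:ℝ))| ≤ γ/4) ∧
    (∀ t ∈ Set.Icc (0:ℝ) L, ∀ k : ℕ, k ≤ ⌈64*M^2/(κ*ε^2)⌉₊ + 1 →
      (1/r) * (∑ i ∈ Finset.Ioc (Ecount U (r*((m:ℝ)+t))) (Ecount U (r*((m:ℝ)+t+l))),
          if (k:ℝ)*κ ≤ v i ∧ v i < ((k:ℝ)+1)*κ then (1:ℝ) else 0)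
        ≤ (ε/8) * (ν (Set.Ico (((k:ℝ)-1/2)*κ) (((k:ℝ)+3/2)*κ))).toReal)

end PSQ

namespace PSQ

/-- the metric d on finite measures built from the families (g_k), (h_k)
(with 0-based indexing, so `g k` plays the role of the paper's `g_{k+1}`). -/
noncomputable def dmet (g h : ℕ → ℝ → ℝ) (ζ₁ ζ₂ : Measure ℝ) : ℝ :=
  (∑' k : ℕ, (2:ℝ)⁻¹^(k+1) * min |pair (g k) ζ₁ - pair (g k) ζ₂| 1)
    + ⨆ k : ℕ, |pair (h k) ζ₁ - pair (h k) ζ₂|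

/-- the hypotheses on the families (g_k), (h_k) defining the metric d (0-based
indexing: `h k` vanishes on [0,k] and equals 1 on [k+1,∞), i.e. it is the paper's
`h_{k+1}`); the family (g_k) is convergence determining for weak convergence of
finite Borel measures on ℝ₊. -/
def MetricFamilies (g h : ℕ → ℝ → ℝ) : Prop :=
  (∀ k, (∀ x, 0 ≤ g k x ∧ g k x ≤ 1) ∧ ContDiff ℝ 1 (g k) ∧ ∃ C, ∀ x, |deriv (g k) x| ≤ C) ∧
  (∀ k, (∀ x, 0 ≤ h k x ∧ h k x ≤ 1) ∧ ContDiff ℝ 1 (h k) ∧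
    (∀ x ∈ Set.Icc (0:ℝ) (k:ℝ), h k x = 0) ∧ (∀ x, (k:ℝ)+1 ≤ x → h k x = 1) ∧
    (∀ x, |deriv (h k) x| ≤ 2)) ∧
  (∀ (ζs : ℕ → Measure ℝ) (ζ : Measure ℝ),
    (∀ j, IsFiniteMeasure (ζs j)) → IsFiniteMeasure ζ →
    (∀ j, ζs j (Set.Iio 0) = 0) → ζ (Set.Iio 0) = 0 →
    (∀ k, Tendsto (fun j => pair (g k) (ζs j)) atTop (nhds (pair (g k) ζ))) →
    ∀ f : ℝ → ℝ, Continuous f → (∃ C, ∀ x, |f x| ≤ C) →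
      Tendsto (fun j => pair f (ζs j)) atTop (nhds (pair f ζ)))

end PSQ

namespace PSQ

/-- the excess lifetime distribution ν_e associated with ν:
it has density y ↦ β·ν((y,∞)) on [0,∞) with β = (∫x dν)⁻¹, so that
ν_e([0,x]) = β ∫_0^x ν((y,∞)) dy. -/
noncomputable def nue (ν : Measure ℝ) : Measure ℝ :=
  (volume.restrict (Set.Ici (0:ℝ))).withDensity
    fun y => ν (Set.Ioi y) * (ENNReal.ofReal (∫ x, x ∂ν))⁻¹

/-- the lifting map Δ: w ↦ (w/⟨χ,νe⟩)·νe -/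
noncomputable def Delta (νe : Measure ℝ) (w : ℝ) : Measure ℝ :=
  ENNReal.ofReal (w / ∫ x, x ∂νe) • νe

/-- sums of g(v_i) over arrivals i with s < U_i-index ≤ t,
i.e. Σ_{i = E(s)+1}^{E(t)} g(v_i). -/
noncomputable def arrSum (U w : ℕ → ℝ) (g : ℝ → ℝ) (s t : ℝ) : ℝ :=
  ∑ i ∈ Finset.Ioc (Ecount U s) (Ecount U t), g (w i)

/-- weak continuity of a measure-valued path on a set -/
def WeaklyContinuousOn (ζ : ℝ → Measure ℝ) (s : Set ℝ) : Prop :=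
  ∀ f : ℝ → ℝ, Continuous f → (∃ C, ∀ x, |f x| ≤ C) →
    ContinuousOn (fun t => pair f (ζ t)) s

/-- fluid model solution on [0,L] for critical data (α, ν) -/
def IsFluidSol (α : ℝ) (ν : Measure ℝ) (L : ℝ) (ζ : ℝ → Measure ℝ) : Prop :=
  (∀ t ∈ Set.Icc (0:ℝ) L, IsFiniteMeasure (ζ t) ∧ ζ t (Set.Iio 0) = 0 ∧ ζ t {0} = 0) ∧
  WeaklyContinuousOn ζ (Set.Icc 0 L) ∧
  ((ζ 0 = 0 ∧ ∀ t ∈ Set.Icc (0:ℝ) L, ζ t = 0) ∨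
   ((∀ t ∈ Set.Icc (0:ℝ) L, ζ t ≠ 0) ∧
    ∀ t ∈ Set.Icc (0:ℝ) L, ∀ gf : ℝ → ℝ, ContDiff ℝ 1 gf →
      (∃ C, ∀ x, |gf x| ≤ C ∧ |deriv gf x| ≤ C) → gf 0 = 0 → deriv gf 0 = 0 →
      pair gf (ζ t) = pair gf (ζ 0)
        - (∫ s in (0:ℝ)..t, pair (deriv gf) (ζ s) / mass (ζ s)) + α * t * pair gf ν))

/-- The good-path setting: all the fixed data (heavy traffic sequence R, threshold
sequences ε_n, l_n, κ_n, γ_n, constants p, M, a dense family V of test functions, the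
families g, h defining the metric d, the sequence r_n) together with their standing
hypotheses. -/
structure Setting where
  α : ℝ
  ν : Measure ℝ
  T : ℝ
  R : ℕ → ℝ
  εseq : ℕ → ℝ
  lseq : ℕ → ℝ
  κseq : ℕ → ℝ
  γseq : ℕ → ℝ
  p : ℝ
  M : ℝ
  V : ℕ → ℝ → ℝ
  gmet : ℕ → ℝ → ℝ
  hmet : ℕ → ℝ → ℝ
  rseq : ℕ → ℝ
  hα : 0 < α
  hν : IsProbabilityMeasure ν
  hν0 : ν {0} = 0
  hνsupp : ν (Set.Iio 0) = 0
  hνint : Integrable (fun x => x) ν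
  hcrit : α * ∫ x, x ∂ν = 1
  hT : 1 < T
  hR : ∀ n, 0 < R n
  hRmono : StrictMono R
  hRtop : Tendsto R atTop atTop
  hε : ∀ n, εseq n ∈ Set.Ioo (0:ℝ) 1
  hεanti : StrictAnti εseq
  hεlim : Tendsto εseq atTop (nhds 0)
  hp : 0 < p
  hM : 1 < M
  hl : ∀ n, 0 < lseq n
  hκ : ∀ n, 0 < κseq n
  hγ : ∀ n, 0 < γseq n
  hlε : ∀ n, lseq n < εseq n/(32*α)
  hκl : ∀ n, κseq n < lseq n/(2*M)
  hγc : ∀ n, γseq n < min (κseq n * εseq n/4) (lseq n/4)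
  hVsupp : ∀ k, HasCompactSupport (V k)
  hVdiff : ∀ k, ContDiff ℝ 1 (V k)
  hV0 : ∀ k, V k 0 = 0 ∧ deriv (V k) 0 = 0
  hVdense : ∀ g : ℝ → ℝ, HasCompactSupport g → ContDiff ℝ 1 g →
    g 0 = 0 → deriv g 0 = 0 →
    ∃ φ : ℕ → ℕ, (∃ C, ∀ j x, |V (φ j) x| ≤ C ∧ |deriv (V (φ j)) x| ≤ C) ∧
      (∀ x, Tendsto (fun j => V (φ j) x) atTop (nhds (g x))) ∧
      (∀ x, Tendsto (fun j => deriv (V (φ j)) x) atTop (nhds (deriv g x)))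
  hmetfam : MetricFamilies gmet hmet
  hrpos : ∀ n, 0 < rseq n
  hrmono : StrictMono rseq
  hrtop : Tendsto rseq atTop atTop

/-- the excess lifetime distribution of the setting -/
noncomputable def Setting.nuE (S : Setting) : Measure ℝ := nue S.ν

/-- the index n(r) -/
noncomputable def Setting.nIdx (S : Setting) (r : ℝ) : ℕ := sSup {n : ℕ | S.rseq n < r}

/-- membership in the invariant manifold M_ν -/
def Setting.onManifold (S : Setting) (ξ : Measure ℝ) : Prop :=
  ∃ c : ℝ, 0 ≤ c ∧ ξ = ENNReal.ofReal c • S.nuE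

/-- the distance of a measure-valued path on [0,L] to the good paths B_L^r :
ζ ∈ B_L^r iff ζ agrees on [0,L] with some shifted fluid scaled state descriptor
μ̄^{r,m}, 0 ≤ m ≤ ⌊rT⌋, of a processor-sharing path satisfying, for all n' ≤ n(r),
the level-(ε_{n'}, l_{n'}, κ_{n'}, γ_{n'}, M) good-path properties, the law of large
numbers bounds for the test family V, and whose initial measure is ε_{n'}-close to
the invariant manifold. -/
def Setting.memBLr (S : Setting) (L r : ℝ) (ζ : ℝ → Measure ℝ) : Prop :=
  ∃ (U v : ℕ → ℝ) (Z0 : ℕ) (vt : ℕ → ℝ) (μ : ℝ → Measure ℝ) (Sf : ℝ → ℝ) (m : ℕ),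
    QueueHyps U v Z0 vt ∧ StateEqns U v Z0 vt μ Sf ∧ m ≤ ⌊r * S.T⌋₊ ∧
    (∀ t ∈ Set.Icc (0:ℝ) L, ζ t = fmu μ r ((m:ℝ)+t)) ∧
    ∀ n' : ℕ, n' ≤ S.nIdx r →
      GoodPath U v μ S.ν S.T L r (S.εseq n') (S.lseq n') S.p (S.κseq n') (S.γseq n') S.M ∧
      (∀ k : ℕ, k ≤ n' → ∀ j : ℕ, 1 ≤ j → j ≤ ⌊L / S.lseq n'⌋₊ → ∀ m' : ℕ, m' ≤ ⌊r*S.T⌋₊ →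
        |(1/r) * arrSum U v (S.V k) (r*(m':ℝ)) (r*((m':ℝ) + (j:ℝ) * S.lseq n'))
          - S.α * (j:ℝ) * S.lseq n' * pair (S.V k) S.ν| ≤ S.εseq n') ∧
      (∃ ξ : Measure ℝ, S.onManifold ξ ∧
        max (dmet S.gmet S.hmet (fmu μ r 0) ξ) |pair id (fmu μ r 0) - pair id ξ| < S.εseq n')

/-- the set B_L of uniform limits of good paths: weakly continuous M_F-valued paths
on [0,L] that are uniform (in the metric d) limits of paths ζ^j ∈ B_L^{r̃_j} along a
subsequence r̃_j → ∞ of R. -/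
def Setting.memBL (S : Setting) (L : ℝ) (ζ : ℝ → Measure ℝ) : Prop :=
  (∀ t ∈ Set.Icc (0:ℝ) L, IsFiniteMeasure (ζ t) ∧ ζ t (Set.Iio 0) = 0) ∧
  (∀ t ∈ Set.Icc (0:ℝ) L, ∀ ε : ℝ, 0 < ε → ∃ δ : ℝ, 0 < δ ∧
    ∀ s ∈ Set.Icc (0:ℝ) L, |s - t| < δ → dmet S.gmet S.hmet (ζ s) (ζ t) < ε) ∧
  ∃ (φ : ℕ → ℕ) (ζs : ℕ → ℝ → Measure ℝ), StrictMono φ ∧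
    (∀ j, S.memBLr L (S.R (φ j)) (ζs j)) ∧
    ∀ ε : ℝ, 0 < ε → ∃ J : ℕ, ∀ j, J ≤ j → ∀ t ∈ Set.Icc (0:ℝ) L,
      dmet S.gmet S.hmet (ζs j t) (ζ t) ≤ ε

end PSQ

namespace PSQ

/-- Finite measures on the line carried by `[0, ∞)`. -/
def IsMF (ζ : Measure ℝ) : Prop := IsFiniteMeasure ζ ∧ ζ (Iio 0) = 0

lemma IsMF.ae_nonneg {ζ : Measure ℝ} (h : IsMF ζ) : ∀ᵐ x ∂ζ, 0 ≤ x := by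
  rw [ae_iff]
  simpa [Iio] using h.2

lemma mass_nonneg (ζ : Measure ℝ) : 0 ≤ mass ζ := ENNReal.toReal_nonneg

lemma pair_const (ζ : Measure ℝ) (c : ℝ) : pair (fun _ => c) ζ = c * mass ζ := by
  simp [pair, mass, Measure.real, mul_comm]

lemma abs_pair_le {ζ : Measure ℝ} [IsFiniteMeasure ζ] {f : ℝ → ℝ} {C : ℝ}
    (hf : ∀ᵐ x ∂ζ, |f x| ≤ C) : |pair f ζ| ≤ C * mass ζ :=
  norm_integral_le_of_norm_le_const (f := f) (μ := ζ) (C := C) hf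

lemma integrable_of_bdd {ζ : Measure ℝ} [IsFiniteMeasure ζ] {f : ℝ → ℝ} {C : ℝ}
    (hf : Measurable f) (hC : ∀ x, |f x| ≤ C) : Integrable f ζ :=
  Integrable.of_bound hf.aestronglyMeasurable C (Eventually.of_forall hC)

lemma pair_smul (c : ENNReal) (f : ℝ → ℝ) (ζ : Measure ℝ) :
    pair f (c • ζ) = c.toReal * pair f ζ := by
  simp [pair, integral_smul_measure]

lemma mass_smul (c : ENNReal) (ζ : Measure ℝ) : mass (c • ζ) = c.toReal * mass ζ := by
  simp [mass]

section metric

variable {g h : ℕ → ℝ → ℝ}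

lemma dmet_summable (ζ ξ : Measure ℝ) :
    Summable fun k : ℕ => (2:ℝ)⁻¹^(k+1) * min |pair (g k) ζ - pair (g k) ξ| 1 := by
  have hs : Summable fun k : ℕ => (2:ℝ)⁻¹^(k+1) :=
    (summable_nat_add_iff 1).2 (summable_geometric_of_lt_one (by norm_num) (by norm_num))
  refine Summable.of_nonneg_of_le (fun k => ?_) (fun k => ?_) hs
  · positivity
  · exact mul_le_of_le_one_right (by positivity) (min_le_right _ _)

lemma dmet_sup_nonneg (ζ ξ : Measure ℝ) : 0 ≤ ⨆ k : ℕ, |pair (h k) ζ - pair (h k) ξ| :=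
  Real.iSup_nonneg fun _ => abs_nonneg _

lemma dmet_term_le (ζ ξ : Measure ℝ) (k : ℕ) :
    (2:ℝ)⁻¹^(k+1) * min |pair (g k) ζ - pair (g k) ξ| 1 ≤ dmet g h ζ ξ := by
  have := (dmet_summable (g := g) ζ ξ).le_tsum k (fun j _ => by positivity)
  have h2 := dmet_sup_nonneg (h := h) ζ ξ
  unfold dmet
  linarith

lemma dmet_comm (ζ ξ : Measure ℝ) : dmet g h ζ ξ = dmet g h ξ ζ := by
  unfold dmet
  simp only [abs_sub_comm]

lemma abs_pair_h_le (H : MetricFamilies g h) {ζ : Measure ℝ} (hζ : IsMF ζ) (k : ℕ) :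
    |pair (h k) ζ| ≤ mass ζ := by
  have := hζ.1
  have := abs_pair_le (ζ := ζ) (f := h k) (C := 1) (Eventually.of_forall fun x => by
    have := (H.2.1 k).1 x
    rw [abs_le]; constructor <;> linarith)
  simpa using this

lemma dmet_bdd (H : MetricFamilies g h) {ζ ξ : Measure ℝ} (hζ : IsMF ζ) (hξ : IsMF ξ) :
    BddAbove (range fun k : ℕ => |pair (h k) ζ - pair (h k) ξ|) := by
  refine ⟨mass ζ + mass ξ, ?_⟩
  rintro _ ⟨k, rfl⟩
  exact (abs_sub _ _).trans (add_le_add (abs_pair_h_le H hζ k) (abs_pair_h_le H hξ k))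

lemma dmet_triangle (H : MetricFamilies g h) {ζ ξ η : Measure ℝ}
    (hζ : IsMF ζ) (hξ : IsMF ξ) (hη : IsMF η) :
    dmet g h ζ η ≤ dmet g h ζ ξ + dmet g h ξ η := by
  unfold dmet
  have h1 : (∑' k : ℕ, (2:ℝ)⁻¹^(k+1) * min |pair (g k) ζ - pair (g k) η| 1) ≤
      (∑' k : ℕ, (2:ℝ)⁻¹^(k+1) * min |pair (g k) ζ - pair (g k) ξ| 1) +
      ∑' k : ℕ, (2:ℝ)⁻¹^(k+1) * min |pair (g k) ξ - pair (g k) η| 1 := by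
    rw [← (dmet_summable ζ ξ).tsum_add (dmet_summable ξ η)]
    refine (dmet_summable ζ η).tsum_le_tsum (fun k => ?_)
      ((dmet_summable ζ ξ).add (dmet_summable ξ η))
    rw [← mul_add]
    refine mul_le_mul_of_nonneg_left ?_ (by positivity)
    have := abs_sub_le (pair (g k) ζ) (pair (g k) ξ) (pair (g k) η)
    have h3 := abs_nonneg (pair (g k) ζ - pair (g k) ξ)
    have h4 := abs_nonneg (pair (g k) ξ - pair (g k) η)
    rcases min_cases |pair (g k) ζ - pair (g k) η| 1 with h | h <;>
    rcases min_cases |pair (g k) ζ - pair (g k) ξ| 1 with h' | h' <;>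
    rcases min_cases |pair (g k) ξ - pair (g k) η| 1 with h'' | h'' <;>
    rw [h.1, h'.1, h''.1] <;> linarith
  have h2 : (⨆ k : ℕ, |pair (h k) ζ - pair (h k) η|) ≤
      (⨆ k : ℕ, |pair (h k) ζ - pair (h k) ξ|) + ⨆ k : ℕ, |pair (h k) ξ - pair (h k) η| := by
    refine ciSup_le fun k => (abs_sub_le _ (pair (h k) ξ) _).trans ?_
    exact add_le_add (le_ciSup (dmet_bdd H hζ hξ) k) (le_ciSup (dmet_bdd H hξ hη) k)
  linarith

lemma tendsto_pair_g_sub {ζs ξs : ℕ → Measure ℝ}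
    (hd : Tendsto (fun j => dmet g h (ζs j) (ξs j)) atTop (nhds 0)) (k : ℕ) :
    Tendsto (fun j => pair (g k) (ζs j) - pair (g k) (ξs j)) atTop (nhds 0) := by
  have h1 : Tendsto (fun j => min |pair (g k) (ζs j) - pair (g k) (ξs j)| 1) atTop (nhds 0) := by
    have h2 : Tendsto (fun j => (2:ℝ)^(k+1) * dmet g h (ζs j) (ξs j)) atTop (nhds 0) := by
      simpa using hd.const_mul ((2:ℝ)^(k+1))
    refine squeeze_zero (fun j => by positivity) (fun j => ?_) h2
    have h3 := dmet_term_le (g := g) (h := h) (ζs j) (ξs j) k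
    have h4 : (2:ℝ)^(k+1) * ((2:ℝ)⁻¹^(k+1) * min |pair (g k) (ζs j) - pair (g k) (ξs j)| 1) ≤
      (2:ℝ)^(k+1) * dmet g h (ζs j) (ξs j) := mul_le_mul_of_nonneg_left h3 (by positivity)
    rwa [← mul_assoc, ← mul_pow, mul_inv_cancel₀ (by norm_num), one_pow, one_mul] at h4
  rw [tendsto_zero_iff_abs_tendsto_zero]
  refine h1.congr' ?_
  filter_upwards [h1.eventually_lt_const (zero_lt_one)] with j hj
  rcases min_lt_iff.1 hj with h | h
  · exact min_eq_left h.le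
  · exact absurd h (lt_irrefl _)

lemma tendsto_pair (H : MetricFamilies g h) {ζs : ℕ → Measure ℝ} {ζ : Measure ℝ}
    (hζs : ∀ j, IsMF (ζs j)) (hζ : IsMF ζ)
    (hd : ∀ k, Tendsto (fun j => pair (g k) (ζs j)) atTop (nhds (pair (g k) ζ)))
    {f : ℝ → ℝ} (hf : Continuous f) (hb : ∃ C, ∀ x, |f x| ≤ C) :
    Tendsto (fun j => pair f (ζs j)) atTop (nhds (pair f ζ)) :=
  H.2.2 ζs ζ (fun j => (hζs j).1) hζ.1 (fun j => (hζs j).2) hζ.2 hd f hf hb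

lemma dmet_nonneg (ζ ξ : Measure ℝ) : 0 ≤ dmet g h ζ ξ :=
  add_nonneg (tsum_nonneg fun _ => by positivity) (dmet_sup_nonneg _ _)

end metric

end PSQ

namespace PSQ

section queue

variable {U v : ℕ → ℝ} {Z0 : ℕ} {vt : ℕ → ℝ} {μ : ℝ → Measure ℝ} {Sf : ℝ → ℝ}

lemma le_Ecount_iff (hQ : QueueHyps U v Z0 vt) {t : ℝ} (ht : 0 ≤ t) (i : ℕ) :
    i ≤ Ecount U t ↔ U i ≤ t := by
  obtain ⟨h0, hmono, -, htop, -, -⟩ := hQ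
  have hbdd : BddAbove {i : ℕ | U i ≤ t} := by
    obtain ⟨n, hn⟩ := (htop.eventually_gt_atTop t).exists
    refine ⟨n, fun i hi => ?_⟩
    by_contra hlt
    exact absurd (hmono (not_le.1 hlt).le) (not_le.2 (lt_of_le_of_lt hi hn))
  have hne : {i : ℕ | U i ≤ t}.Nonempty := ⟨0, by simpa [h0] using ht⟩
  have hmem : U (Ecount U t) ≤ t := Nat.sSup_mem hne hbdd
  exact ⟨fun h => (hmono h).trans hmem, fun h => le_csSup hbdd h⟩

lemma Ecount_mono (hQ : QueueHyps U v Z0 vt) {s t : ℝ} (hs : 0 ≤ s) (hst : s ≤ t) :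
    Ecount U s ≤ Ecount U t :=
  (le_Ecount_iff hQ (hs.trans hst) _).2 (((le_Ecount_iff hQ hs _).1 le_rfl).trans hst)

lemma mem_Ioc_Ecount (hQ : QueueHyps U v Z0 vt) {s t : ℝ} (hs : 0 ≤ s) (hst : s ≤ t) {i : ℕ}
    (hi : i ∈ Finset.Ioc (Ecount U s) (Ecount U t)) : 1 ≤ i ∧ s < U i ∧ U i ≤ t := by
  rw [Finset.mem_Ioc] at hi
  refine ⟨by omega, ?_, (le_Ecount_iff hQ (hs.trans hst) i).1 hi.2⟩
  by_contra h
  exact absurd ((le_Ecount_iff hQ hs i).2 (not_lt.1 h)) (by omega)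

lemma dplus_pos (y : ℝ) : dplus (pos y) = if 0 < y then Measure.dirac y else 0 := by
  unfold dplus pos
  by_cases h : 0 < y
  · simp [h, max_eq_left h.le]
  · simp [h]

lemma isMF_dplus_pos (y : ℝ) : IsMF (dplus (pos y)) := by
  rw [dplus_pos]
  split_ifs with h
  · refine ⟨inferInstance, ?_⟩
    simp [h.le]
  · exact ⟨inferInstance, by simp⟩

lemma pair_dplus_pos (f : ℝ → ℝ) (y : ℝ) :
    pair f (dplus (pos y)) = if 0 < y then f y else 0 := by
  rw [dplus_pos]
  split_ifs <;> simp [pair]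

lemma integrable_dplus_pos (f : ℝ → ℝ) (y : ℝ) : Integrable f (dplus (pos y)) := by
  rw [dplus_pos]
  split_ifs
  · exact integrable_dirac (by simp)
  · simp

lemma integrable_state (hS : StateEqns U v Z0 vt μ Sf) {t : ℝ} (ht : 0 ≤ t) (f : ℝ → ℝ) :
    Integrable f (μ t) := by
  rw [(hS t ht).2]
  refine Integrable.add_measure ?_ ?_ <;>
  exact integrable_finsetSum_measure.2 fun _ _ => integrable_dplus_pos _ _

lemma IsMF.add {ζ ξ : Measure ℝ} (hζ : IsMF ζ) (hξ : IsMF ξ) : IsMF (ζ + ξ) := by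
  have := hζ.1
  have := hξ.1
  exact ⟨inferInstance, by simp [hζ.2, hξ.2]⟩

lemma IsMF.finsetSum {ι : Type*} (s : Finset ι) {m : ι → Measure ℝ} (h : ∀ i ∈ s, IsMF (m i)) :
    IsMF (∑ i ∈ s, m i) := by
  classical
  induction s using Finset.induction_on with
  | empty => exact ⟨by simpa using (inferInstance : IsFiniteMeasure (0 : Measure ℝ)), by simp⟩
  | insert a s ha ih =>
    rw [Finset.sum_insert ha]
    exact (h a (Finset.mem_insert_self _ _)).add
      (ih fun i hi => h i (Finset.mem_insert_of_mem hi))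

lemma isMF_state (hS : StateEqns U v Z0 vt μ Sf) {t : ℝ} (ht : 0 ≤ t) : IsMF (μ t) := by
  rw [(hS t ht).2]
  exact (IsMF.finsetSum _ fun _ _ => isMF_dplus_pos _).add
    (IsMF.finsetSum _ fun _ _ => isMF_dplus_pos _)

lemma sum_range_eq_sum_Ioc (F : ℕ → ℝ) (n : ℕ) :
    ∑ i ∈ Finset.range n, F (i+1) = ∑ i ∈ Finset.Ioc 0 n, F i := by
  induction n with
  | zero => simp
  | succ n ih => rw [Finset.sum_range_succ, ih, Finset.sum_Ioc_succ_top (Nat.zero_le _)]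

lemma pair_state (hS : StateEqns U v Z0 vt μ Sf) {t : ℝ} (ht : 0 ≤ t) (f : ℝ → ℝ) :
    pair f (μ t) =
      (∑ j ∈ Finset.range Z0, if 0 < vt (j+1) - Sf t then f (vt (j+1) - Sf t) else 0)
      + ∑ i ∈ Finset.Ioc 0 (Ecount U t),
          if 0 < v i - Sf t + Sf (U i) then f (v i - Sf t + Sf (U i)) else 0 := by
  rw [← sum_range_eq_sum_Ioc
    (fun i => if 0 < v i - Sf t + Sf (U i) then f (v i - Sf t + Sf (U i)) else 0)]
  conv_lhs => rw [(hS t ht).2]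
  unfold pair
  rw [integral_add_measure, integral_finsetSum_measure, integral_finsetSum_measure]
  · exact congrArg₂ _ (Finset.sum_congr rfl fun _ _ => pair_dplus_pos _ _)
      (Finset.sum_congr rfl fun _ _ => pair_dplus_pos _ _)
  · exact fun _ _ => integrable_dplus_pos _ _
  · exact fun _ _ => integrable_dplus_pos _ _
  · exact integrable_finsetSum_measure.2 fun _ _ => integrable_dplus_pos _ _
  · exact integrable_finsetSum_measure.2 fun _ _ => integrable_dplus_pos _ _

lemma mass_eq_pair (ζ : Measure ℝ) : mass ζ = pair (fun _ => 1) ζ := by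
  rw [pair_const, one_mul]

lemma inv_mass_state_le_one (hS : StateEqns U v Z0 vt μ Sf) {t : ℝ} (ht : 0 ≤ t) :
    (mass (μ t))⁻¹ ≤ 1 := by
  have : ∃ n : ℕ, mass (μ t) = n := by
    rw [mass_eq_pair, pair_state hS ht]
    exact ⟨(∑ j ∈ Finset.range Z0, if 0 < vt (j+1) - Sf t then 1 else 0)
      + ∑ i ∈ Finset.Ioc 0 (Ecount U t), if 0 < v i - Sf t + Sf (U i) then 1 else 0, by simp⟩
  obtain ⟨n, hn⟩ := this
  rw [hn]
  exact Nat.cast_inv_le_one n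

/-- The reciprocal mass is measurable as soon as the cumulative service is. -/
lemma measurable_inv_mass (hQ : QueueHyps U v Z0 vt) (hS : StateEqns U v Z0 vt μ Sf)
    {T : ℝ} {S' : ℝ → ℝ} (hm : Measurable S') (he : ∀ t ∈ Icc 0 T, Sf t = S' t) :
    AEStronglyMeasurable (fun s => (mass (μ s))⁻¹) (volume.restrict (Icc 0 T)) := by
  by_cases hT : T < 0
  · simp [Icc_eq_empty (not_le.2 hT)]
  have hT := not_lt.1 hT
  let F : ℝ → ℝ := fun t => (∑ j ∈ Finset.range Z0, if 0 < vt (j+1) - S' t then (1:ℝ) else 0)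
      + ∑ i ∈ Finset.Ioc 0 (Ecount U T),
          if 0 < v i - S' t + Sf (U i) ∧ U i ≤ t then (1:ℝ) else 0
  have hF : Measurable F := by
    refine Measurable.add ?_ ?_ <;> refine Finset.measurable_fun_sum _ fun i _ => ?_ <;>
      refine Measurable.ite ?_ measurable_const measurable_const
    · exact measurableSet_lt measurable_const (measurable_const.sub hm)
    · exact (measurableSet_lt measurable_const ((measurable_const.sub hm).add_const _)).inter
        (measurableSet_le measurable_const measurable_id)
  refine (hF.inv.aestronglyMeasurable).congr ?_
  filter_upwards [ae_restrict_mem measurableSet_Icc] with t ht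
  simp only [Pi.inv_apply, inv_inj]
  rw [mass_eq_pair, pair_state hS ht.1, he t ht]
  simp only [F]
  congr 1
  have hsub : Finset.Ioc 0 (Ecount U t) ⊆ Finset.Ioc 0 (Ecount U T) :=
    Finset.Ioc_subset_Ioc_right (Ecount_mono hQ ht.1 ht.2)
  rw [← Finset.sum_subset hsub]
  · refine Finset.sum_congr rfl fun i hi => ?_
    have := (le_Ecount_iff hQ ht.1 i).1 (Finset.mem_Ioc.1 hi).2
    simp [this]
  · intro i hi hni
    rw [Finset.mem_Ioc] at hi hni
    rw [if_neg]
    rintro ⟨-, h2⟩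
    exact hni ⟨hi.1, (le_Ecount_iff hQ ht.1 i).2 h2⟩

lemma intervalIntegrable_inv_mass (hQ : QueueHyps U v Z0 vt) (hS : StateEqns U v Z0 vt μ Sf)
    {T : ℝ} (hT : 0 ≤ T) : IntervalIntegrable (fun s => (mass (μ s))⁻¹) volume 0 T := by
  set f : ℝ → ℝ := fun s => (mass (μ s))⁻¹ with hf
  have hnn : ∀ s, 0 ≤ f s := fun s => inv_nonneg.2 (mass_nonneg _)
  let A : Set ℝ := {t | 0 ≤ t ∧ IntervalIntegrable f volume 0 t}
  have hdown : ∀ s t, 0 ≤ s → s ≤ t → t ∈ A → s ∈ A := fun s t hs hst ht =>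
    ⟨hs, ht.2.mono_set (by rw [uIcc_of_le hs, uIcc_of_le ht.1]; exact Icc_subset_Icc_right hst)⟩
  have hA : A.OrdConnected := ⟨fun s hs t ht x hx => hdown x t (hs.1.trans hx.1) hx.2 ht⟩
  have hmono : MonotoneOn Sf A := by
    intro s hs t ht hst
    rw [(hS s hs.1).1, (hS t ht.1).1]
    exact intervalIntegral.integral_mono_interval le_rfl hs.1 hst
      (Eventually.of_forall fun x => hnn x) ht.2
  have hzero : ∀ t, 0 ≤ t → t ∉ A → Sf t = 0 := by
    intro t ht hA
    rw [(hS t ht).1]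
    exact intervalIntegral.integral_undef fun h => hA ⟨ht, h⟩
  have hmeas : ∃ S' : ℝ → ℝ, Measurable S' ∧ ∀ t, 0 ≤ t → Sf t = S' t := by
    refine ⟨A.indicator Sf, ?_, fun t ht => ?_⟩
    · refine measurable_of_Ici fun c => ?_
      have : (A.indicator Sf) ⁻¹' Ici c =
          (A ∩ Sf ⁻¹' Ici c) ∪ (if c ≤ 0 then Aᶜ else ∅) := by
        ext x
        by_cases hx : x ∈ A <;> by_cases hc : c ≤ 0 <;> simp [hx, hc]
      rw [this]
      refine MeasurableSet.union (OrdConnected.measurableSet ⟨?_⟩) ?_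
      · intro s hs t ht x hx
        have hxA : x ∈ A := hA.out hs.1 ht.1 hx
        exact ⟨hxA, le_trans hs.2 (hmono hs.1 hxA hx.1)⟩
      · split_ifs
        · exact hA.measurableSet.compl
        · exact MeasurableSet.empty
    · by_cases h : t ∈ A
      · simp [h]
      · simp [h, hzero t ht h]
  obtain ⟨S', hS', he⟩ := hmeas
  have hm := measurable_inv_mass hQ hS (T := T) hS' fun t ht => he t ht.1
  rw [intervalIntegrable_iff, uIoc_of_le hT]
  refine IntegrableOn.mono_set (t := Icc 0 T) ?_ Ioc_subset_Icc_self
  refine Integrable.of_bound hm 1 ?_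
  filter_upwards [ae_restrict_mem measurableSet_Icc] with t ht
  rw [Real.norm_eq_abs, abs_of_nonneg (hnn t)]
  exact inv_mass_state_le_one hS ht.1

lemma service_sub (hQ : QueueHyps U v Z0 vt) (hS : StateEqns U v Z0 vt μ Sf) {s t : ℝ}
    (hs : 0 ≤ s) (ht : 0 ≤ t) : Sf t - Sf s = ∫ u in s..t, (mass (μ u))⁻¹ := by
  rw [(hS t ht).1, (hS s hs).1]
  exact intervalIntegral.integral_interval_sub_left (intervalIntegrable_inv_mass hQ hS ht)
    (intervalIntegrable_inv_mass hQ hS hs)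

lemma service_mono (hQ : QueueHyps U v Z0 vt) (hS : StateEqns U v Z0 vt μ Sf) {s t : ℝ}
    (hs : 0 ≤ s) (hst : s ≤ t) : Sf s ≤ Sf t := by
  have := service_sub hQ hS hs (hs.trans hst)
  have h2 : 0 ≤ ∫ u in s..t, (mass (μ u))⁻¹ :=
    intervalIntegral.integral_nonneg hst fun _ _ => inv_nonneg.2 (mass_nonneg _)
  linarith

lemma pair_state_increment (hQ : QueueHyps U v Z0 vt) (hS : StateEqns U v Z0 vt μ Sf) {s t : ℝ}
    (hs : 0 ≤ s) (hst : s ≤ t) {f : ℝ → ℝ} (hf : ∀ x ≤ 0, f x = 0) :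
    pair f (μ t) = pair (fun x => f (x - (Sf t - Sf s))) (μ s)
      + ∑ i ∈ Finset.Ioc (Ecount U s) (Ecount U t), f (v i - (Sf t - Sf (U i))) := by
  have hSm := service_mono hQ hS hs hst
  have e1 : ∀ y, (if 0 < y then f y else 0) = f y := fun y => by
    split_ifs with h
    · rfl
    · exact (hf y (not_lt.1 h)).symm
  have e2 : ∀ y, (if 0 < y then f (y - (Sf t - Sf s)) else 0) = f (y - (Sf t - Sf s)) := fun y => by
    split_ifs with h
    · rfl
    · exact (hf _ (by linarith [not_lt.1 h])).symm
  rw [pair_state hS (hs.trans hst), pair_state hS hs]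
  simp only [e1, e2]
  rw [add_assoc]
  congr 1
  · exact Finset.sum_congr rfl fun j _ => by ring_nf
  · rw [← Finset.sum_Ioc_consecutive _ (Nat.zero_le _) (Ecount_mono hQ hs hst)]
    congr 1 <;> exact Finset.sum_congr rfl fun j _ => by ring_nf

lemma sum_pos_le_workload (hQ : QueueHyps U v Z0 vt) (hS : StateEqns U v Z0 vt μ Sf) {s t : ℝ}
    (hs : 0 ≤ s) (hst : s ≤ t) :
    ∑ i ∈ Finset.Ioc (Ecount U s) (Ecount U t), pos (v i - (Sf t - Sf s)) ≤ pair id (μ t) := by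
  have h1 : pair id (μ t) = pair pos (μ t) := by
    refine integral_congr_ae ?_
    filter_upwards [(isMF_state hS (hs.trans hst)).ae_nonneg] with x hx
    simp [pos, hx]
  rw [h1, pair_state_increment hQ hS hs hst (f := pos) (fun x hx => by simp [pos, hx])]
  have h2 : 0 ≤ pair (fun x => pos (x - (Sf t - Sf s))) (μ s) :=
    integral_nonneg fun _ => le_max_right _ _
  have h3 : ∑ i ∈ Finset.Ioc (Ecount U s) (Ecount U t), pos (v i - (Sf t - Sf s)) ≤
      ∑ i ∈ Finset.Ioc (Ecount U s) (Ecount U t), pos (v i - (Sf t - Sf (U i))) := by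
    refine Finset.sum_le_sum fun i hi => ?_
    have hi := mem_Ioc_Ecount hQ hs hst hi
    have := service_mono hQ hS hs hi.2.1.le
    exact max_le_max (by linarith) le_rfl
  linarith

end queue

end PSQ

namespace PSQ

/-- A processor sharing path together with a scaling parameter and an integer shift. -/
structure Path where
  U : ℕ → ℝ
  v : ℕ → ℝ
  Z0 : ℕ
  vt : ℕ → ℝ
  μ : ℝ → Measure ℝ
  Sf : ℝ → ℝ
  m : ℕ
  r : ℝ
  hr : 0 < r
  hQ : QueueHyps U v Z0 vt
  hS : StateEqns U v Z0 vt μ Sf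

namespace Path

variable (P : Path)

/-- The shifted fluid scaled state descriptor. -/
noncomputable def st (t : ℝ) : Measure ℝ := fmu P.μ P.r (P.m + t)

/-- The fluid scaled sum of `g` over the service times of the arrivals in `(s, t]`. -/
noncomputable def arr (g : ℝ → ℝ) (s t : ℝ) : ℝ :=
  (1 / P.r) * arrSum P.U P.v g (P.r * (P.m + s)) (P.r * (P.m + t))

/-- The service received per job during `(s, t]`. -/
noncomputable def srv (s t : ℝ) : ℝ := P.Sf (P.r * (P.m + t)) - P.Sf (P.r * (P.m + s))

variable {P}

lemma time_nonneg {s : ℝ} (hs : 0 ≤ s) : 0 ≤ P.r * (P.m + s) := by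
  have := P.hr
  positivity

lemma time_mono {s t : ℝ} (hst : s ≤ t) : P.r * (P.m + s) ≤ P.r * (P.m + t) :=
  mul_le_mul_of_nonneg_left (by linarith) P.hr.le

lemma pair_st (f : ℝ → ℝ) (t : ℝ) : pair f (P.st t) = (1 / P.r) * pair f (P.μ (P.r * (P.m + t))) := by
  rw [st, fmu, pair_smul, ENNReal.toReal_ofReal (by have := P.hr; positivity)]

lemma isMF_st {t : ℝ} (ht : 0 ≤ t) : IsMF (P.st t) := by
  have := isMF_state P.hS (P.time_nonneg ht)
  have h1 := this.1
  refine ⟨?_, by simp [st, fmu, this.2]⟩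
  exact Measure.smul_finite _ ENNReal.ofReal_ne_top

lemma integrable_st {t : ℝ} (ht : 0 ≤ t) (f : ℝ → ℝ) : Integrable f (P.st t) :=
  (integrable_state P.hS (P.time_nonneg ht) f).smul_measure (by simp)

lemma mass_st (t : ℝ) : mass (P.st t) = (1 / P.r) * mass (P.μ (P.r * (P.m + t))) := by
  rw [mass_eq_pair, pair_st, ← mass_eq_pair]

lemma inv_mass_st (t : ℝ) : (mass (P.st t))⁻¹ = P.r * (mass (P.μ (P.r * t + P.r * P.m)))⁻¹ := by
  rw [mass_st, mul_inv, one_div, inv_inv, mul_add, add_comm]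

lemma intervalIntegrable_inv_mass_st {s t : ℝ} (hs : 0 ≤ s) (ht : 0 ≤ t) :
    IntervalIntegrable (fun u => (mass (P.st u))⁻¹) volume s t := by
  simp_rw [inv_mass_st]
  refine IntervalIntegrable.const_mul ?_ _
  have hr := P.hr
  have h : IntervalIntegrable (fun u => (mass (P.μ u))⁻¹) volume
      (P.r * s + P.r * P.m) (P.r * t + P.r * P.m) :=
    (PSQ.intervalIntegrable_inv_mass P.hQ P.hS (by positivity)).symm.trans
      (PSQ.intervalIntegrable_inv_mass P.hQ P.hS (by positivity))
  have h2 := (h.comp_add_right (P.r * P.m)).comp_mul_left (c := P.r)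
  simpa [mul_div_assoc, hr.ne'] using h2

lemma srv_eq {s t : ℝ} (hs : 0 ≤ s) (ht : 0 ≤ t) :
    P.srv s t = ∫ u in s..t, (mass (P.st u))⁻¹ := by
  have hr := P.hr
  simp_rw [inv_mass_st]
  rw [intervalIntegral.integral_const_mul,
    intervalIntegral.integral_comp_mul_add (fun u => (mass (P.μ u))⁻¹) hr.ne', srv,
    service_sub P.hQ P.hS (P.time_nonneg hs) (P.time_nonneg ht), smul_eq_mul, ← mul_assoc,
    mul_inv_cancel₀ hr.ne', one_mul]
  congr 1 <;> ring

lemma srv_nonneg {s t : ℝ} (hs : 0 ≤ s) (hst : s ≤ t) : 0 ≤ P.srv s t :=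
  sub_nonneg.2 (service_mono P.hQ P.hS (P.time_nonneg hs) (P.time_mono hst))

lemma arr_add {s t u : ℝ} (hs : 0 ≤ s) (hst : s ≤ t) (htu : t ≤ u) (g : ℝ → ℝ) :
    P.arr g s t + P.arr g t u = P.arr g s u := by
  unfold arr arrSum
  rw [← mul_add, Finset.sum_Ioc_consecutive]
  · exact Ecount_mono P.hQ (P.time_nonneg hs) (P.time_mono hst)
  · exact Ecount_mono P.hQ (P.time_nonneg (hs.trans hst)) (P.time_mono htu)

lemma arr_sub (f g : ℝ → ℝ) (s t : ℝ) :
    P.arr (fun x => f x - g x) s t = P.arr f s t - P.arr g s t := by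
  simp only [arr, arrSum, Finset.sum_sub_distrib, mul_sub]

lemma arr_add_fun (f g : ℝ → ℝ) (s t : ℝ) :
    P.arr (fun x => f x + g x) s t = P.arr f s t + P.arr g s t := by
  simp only [arr, arrSum, Finset.sum_add_distrib, mul_add]

lemma arr_const_mul (c : ℝ) (g : ℝ → ℝ) (s t : ℝ) :
    P.arr (fun x => c * g x) s t = c * P.arr g s t := by
  simp only [arr, arrSum, ← Finset.mul_sum]
  ring

lemma abs_arr_le {s t : ℝ} (hs : 0 ≤ s) (hst : s ≤ t) {f g : ℝ → ℝ}
    (h : ∀ x, 0 < x → |f x| ≤ g x) : |P.arr f s t| ≤ P.arr g s t := by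
  unfold arr arrSum
  have hr := P.hr
  rw [abs_mul, abs_of_nonneg (by positivity : 0 ≤ 1 / P.r)]
  refine mul_le_mul_of_nonneg_left ?_ (by positivity)
  refine (Finset.abs_sum_le_sum_abs _ _).trans (Finset.sum_le_sum fun i hi => h _ ?_)
  exact P.hQ.2.2.2.2.1 i (mem_Ioc_Ecount P.hQ (P.time_nonneg hs) (P.time_mono hst) hi).1

lemma arr_nonneg {s t : ℝ} (hs : 0 ≤ s) (hst : s ≤ t) {g : ℝ → ℝ}
    (h : ∀ x, 0 < x → 0 ≤ g x) : 0 ≤ P.arr g s t := by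
  have := P.abs_arr_le hs hst (f := fun _ => 0) (g := g) (by simpa using h)
  exact (abs_nonneg _).trans this

lemma arr_one {s t : ℝ} (hs : 0 ≤ s) (hst : s ≤ t) :
    P.arr (fun _ => 1) s t = fE P.U P.r (P.m + t) - fE P.U P.r (P.m + s) := by
  unfold arr arrSum fE
  have := Ecount_mono P.hQ (P.time_nonneg hs) (P.time_mono hst)
  rw [Finset.sum_const, Nat.card_Ioc, nsmul_eq_mul, Nat.cast_sub this]
  ring

lemma arr_pos_le {s t : ℝ} (hs : 0 ≤ s) (hst : s ≤ t) :
    P.arr (fun x => pos (x - P.srv s t)) s t ≤ pair id (P.st t) := by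
  have hr := P.hr
  rw [pair_st]
  refine mul_le_mul_of_nonneg_left ?_ (by positivity)
  exact sum_pos_le_workload P.hQ P.hS (P.time_nonneg hs) (P.time_mono hst)

lemma pair_st_increment {s t : ℝ} (hs : 0 ≤ s) (hst : s ≤ t) {f g : ℝ → ℝ} {D : ℝ}
    (hf : ∀ x ≤ 0, f x = 0)
    (hD : ∀ x y, 0 ≤ y → y ≤ P.srv s t → |f (x - y) - f x| ≤ D * g x) :
    |pair f (P.st t) - pair (fun x => f (x - P.srv s t)) (P.st s) - P.arr f s t|
      ≤ D * P.arr g s t := by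
  have hr := P.hr
  rw [pair_st, pair_st, pair_state_increment P.hQ P.hS (P.time_nonneg hs) (P.time_mono hst) hf]
  unfold arr arrSum
  rw [← srv, mul_add, add_sub_cancel_left, ← mul_sub, ← Finset.sum_sub_distrib, abs_mul,
    abs_of_nonneg (by positivity : 0 ≤ 1 / P.r), mul_left_comm]
  refine mul_le_mul_of_nonneg_left ?_ (by positivity)
  rw [Finset.mul_sum]
  refine (Finset.abs_sum_le_sum_abs _ _).trans (Finset.sum_le_sum fun i hi => ?_)
  have hi := mem_Ioc_Ecount P.hQ (P.time_nonneg hs) (P.time_mono hst) hi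
  have h0 := P.time_nonneg hs
  refine hD _ _ ?_ ?_
  · exact sub_nonneg.2 (service_mono P.hQ P.hS (h0.trans hi.2.1.le) hi.2.2)
  · have := service_mono P.hQ P.hS h0 hi.2.1.le
    unfold srv
    linarith

end Path

/-- The features of a sequence of good paths that survive in the limit. -/
structure Setting.Approx (S : Setting) (L : ℝ) (ζ : ℝ → Measure ℝ) (P : ℕ → Path) : Prop where
  dist : ∀ ε : ℝ, 0 < ε → ∃ J : ℕ, ∀ j, J ≤ j → ∀ t ∈ Icc (0:ℝ) L,
    dmet S.gmet S.hmet ((P j).st t) (ζ t) ≤ ε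
  count : ∃ C : ℝ, ∀ j, (P j).arr (fun _ => 1) 0 L ≤ C
  lln : ∀ k, ∀ t ∈ Icc (0:ℝ) L,
    Tendsto (fun j => (P j).arr (S.V k) 0 t) atTop (nhds (S.α * t * pair (S.V k) S.ν))
  moment : ∀ j, ∀ t ∈ Icc (0:ℝ) L, pair id ((P j).st t) ≤ S.M ∧
    pair (fun x => x ^ ((1:ℝ) + S.p)) ((P j).st t) ≤ S.M
  workload : ∀ t ∈ Icc (0:ℝ) L,
    Tendsto (fun j => pair id ((P j).st t) - pair id ((P j).st 0)) atTop (nhds 0)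

lemma Setting.le_nIdx (S : Setting) {r : ℝ} {n : ℕ} (h : S.rseq n < r) : n ≤ S.nIdx r := by
  refine le_csSup ?_ h
  obtain ⟨N, hN⟩ := (S.hrtop.eventually_gt_atTop r).exists
  refine ⟨N, fun i hi => ?_⟩
  by_contra hlt
  exact absurd (S.hrmono.monotone (not_le.1 hlt).le) (not_le.2 (lt_trans hi hN))

lemma Setting.tendsto_nIdx (S : Setting) : Tendsto S.nIdx atTop atTop := by
  refine tendsto_atTop.2 fun n => ?_
  filter_upwards [eventually_gt_atTop (S.rseq n)] with r hr
  exact S.le_nIdx hr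

lemma Setting.tendsto_lseq (S : Setting) : Tendsto S.lseq atTop (nhds 0) := by
  refine squeeze_zero (fun n => (S.hl n).le) (fun n => (S.hlε n).le) ?_
  simpa using S.hεlim.div_const (32 * S.α)

lemma count_windows {e : ℝ → ℝ} {L l c : ℝ} (hL : 0 ≤ L) (hl : 0 < l)
    (hmono : ∀ s t, 0 ≤ s → s ≤ t → e s ≤ e t)
    (h : ∀ t ∈ Icc (0:ℝ) L, e (t + l) - e t ≤ c) : e L - e 0 ≤ (⌊L / l⌋₊ + 1) * c := by
  have key : ∀ k : ℕ, k ≤ ⌊L / l⌋₊ + 1 → e (k * l) - e 0 ≤ k * c := by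
    intro k
    induction k with
    | zero => intro _; simp
    | succ k ih =>
      intro hk
      have h1 := ih (by omega)
      have hkl : (k:ℝ) * l ≤ L := by
        have : (k:ℝ) ≤ L / l := (Nat.cast_le.2 (by omega)).trans (Nat.floor_le (by positivity))
        rwa [le_div_iff₀ hl] at this
      have h2 := h (k * l) ⟨by positivity, hkl⟩
      push_cast
      rw [add_mul, add_mul, one_mul, one_mul]
      linarith
  have h1 := key _ le_rfl
  have h2 : L ≤ (⌊L / l⌋₊ + 1) * l := by
    rw [← div_le_iff₀ hl]
    exact (Nat.lt_floor_add_one _).le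
  have h3 := hmono L _ hL h2
  push_cast at h1
  linarith

lemma Setting.exists_approx (S : Setting) {L : ℝ} (hL : 0 ≤ L) {ζ : ℝ → Measure ℝ}
    (hζ : S.memBL L ζ) : ∃ P : ℕ → Path, S.Approx L ζ P := by
  obtain ⟨-, -, φ, ζs, hφ, hB, hd⟩ := hζ
  choose U v Z0 vt μ Sf m hQ hS hm hst hlev using hB
  let P : ℕ → Path := fun j => ⟨U j, v j, Z0 j, vt j, μ j, Sf j, m j, S.R (φ j), S.hR _, hQ j, hS j⟩
  have hN : Tendsto (fun j => S.nIdx (S.R (φ j))) atTop atTop :=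
    S.tendsto_nIdx.comp (S.hRtop.comp hφ.tendsto_atTop)
  have hcount : ∀ j n, n ≤ S.nIdx (S.R (φ j)) → ∀ t ∈ Icc (0:ℝ) L,
      (P j).arr (fun _ => 1) t (t + S.lseq n) ≤ S.εseq n / 16 := by
    intro j n hn t ht
    rw [Path.arr_one ht.1 (by have := S.hl n; linarith), ← add_assoc]
    exact ((hlev j n hn).1 (m j) (hm j)).1 t ht
  have hmom : ∀ j, ∀ t ∈ Icc (0:ℝ) L, pair id ((P j).st t) ≤ S.M ∧
    pair (fun x => x ^ ((1:ℝ) + S.p)) ((P j).st t) ≤ S.M := by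
    intro j t ht
    have := ((hlev j 0 (Nat.zero_le _)).1 (m j) (hm j)).2.1 t ht
    rw [max_le_iff, max_le_iff] at this
    exact ⟨this.1.2, this.2⟩
  refine ⟨P, ?_, ?_, ?_, hmom, ?_⟩
  · intro ε hε
    obtain ⟨J, hJ⟩ := hd ε hε
    refine ⟨J, fun j hj t ht => ?_⟩
    have := hJ j hj t ht
    rwa [hst j t ht] at this
  · refine ⟨(⌊L / S.lseq 0⌋₊ + 1) * (S.εseq 0 / 16), fun j => ?_⟩
    have h1 := count_windows (e := fun t => (P j).arr (fun _ => 1) 0 t) (L := L)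
      (c := S.εseq 0 / 16) hL (S.hl 0) ?_ ?_
    · have h0 : (P j).arr (fun _ => 1) 0 0 = 0 := by simp [Path.arr, arrSum]
      simpa [h0] using h1
    · intro s t hs hst
      have := Path.arr_add (P := P j) le_rfl hs hst (fun _ => 1)
      have h2 := Path.arr_nonneg (P := P j) hs hst (g := fun _ => 1) (by simp)
      linarith
    · intro t ht
      have hl := S.hl 0
      have := Path.arr_add (P := P j) (u := t + S.lseq 0) le_rfl ht.1 (by linarith) (fun _ => 1)
      have h2 := hcount j 0 (Nat.zero_le _) t ht
      linarith
  · intro k t ht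
    obtain ⟨C, hC⟩ : ∃ C, ∀ x, |S.V k x| ≤ C := by
      obtain ⟨C, hC⟩ := (S.hVsupp k).exists_bound_of_continuous (S.hVdiff k).continuous
      exact ⟨C, hC⟩
    have hC0 : 0 ≤ C := (abs_nonneg _).trans (hC 0)
    rw [tendsto_iff_norm_sub_tendsto_zero]
    have hb : Tendsto (fun j => C * (S.εseq (S.nIdx (S.R (φ j))) / 16)
        + S.εseq (S.nIdx (S.R (φ j)))
        + S.α * S.lseq (S.nIdx (S.R (φ j))) * |pair (S.V k) S.ν|) atTop (nhds 0) := by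
      have h1 := S.hεlim.comp hN
      have h2 := S.tendsto_lseq.comp hN
      have h3 := (((h1.div_const 16).const_mul C).add h1).add
        ((h2.const_mul S.α).mul_const |pair (S.V k) S.ν|)
      simpa using h3
    refine squeeze_zero' (Eventually.of_forall fun _ => norm_nonneg _) ?_ hb
    filter_upwards [hN.eventually_ge_atTop k] with j hj
    set n := S.nIdx (S.R (φ j)) with hn
    have hl := S.hl n
    set i := ⌊t / S.lseq n⌋₊ with hi
    have hil : (i:ℝ) * S.lseq n ≤ t := by
      rw [← le_div_iff₀ hl]; exact Nat.floor_le (div_nonneg ht.1 hl.le)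
    have hil' : t < (i:ℝ) * S.lseq n + S.lseq n := by
      have := Nat.lt_floor_add_one (t / S.lseq n)
      rw [div_lt_iff₀ hl, add_mul, one_mul] at this
      exact this
    have hi0 : 0 ≤ (i:ℝ) * S.lseq n := by positivity
    have e1 : |(P j).arr (S.V k) 0 (i * S.lseq n) - S.α * i * S.lseq n * pair (S.V k) S.ν|
        ≤ S.εseq n := by
      rcases Nat.eq_zero_or_pos i with h0 | h0
      · rw [h0]
        simpa [Path.arr, arrSum] using (S.hε n).1.le
      · have := (hlev j n le_rfl).2.1 k hj i h0 (Nat.floor_mono (by gcongr; exact ht.2)) (m j) (hm j)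
        simpa [Path.arr, P] using this
    have e2 : |(P j).arr (S.V k) (i * S.lseq n) t| ≤ C * (S.εseq n / 16) := by
      refine (Path.abs_arr_le hi0 hil (g := fun _ => C * 1) (by simpa using fun x _ => hC x)).trans ?_
      rw [Path.arr_const_mul]
      refine mul_le_mul_of_nonneg_left ?_ hC0
      have h1 := hcount j n le_rfl (i * S.lseq n) ⟨hi0, hil.trans ht.2⟩
      have h2 := Path.arr_add (P := P j) hi0 hil hil'.le (fun _ => 1)
      have h3 := Path.arr_nonneg (P := P j) (ht.1) hil'.le (g := fun _ => 1) (by simp)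
      linarith
    have e3 := Path.arr_add (P := P j) le_rfl hi0 hil (S.V k)
    have e4 : |S.α * i * S.lseq n * pair (S.V k) S.ν - S.α * t * pair (S.V k) S.ν| ≤
        S.α * S.lseq n * |pair (S.V k) S.ν| := by
      have : S.α * i * S.lseq n * pair (S.V k) S.ν - S.α * t * pair (S.V k) S.ν
        = -(S.α * (t - i * S.lseq n) * pair (S.V k) S.ν) := by ring
      rw [this, abs_neg, abs_mul, abs_mul, abs_of_pos S.hα, abs_of_nonneg (by linarith)]
      have := S.hα
      gcongr
      linarith
    rw [Real.norm_eq_abs, ← e3]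
    rw [abs_le] at *
    constructor <;> linarith [e1.1, e1.2, e2.1, e2.2, e4.1, e4.2]
  · intro t ht
    rw [tendsto_zero_iff_abs_tendsto_zero]
    have hb : Tendsto (fun j => S.lseq (S.nIdx (S.R (φ j)))) atTop (nhds 0) :=
      S.tendsto_lseq.comp hN
    refine squeeze_zero (fun _ => abs_nonneg _) (fun j => ?_) hb
    set n := S.nIdx (S.R (φ j)) with hn
    have h1 := ((hlev j n le_rfl).1 (m j) (hm j)).2.2.2.1 t ht
    have h2 := (S.hγc n).trans_le (min_le_right _ _)
    have h3 := S.hl n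
    have h4 : (P j).st 0 = fmu (μ j) (S.R (φ j)) (m j) := by simp [Path.st, P]
    simp only [Function.comp_apply, h4]
    refine h1.trans ?_
    linarith

end PSQ

namespace PSQ

/-- A weakly continuous path approximated by good paths. -/
structure Setting.Lim (S : Setting) (L : ℝ) (ζ : ℝ → Measure ℝ) (P : ℕ → Path) : Prop where
  mf : ∀ t ∈ Icc (0:ℝ) L, IsMF (ζ t)
  cont : ∀ t ∈ Icc (0:ℝ) L, ∀ ε : ℝ, 0 < ε → ∃ δ : ℝ, 0 < δ ∧
    ∀ s ∈ Icc (0:ℝ) L, |s - t| < δ → dmet S.gmet S.hmet (ζ s) (ζ t) < ε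
  approx : S.Approx L ζ P

/-- Cumulative service per job received during `[s, t]` along a measure-valued path. -/
noncomputable def svc (ζ : ℝ → Measure ℝ) (s t : ℝ) : ℝ := ∫ u in s..t, (mass (ζ u))⁻¹

section general

variable {S : Setting} {L : ℝ} {ζ : ℝ → Measure ℝ} {P : ℕ → Path}

lemma Setting.exists_lim (S : Setting) {L : ℝ} (hL : 0 ≤ L) {ζ : ℝ → Measure ℝ}
    (hζ : S.memBL L ζ) : ∃ P : ℕ → Path, S.Lim L ζ P := by
  obtain ⟨P, hP⟩ := S.exists_approx hL hζ
  exact ⟨P, hζ.1, hζ.2.1, hP⟩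

lemma Setting.gmet_bdd (S : Setting) (k : ℕ) : ∃ C, ∀ x, |S.gmet k x| ≤ C :=
  ⟨1, fun x => by
    have := (S.hmetfam.1 k).1 x
    rw [abs_le]; constructor <;> linarith⟩

variable (h : S.Lim L ζ P)
include h

lemma Setting.Lim.tendsto_time {f : ℝ → ℝ} (hf : Continuous f) (hb : ∃ C, ∀ x, |f x| ≤ C)
    {ts : ℕ → ℝ} {t : ℝ} (hts : ∀ i, ts i ∈ Icc (0:ℝ) L) (ht : t ∈ Icc (0:ℝ) L)
    (hlim : Tendsto ts atTop (nhds t)) :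
    Tendsto (fun i => pair f (ζ (ts i))) atTop (nhds (pair f (ζ t))) := by
  refine tendsto_pair S.hmetfam (fun i => h.mf _ (hts i)) (h.mf t ht) (fun k => ?_) hf hb
  have hd : Tendsto (fun i => dmet S.gmet S.hmet (ζ (ts i)) (ζ t)) atTop (nhds 0) := by
    rw [Metric.tendsto_atTop]
    intro ε hε
    obtain ⟨δ, hδ, hc⟩ := h.cont t ht ε hε
    obtain ⟨N, hN⟩ := Metric.tendsto_atTop.1 hlim δ hδ
    refine ⟨N, fun n hn => ?_⟩
    rw [Real.dist_eq, sub_zero, abs_of_nonneg (dmet_nonneg _ _)]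
    exact hc _ (hts n) (hN n hn)
  simpa using (tendsto_pair_g_sub hd k).add_const (pair (S.gmet k) (ζ t))

lemma Setting.Lim.continuousOn_pair {f : ℝ → ℝ} (hf : Continuous f) (hb : ∃ C, ∀ x, |f x| ≤ C) :
    ContinuousOn (fun t => pair f (ζ t)) (Icc 0 L) := by
  intro t ht
  refine tendsto_of_seq_tendsto fun x hx => ?_
  rw [tendsto_nhdsWithin_iff] at hx
  obtain ⟨N, hN⟩ := hx.2.exists_forall_of_atTop
  rw [← tendsto_add_atTop_iff_nat N]
  exact h.tendsto_time hf hb (fun i => hN _ (Nat.le_add_left N i)) ht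
    ((tendsto_add_atTop_iff_nat N).2 hx.1)

lemma Setting.Lim.continuousOn_mass : ContinuousOn (fun t => mass (ζ t)) (Icc 0 L) := by
  simpa only [mass_eq_pair] using h.continuousOn_pair (f := fun _ => 1) continuous_const
    ⟨1, by simp⟩

/-- Continuous convergence of the approximating paths. -/
lemma Setting.Lim.tendsto_diag {f : ℝ → ℝ} (hf : Continuous f) (hb : ∃ C, ∀ x, |f x| ≤ C)
    {φ : ℕ → ℕ} (hφ : Tendsto φ atTop atTop)
    {ts : ℕ → ℝ} {t : ℝ} (hts : ∀ i, ts i ∈ Icc (0:ℝ) L) (ht : t ∈ Icc (0:ℝ) L)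
    (hlim : Tendsto ts atTop (nhds t)) :
    Tendsto (fun i => pair f ((P (φ i)).st (ts i))) atTop (nhds (pair f (ζ t))) := by
  refine tendsto_pair S.hmetfam (fun i => Path.isMF_st (hts i).1) (h.mf t ht) (fun k => ?_) hf hb
  have hd : Tendsto (fun i => dmet S.gmet S.hmet ((P (φ i)).st (ts i)) (ζ (ts i)))
      atTop (nhds 0) := by
    rw [Metric.tendsto_atTop]
    intro ε hε
    obtain ⟨J, hJ⟩ := h.approx.dist (ε / 2) (half_pos hε)
    obtain ⟨N, hN⟩ := (hφ.eventually_ge_atTop J).exists_forall_of_atTop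
    refine ⟨N, fun n hn => ?_⟩
    rw [Real.dist_eq, sub_zero, abs_of_nonneg (dmet_nonneg _ _)]
    exact (hJ _ (hN n hn) _ (hts n)).trans_lt (half_lt_self hε)
  have h1 := tendsto_pair_g_sub hd k
  have h2 := h.tendsto_time (S.hmetfam.1 k).2.1.continuous (S.gmet_bdd k) hts ht hlim
  simpa using h1.add h2

lemma Setting.Lim.tendsto_st {f : ℝ → ℝ} (hf : Continuous f) (hb : ∃ C, ∀ x, |f x| ≤ C)
    {t : ℝ} (ht : t ∈ Icc (0:ℝ) L) :
    Tendsto (fun j => pair f ((P j).st t)) atTop (nhds (pair f (ζ t))) :=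
  h.tendsto_diag hf hb tendsto_id (fun _ => ht) ht tendsto_const_nhds

lemma Setting.Lim.tendsto_mass {t : ℝ} (ht : t ∈ Icc (0:ℝ) L) :
    Tendsto (fun j => mass ((P j).st t)) atTop (nhds (mass (ζ t))) := by
  simpa only [mass_eq_pair] using h.tendsto_st (f := fun _ => 1) continuous_const ⟨1, by simp⟩ ht

lemma Setting.Lim.eventually_mass_ge {a b c : ℝ} (ha : 0 ≤ a) (hb : b ≤ L) (hc : 0 < c)
    (hm : ∀ t ∈ Icc a b, c ≤ mass (ζ t)) :
    ∀ᶠ j in atTop, ∀ t ∈ Icc a b, c / 2 ≤ mass ((P j).st t) := by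
  by_contra hcon
  rw [not_eventually] at hcon
  obtain ⟨φ, hφ, hφ'⟩ := extraction_of_frequently_atTop hcon
  push Not at hφ'
  choose ts hts hlt using hφ'
  obtain ⟨t, ht, ψ, hψ, hlim⟩ := isCompact_Icc.tendsto_subseq hts
  have hsub : Icc a b ⊆ Icc 0 L := Icc_subset_Icc ha hb
  have h1 := h.tendsto_diag (f := fun _ => 1) continuous_const ⟨1, by simp⟩
    (hφ.comp hψ).tendsto_atTop (fun i => hsub (hts (ψ i))) (hsub ht) hlim
  simp only [← mass_eq_pair] at h1
  have h2 := le_of_tendsto h1 (Eventually.of_forall fun i => (hlt (ψ i)).le)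
  have := hm t ht
  linarith

end general

end PSQ

namespace PSQ

/-- The family `V` approximates test functions uniformly on compact sets. -/
lemma Setting.exists_V_close (S : Setting) {g : ℝ → ℝ} (hg : HasCompactSupport g)
    (hg1 : ContDiff ℝ 1 g) (hg0 : g 0 = 0) (hg0' : deriv g 0 = 0) :
    ∃ C, 0 ≤ C ∧ (∀ x, |g x| ≤ C) ∧ ∀ K η : ℝ, 0 < K → 0 < η → ∃ k, (∀ x, |S.V k x| ≤ C) ∧
      (∀ x ∈ Icc 0 K, |S.V k x - g x| ≤ η) ∧ |pair (S.V k) S.ν - pair g S.ν| ≤ η := by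
  obtain ⟨φ, ⟨C, hC⟩, hV, hV'⟩ := S.hVdense g hg hg1 hg0 hg0'
  have hgC : ∀ x, |g x| ≤ C := fun x =>
    le_of_tendsto (hV x).abs (Eventually.of_forall fun j => (hC j x).1)
  have hgC' : ∀ x, |deriv g x| ≤ C := fun x =>
    le_of_tendsto (hV' x).abs (Eventually.of_forall fun j => (hC j x).2)
  have hC0 : 0 ≤ C := (abs_nonneg _).trans (hgC 0)
  refine ⟨C, hC0, hgC, fun K η hK hη => ?_⟩
  have hν := S.hν
  have hcV : ∀ j, Continuous (deriv (S.V (φ j))) := fun j => (S.hVdiff _).continuous_deriv_one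
  have hcg : Continuous (deriv g) := hg1.continuous_deriv_one
  have h1 : Tendsto (fun j => pair (S.V (φ j)) S.ν) atTop (nhds (pair g S.ν)) := by
    refine tendsto_integral_of_dominated_convergence (fun _ => C)
      (fun j => (S.hVdiff _).continuous.aestronglyMeasurable) (integrable_const _)
      (fun j => Eventually.of_forall fun x => (hC j x).1) (Eventually.of_forall hV)
  have h2 : Tendsto (fun j => ∫ x in (0:ℝ)..K, |deriv (S.V (φ j)) x - deriv g x|) atTop
      (nhds (∫ x in (0:ℝ)..K, (0:ℝ))) := by
    refine intervalIntegral.tendsto_integral_filter_of_dominated_convergence (fun _ => C + C)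
      (Eventually.of_forall fun j => ((hcV j).sub hcg).abs.aestronglyMeasurable)
      (Eventually.of_forall fun j => Eventually.of_forall fun x _ => ?_)
      intervalIntegrable_const (Eventually.of_forall fun x _ => ?_)
    · rw [Real.norm_eq_abs, abs_abs]
      exact (abs_sub _ _).trans (add_le_add (hC j x).2 (hgC' x))
    · simpa using ((hV' x).sub_const (deriv g x)).abs
  rw [intervalIntegral.integral_zero] at h2
  obtain ⟨j, hj1, hj2⟩ := ((Metric.tendsto_nhds.1 h1 η hη).and (h2.eventually_lt_const hη)).exists
  refine ⟨φ j, fun x => (hC j x).1, fun x hx => ?_, hj1.le⟩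
  have e1 : S.V (φ j) x - g x = ∫ y in (0:ℝ)..x, (deriv (S.V (φ j)) y - deriv g y) := by
    rw [intervalIntegral.integral_sub ((hcV j).intervalIntegrable _ _) (hcg.intervalIntegrable _ _),
      intervalIntegral.integral_deriv_eq_sub
        (fun y _ => ((S.hVdiff _).differentiable one_ne_zero) y) ((hcV j).intervalIntegrable _ _),
      intervalIntegral.integral_deriv_eq_sub
        (fun y _ => (hg1.differentiable one_ne_zero) y) (hcg.intervalIntegrable _ _),
      (S.hV0 _).1, hg0]
    ring
  rw [e1]
  refine (intervalIntegral.abs_integral_le_integral_abs hx.1).trans (le_trans ?_ hj2.le)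
  exact intervalIntegral.integral_mono_interval le_rfl hx.1 hx.2
    (Eventually.of_forall fun y => abs_nonneg _) (((hcV j).sub hcg).abs.intervalIntegrable _ _)

section busy

variable {S : Setting} {L : ℝ} {ζ : ℝ → Measure ℝ} {P : ℕ → Path} (h : S.Lim L ζ P)
  {a b c : ℝ} (ha : 0 ≤ a) (hb : b ≤ L) (hc : 0 < c) (hm : ∀ t ∈ Icc a b, c ≤ mass (ζ t))
include h ha hb hc hm

lemma Setting.Lim.eventually_srv_le :
    ∀ᶠ j in atTop, ∀ s t, a ≤ s → s ≤ t → t ≤ b → (P j).srv s t ≤ 2 / c * (t - s) := by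
  filter_upwards [h.eventually_mass_ge ha hb hc hm] with j hj s t has hst htb
  rw [Path.srv_eq (ha.trans has) (ha.trans (has.trans hst))]
  have := intervalIntegral.norm_integral_le_of_norm_le_const (a := s) (b := t) (C := 2 / c)
    (f := fun u => (mass ((P j).st u))⁻¹) fun x hx => by
      rw [uIoc_of_le hst] at hx
      have h1 := hj x ⟨has.trans hx.1.le, hx.2.trans htb⟩
      rw [Real.norm_eq_abs, abs_of_nonneg (inv_nonneg.2 (mass_nonneg _)), ← inv_div]
      exact inv_anti₀ (by positivity) h1
  rw [abs_of_nonneg (sub_nonneg.2 hst)] at this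
  exact (le_abs_self _).trans this

lemma Setting.Lim.tendsto_srv {s t : ℝ} (has : a ≤ s) (hst : s ≤ t) (htb : t ≤ b) :
    Tendsto (fun j => (P j).srv s t) atTop (nhds (svc ζ s t)) := by
  have hs0 := ha.trans has
  have : (fun j => (P j).srv s t) = fun j => ∫ u in s..t, (mass ((P j).st u))⁻¹ := by
    funext j
    exact Path.srv_eq hs0 (hs0.trans hst)
  rw [this]
  refine intervalIntegral.tendsto_integral_filter_of_dominated_convergence (fun _ => 2 / c)
    (Eventually.of_forall fun j => (intervalIntegrable_iff.1 (Path.intervalIntegrable_inv_mass_st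
      hs0 (hs0.trans hst))).aestronglyMeasurable) ?_
    intervalIntegrable_const (Eventually.of_forall fun x hx => ?_)
  · filter_upwards [h.eventually_mass_ge ha hb hc hm] with j hj
    refine Eventually.of_forall fun x hx => ?_
    rw [uIoc_of_le hst] at hx
    have h1 := hj x ⟨has.trans hx.1.le, hx.2.trans htb⟩
    rw [Real.norm_eq_abs, abs_of_nonneg (inv_nonneg.2 (mass_nonneg _)), ← inv_div]
    exact inv_anti₀ (by positivity) h1
  · rw [uIoc_of_le hst] at hx
    have hx' : x ∈ Icc a b := ⟨has.trans hx.1.le, hx.2.trans htb⟩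
    exact (h.tendsto_mass (Icc_subset_Icc ha hb hx')).inv₀ (hc.trans_le (hm x hx')).ne'

/-- The law of large numbers for the arrivals during a busy interval. -/
lemma Setting.Lim.tendsto_arr {s t : ℝ} (has : a ≤ s) (hst : s ≤ t) (htb : t ≤ b)
    {g : ℝ → ℝ} (hg : HasCompactSupport g)
    (hg1 : ContDiff ℝ 1 g) (hg0 : g 0 = 0) (hg0' : deriv g 0 = 0) :
    Tendsto (fun j => (P j).arr g s t) atTop (nhds (S.α * (t - s) * pair g S.ν)) := by
  have hs0 := ha.trans has
  have ht0 := hs0.trans hst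
  have htL := htb.trans hb
  obtain ⟨C, hC0, hgC, hV⟩ := S.exists_V_close hg hg1 hg0 hg0'
  obtain ⟨C₀, hcount⟩ := h.approx.count
  have hC₀ : 0 ≤ C₀ := (Path.arr_nonneg le_rfl (ht0.trans htL) (fun _ _ => zero_le_one)).trans
    (hcount 0)
  have hα := S.hα
  have hM : 0 < S.M := zero_lt_one.trans S.hM
  rw [Metric.tendsto_nhds]
  intro ε hε
  set Y : ℝ := 2 / c * (t - s) with hY
  have hY0 : 0 ≤ Y := mul_nonneg (by positivity) (sub_nonneg.2 hst)
  set D : ℝ := ε / (4 * S.M) with hD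
  have hD0 : 0 < D := by positivity
  set K : ℝ := Y + (2 * C + 1) / D with hK
  have hKp : 0 < K := by positivity
  set η : ℝ := ε / (4 * (C₀ + S.α * (t - s) + 1)) with hη
  have hts : 0 ≤ S.α * (t - s) := mul_nonneg hα.le (sub_nonneg.2 hst)
  have hη0 : 0 < η := by positivity
  obtain ⟨k, hk1, hk2, hk3⟩ := hV K η hKp hη0
  have hlim : Tendsto (fun j => (P j).arr (S.V k) s t) atTop
      (nhds (S.α * (t - s) * pair (S.V k) S.ν)) := by
    have h1 := (h.approx.lln k t ⟨ht0, htL⟩).sub (h.approx.lln k s ⟨hs0, hst.trans htL⟩)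
    refine Tendsto.congr (fun j => ?_) (h1.trans (by rw [show S.α * t * pair (S.V k) S.ν -
      S.α * s * pair (S.V k) S.ν = S.α * (t - s) * pair (S.V k) S.ν by ring]))
    have := (P j).arr_add le_rfl hs0 hst (S.V k)
    linarith
  filter_upwards [h.eventually_srv_le ha hb hc hm, Metric.tendsto_nhds.1 hlim (ε / 4) (by positivity)]
    with j hj1 hj2
  rw [Real.dist_eq] at hj2 ⊢
  have hb1 : |(P j).arr g s t - (P j).arr (S.V k) s t| ≤ η * C₀ + D * S.M := by
    rw [← Path.arr_sub]
    have e1 := (P j).abs_arr_le hs0 hst (f := fun x => g x - S.V k x)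
      (g := fun x => η * 1 + D * pos (x - (P j).srv s t)) fun x hx => by
        rcases le_or_gt x K with hxK | hxK
        · have := hk2 x ⟨hx.le, hxK⟩
          rw [abs_sub_comm] at this
          have : 0 ≤ D * pos (x - (P j).srv s t) := mul_nonneg hD0.le (le_max_right _ _)
          linarith
        · have h1 := abs_sub (g x) (S.V k x)
          have h2 := hgC x
          have h3 := hk1 x
          have h4 : (2 * C + 1) / D ≤ pos (x - (P j).srv s t) := by
            refine le_trans ?_ (le_max_left _ _)
            have := hj1 s t has hst htb
            linarith
          rw [div_le_iff₀' hD0] at h4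
          linarith
    refine e1.trans ?_
    rw [Path.arr_add_fun, Path.arr_const_mul, Path.arr_const_mul]
    refine add_le_add (mul_le_mul_of_nonneg_left ?_ hη0.le) (mul_le_mul_of_nonneg_left ?_ hD0.le)
    · have h1 := (P j).arr_add le_rfl hs0 hst (fun _ => 1)
      have h2 := (P j).arr_add le_rfl ht0 htL (fun _ => 1)
      have h3 := (P j).arr_nonneg le_rfl hs0 (g := fun _ => 1) (fun _ _ => zero_le_one)
      have h4 := (P j).arr_nonneg ht0 htL (g := fun _ => 1) (fun _ _ => zero_le_one)
      have h5 := hcount j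
      linarith
    · exact (Path.arr_pos_le hs0 hst).trans (h.approx.moment j t ⟨ht0, htL⟩).1
  have hb2 : |S.α * (t - s) * pair (S.V k) S.ν - S.α * (t - s) * pair g S.ν|
      ≤ S.α * (t - s) * η := by
    rw [← mul_sub, abs_mul, abs_of_nonneg hts]
    exact mul_le_mul_of_nonneg_left hk3 hts
  have hb3 : η * C₀ + S.α * (t - s) * η ≤ ε / 4 := by
    rw [hη]
    have : 0 < C₀ + S.α * (t - s) + 1 := by positivity
    rw [show ε / (4 * (C₀ + S.α * (t - s) + 1)) * C₀ + S.α * (t - s) *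
      (ε / (4 * (C₀ + S.α * (t - s) + 1))) = ε / 4 * ((C₀ + S.α * (t - s)) /
        (C₀ + S.α * (t - s) + 1)) by field_simp]
    refine mul_le_of_le_one_right (by positivity) ?_
    rw [div_le_one this]
    linarith
  have hb4 : D * S.M = ε / 4 := by
    rw [hD]; field_simp
  rw [abs_le] at hb1 hb2
  rw [abs_lt] at hj2 ⊢
  constructor <;> linarith

end busy

end PSQ

namespace PSQ

lemma exists_cutoff {x₀ K : ℝ} (hx₀ : 0 < x₀) :
    ∃ g : ℝ → ℝ, HasCompactSupport g ∧ ContDiff ℝ 1 g ∧ g 0 = 0 ∧ deriv g 0 = 0 ∧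
      (∀ x, 0 ≤ g x ∧ g x ≤ 1) ∧ ∀ x ∈ Icc x₀ K, g x = 1 := by
  let g : ℝ → ℝ := fun x =>
    Real.smoothTransition (2 * x / x₀ - 1) * Real.smoothTransition (K + 1 - x)
  have h0 : ∀ x ≤ x₀ / 2, g x = 0 := fun x hx => by
    have : 2 * x / x₀ - 1 ≤ 0 := by
      rw [sub_nonpos, div_le_one hx₀]; linarith
    simp [g, Real.smoothTransition.zero_of_nonpos this]
  refine ⟨g, ?_, ?_, h0 0 (by linarith), ?_, fun x => ⟨?_, ?_⟩, fun x hx => ?_⟩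
  · refine HasCompactSupport.intro (isCompact_Icc (a := 0) (b := K + 1)) fun x hx => ?_
    rcases le_or_gt 0 x with h | h
    · have : K + 1 - x ≤ 0 := by
        by_contra hcon
        exact hx ⟨h, by linarith⟩
      simp [g, Real.smoothTransition.zero_of_nonpos this]
    · exact h0 x (by linarith)
  · refine ContDiff.mul ?_ ?_
    · exact Real.smoothTransition.contDiff.comp (by fun_prop)
    · exact Real.smoothTransition.contDiff.comp (by fun_prop)
  · have : g =ᶠ[nhds 0] fun _ => 0 := by
      filter_upwards [Iio_mem_nhds (show (0:ℝ) < x₀ / 2 by linarith)] with x hx using h0 x hx.le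
    rw [this.deriv_eq, deriv_const]
  · exact mul_nonneg (Real.smoothTransition.nonneg _) (Real.smoothTransition.nonneg _)
  · exact mul_le_one₀ (Real.smoothTransition.le_one _) (Real.smoothTransition.nonneg _)
      (Real.smoothTransition.le_one _)
  · have h1 : 1 ≤ 2 * x / x₀ - 1 := by
      have := (one_le_div hx₀).2 hx.1
      rw [mul_div_assoc]
      linarith
    have h2 : 1 ≤ K + 1 - x := by linarith [hx.2]
    simp [g, Real.smoothTransition.one_of_one_le h1, Real.smoothTransition.one_of_one_le h2]

/-- Continuously differentiable functions with Lipschitz constant `C` vanishing outside a compact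
subinterval of the open half line. -/
structure TestFun (C : ℝ) (f : ℝ → ℝ) : Prop where
  contDiff : ContDiff ℝ 1 f
  lip : ∀ x y, |f x - f y| ≤ C * |x - y|
  supp : ∃ x₀ K, 0 < x₀ ∧ (∀ x ≤ x₀, f x = 0) ∧ ∀ x, K ≤ x → f x = 0

namespace TestFun

variable {C : ℝ} {f : ℝ → ℝ} (hf : TestFun C f)
include hf

lemma shift {u : ℝ} (hu : 0 ≤ u) : TestFun C (fun x => f (x - u)) := by
  obtain ⟨x₀, K, hx₀, h0, hK⟩ := hf.supp
  refine ⟨hf.contDiff.comp (by fun_prop), fun x y => ?_, x₀, K + u, hx₀, fun x hx => h0 _ (by linarith),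
    fun x hx => hK _ (by linarith)⟩
  simpa using hf.lip (x - u) (y - u)

lemma hasCompactSupport : HasCompactSupport f := by
  obtain ⟨x₀, K, hx₀, h0, hK⟩ := hf.supp
  refine HasCompactSupport.intro (isCompact_Icc (a := 0) (b := K)) fun x hx => ?_
  by_contra hcon
  refine hx ⟨?_, ?_⟩
  · by_contra h1
    exact hcon (h0 x (by linarith))
  · by_contra h1
    exact hcon (hK x (by linarith))

lemma zero_of_nonpos {x : ℝ} (hx : x ≤ 0) : f x = 0 := by
  obtain ⟨x₀, K, hx₀, h0, hK⟩ := hf.supp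
  exact h0 x (by linarith)

lemma deriv_zero : deriv f 0 = 0 := by
  obtain ⟨x₀, K, hx₀, h0, hK⟩ := hf.supp
  have : f =ᶠ[nhds 0] fun _ => 0 := by
    filter_upwards [Iio_mem_nhds hx₀] with x hx using h0 x hx.le
  rw [this.deriv_eq, deriv_const]

lemma continuous : Continuous f := hf.contDiff.continuous

lemma bdd : ∃ B, ∀ x, |f x| ≤ B := by
  obtain ⟨B, hB⟩ := hf.continuous.bounded_above_of_compact_support hf.hasCompactSupport
  exact ⟨B, hB⟩

lemma const_nonneg : 0 ≤ C := by
  have := (abs_nonneg _).trans (hf.lip 1 0)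
  simpa using this

lemma integrable_shift {ζ : Measure ℝ} [IsFiniteMeasure ζ] (u : ℝ) :
    Integrable (fun x => f (x - u)) ζ := by
  obtain ⟨B, hB⟩ := hf.bdd
  exact integrable_of_bdd (hf.continuous.comp (by fun_prop)).measurable fun x => hB _

/-- Pairings with shifts depend Lipschitz continuously on the shift. -/
lemma abs_pair_shift_sub_le {ζ : Measure ℝ} [IsFiniteMeasure ζ] (u w : ℝ) :
    |pair (fun x => f (x - u)) ζ - pair (fun x => f (x - w)) ζ| ≤ C * |u - w| * mass ζ := by
  unfold pair
  rw [← integral_sub (hf.integrable_shift u) (hf.integrable_shift w)]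
  refine abs_pair_le (Eventually.of_forall fun x => ?_)
  refine (hf.lip _ _).trans_eq ?_
  rw [sub_sub_sub_cancel_left, abs_sub_comm]

end TestFun

section busy

variable {S : Setting} {L : ℝ} {ζ : ℝ → Measure ℝ} {P : ℕ → Path} (h : S.Lim L ζ P)
  {a b c : ℝ} (ha : 0 ≤ a) (hb : b ≤ L) (hc : 0 < c) (hm : ∀ t ∈ Icc a b, c ≤ mass (ζ t))
include h ha hb hc hm

lemma Setting.Lim.continuousOn_inv_mass : ContinuousOn (fun t => (mass (ζ t))⁻¹) (Icc a b) :=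
  (h.continuousOn_mass.mono (Icc_subset_Icc ha hb)).inv₀ fun t ht => (hc.trans_le (hm t ht)).ne'

lemma Setting.Lim.intervalIntegrable_inv_mass {s t : ℝ} (hs : s ∈ Icc a b) (ht : t ∈ Icc a b) :
    IntervalIntegrable (fun t => (mass (ζ t))⁻¹) volume s t :=
  ((h.continuousOn_inv_mass ha hb hc hm).mono (uIcc_subset_Icc hs ht)).intervalIntegrable

lemma Setting.Lim.svc_add {s t u : ℝ} (hs : s ∈ Icc a b) (ht : t ∈ Icc a b) (hu : u ∈ Icc a b) :
    svc ζ s t + svc ζ t u = svc ζ s u :=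
  intervalIntegral.integral_add_adjacent_intervals
    (h.intervalIntegrable_inv_mass ha hb hc hm hs ht)
    (h.intervalIntegrable_inv_mass ha hb hc hm ht hu)

omit ha hb hc hm h in
lemma svc_nonneg {s t : ℝ} (hst : s ≤ t) : 0 ≤ svc ζ s t :=
  intervalIntegral.integral_nonneg hst fun _ _ => inv_nonneg.2 (mass_nonneg _)

omit ha hb h in
lemma svc_le {s t : ℝ} (hs : a ≤ s) (hst : s ≤ t) (ht : t ≤ b) :
    svc ζ s t ≤ (t - s) / c := by
  have := intervalIntegral.norm_integral_le_of_norm_le_const (a := s) (b := t) (C := c⁻¹)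
    (f := fun u => (mass (ζ u))⁻¹) fun x hx => by
      rw [uIoc_of_le hst] at hx
      rw [Real.norm_eq_abs, abs_of_nonneg (inv_nonneg.2 (mass_nonneg _))]
      exact inv_anti₀ hc (hm x ⟨hs.trans hx.1.le, hx.2.trans ht⟩)
  rw [abs_of_nonneg (sub_nonneg.2 hst)] at this
  refine (le_abs_self _).trans (this.trans_eq ?_)
  ring

/-- The increments of the limit path over a busy interval. -/
lemma Setting.Lim.abs_increment_le {s t : ℝ} (has : a ≤ s) (hst : s ≤ t) (htb : t ≤ b)
    {C : ℝ} {f : ℝ → ℝ} (hf : TestFun C f) :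
    |pair f (ζ t) - pair (fun x => f (x - svc ζ s t)) (ζ s) - S.α * (t - s) * pair f S.ν|
      ≤ C * S.α / c * (t - s) ^ 2 := by
  obtain ⟨x₀, K, hx₀, h0, hK⟩ := hf.supp
  have hsI : s ∈ Icc 0 L := ⟨ha.trans has, (hst.trans htb).trans hb⟩
  have htI : t ∈ Icc 0 L := ⟨hsI.1.trans hst, htb.trans hb⟩
  set Y : ℝ := 2 / c * (t - s) with hY
  obtain ⟨g, hg1, hg2, hg3, hg4, hg5, hg6⟩ := exists_cutoff (x₀ := x₀) (K := K + Y) hx₀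
  have hC0 := hf.const_nonneg
  have hν := S.hν
  have hsrv := h.tendsto_srv ha hb hc hm has hst htb
  have hbd : ∀ᶠ j in atTop, |pair f ((P j).st t) - pair (fun x => f (x - (P j).srv s t)) ((P j).st s)
      - (P j).arr f s t| ≤ C * (P j).srv s t * (P j).arr g s t := by
    filter_upwards [h.eventually_srv_le ha hb hc hm] with j hj
    refine (P j).pair_st_increment hsI.1 hst (fun x hx => hf.zero_of_nonpos hx) fun x y hy0 hy => ?_
    have hjY := hj s t has hst htb
    have hD : 0 ≤ C * (P j).srv s t := mul_nonneg hC0 (Path.srv_nonneg hsI.1 hst)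
    rcases lt_or_ge x x₀ with h1 | h1
    · rw [h0 _ (by linarith : x - y ≤ x₀), h0 _ h1.le, sub_self, abs_zero]
      exact mul_nonneg hD (hg5 x).1
    · rcases lt_or_ge (K + Y) x with h2 | h2
      · rw [hK _ (by linarith), hK _ (by linarith), sub_self, abs_zero]
        exact mul_nonneg hD (hg5 x).1
      · rw [hg6 x ⟨h1, h2⟩, mul_one]
        refine (hf.lip _ _).trans (mul_le_mul_of_nonneg_left ?_ hC0)
        rwa [sub_sub_cancel_left, abs_neg, abs_of_nonneg hy0]
  have hlim1 : Tendsto (fun j => pair (fun x => f (x - (P j).srv s t)) ((P j).st s)) atTop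
      (nhds (pair (fun x => f (x - svc ζ s t)) (ζ s))) := by
    have h1 := h.tendsto_st (f := fun x => f (x - svc ζ s t)) (hf.continuous.comp (by fun_prop))
      (by obtain ⟨B, hB⟩ := hf.bdd; exact ⟨B, fun x => hB _⟩) hsI
    have h2 : Tendsto (fun j => pair (fun x => f (x - (P j).srv s t)) ((P j).st s)
        - pair (fun x => f (x - svc ζ s t)) ((P j).st s)) atTop (nhds 0) := by
      have h3 : Tendsto (fun j => C * |(P j).srv s t - svc ζ s t| * mass ((P j).st s)) atTop
          (nhds (C * |svc ζ s t - svc ζ s t| * mass (ζ s))) :=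
        ((hsrv.sub_const _).abs.const_mul C).mul (h.tendsto_mass hsI)
      rw [sub_self, abs_zero, mul_zero, zero_mul] at h3
      refine squeeze_zero_norm (fun j => ?_) h3
      have := (Path.isMF_st (P := P j) hsI.1).1
      exact hf.abs_pair_shift_sub_le _ _
    simpa using h2.add h1
  have hlim2 := ((h.tendsto_st hf.continuous hf.bdd htI).sub hlim1).sub
    (h.tendsto_arr ha hb hc hm has hst htb hf.hasCompactSupport hf.contDiff
      (hf.zero_of_nonpos le_rfl) hf.deriv_zero)
  have hlim3 := (hsrv.const_mul C).mul (h.tendsto_arr ha hb hc hm has hst htb hg1 hg2 hg3 hg4)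
  refine (le_of_tendsto_of_tendsto hlim2.abs hlim3 hbd).trans ?_
  have hg7 : pair g S.ν ≤ 1 := by
    have := abs_pair_le (ζ := S.ν) (f := g) (C := 1) (Eventually.of_forall fun x => by
      rw [abs_of_nonneg (hg5 x).1]; exact (hg5 x).2)
    refine (le_abs_self _).trans (this.trans_eq ?_)
    simp [mass]
  have hts : 0 ≤ S.α * (t - s) := mul_nonneg S.hα.le (sub_nonneg.2 hst)
  have e1 : S.α * (t - s) * pair g S.ν ≤ S.α * (t - s) := mul_le_of_le_one_right hts hg7
  have e2 := svc_le hc hm has hst htb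
  calc C * svc ζ s t * (S.α * (t - s) * pair g S.ν)
      ≤ C * svc ζ s t * (S.α * (t - s)) :=
        mul_le_mul_of_nonneg_left e1 (mul_nonneg hC0 (svc_nonneg hst))
    _ ≤ C * ((t - s) / c) * (S.α * (t - s)) :=
        mul_le_mul_of_nonneg_right (mul_le_mul_of_nonneg_left e2 hC0) hts
    _ = C * S.α / c * (t - s) ^ 2 := by ring

end busy

/-- A function with quadratically small increments is constant. -/
lemma eq_of_abs_sub_le_sq {G : ℝ → ℝ} {a b K : ℝ} (hab : a ≤ b)
    (hG : ∀ s t, a ≤ s → s ≤ t → t ≤ b → |G t - G s| ≤ K * (t - s) ^ 2) : G b = G a := by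
  have hder : ∀ x ∈ Icc a b, HasDerivWithinAt G 0 (Icc a b) x := fun x hx => by
    rw [hasDerivWithinAt_iff_isLittleO]
    refine Asymptotics.IsBigO.trans_isLittleO (g := fun y => (y - x) ^ 2) ?_ ?_
    · refine Asymptotics.IsBigO.of_bound K ?_
      filter_upwards [self_mem_nhdsWithin] with y hy
      simp only [smul_zero, sub_zero, Real.norm_eq_abs, abs_of_nonneg (sq_nonneg (y - x))]
      rcases le_total x y with h | h
      · exact hG x y hx.1 h hy.2
      · have := hG y x hy.1 h hx.2
        rwa [abs_sub_comm, ← neg_sub y x, neg_sq] at this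
    · have : (fun y : ℝ => (y - x) ^ 2) =o[nhds x] fun y => y - x := by
        have h1 : Tendsto (fun y : ℝ => y - x) (nhds x) (nhds 0) := by
          have : Continuous fun y : ℝ => y - x := by fun_prop
          simpa using this.tendsto x
        have := (Asymptotics.isLittleO_pow_id (𝕜 := ℝ) (n := 2) one_lt_two).comp_tendsto h1
        simpa [Function.comp_def] using this
      exact this.mono nhdsWithin_le_nhds
  refine constant_of_has_deriv_right_zero (f := G) (a := a) (b := b)
    (fun x hx => (hder x hx).continuousWithinAt) (fun x hx => ?_) b ⟨hab, le_rfl⟩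
  refine ((hder x ⟨hx.1, hx.2.le⟩).mono (Icc_subset_Icc_left hx.1)).mono_of_mem_nhdsWithin ?_
  exact Icc_mem_nhdsGE hx.2

section busy

variable {S : Setting} {L : ℝ} {ζ : ℝ → Measure ℝ} {P : ℕ → Path} (h : S.Lim L ζ P)
  {a b c : ℝ} (ha : 0 ≤ a) (hb : b ≤ L) (hc : 0 < c) (hm : ∀ t ∈ Icc a b, c ≤ mass (ζ t))
include h ha hb hc hm

lemma Setting.Lim.abs_pair_svc_sub_le {C : ℝ} {f : ℝ → ℝ} (hf : TestFun C f) {s t : ℝ}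
    (has : a ≤ s) (hst : s ≤ t) (htb : t ≤ b) :
    |pair (fun x => f (x - svc ζ s b)) S.ν - pair (fun x => f (x - svc ζ t b)) S.ν|
      ≤ C / c * (t - s) := by
  have hν := S.hν
  refine (hf.abs_pair_shift_sub_le _ _).trans ?_
  have e1 := h.svc_add ha hb hc hm ⟨has, hst.trans htb⟩ ⟨has.trans hst, htb⟩
    (right_mem_Icc.2 (has.trans (hst.trans htb)))
  rw [← e1, add_sub_cancel_right, abs_of_nonneg (svc_nonneg hst)]
  simp only [mass, measure_univ, ENNReal.toReal_one, mul_one]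
  rw [div_mul_eq_mul_div, mul_div_assoc]
  exact mul_le_mul_of_nonneg_left (svc_le hc hm has hst htb) hf.const_nonneg

lemma Setting.Lim.continuousOn_pair_svc {C : ℝ} {f : ℝ → ℝ} (hf : TestFun C f) :
    ContinuousOn (fun s => pair (fun x => f (x - svc ζ s b)) S.ν) (Icc a b) := by
  have hC0 := hf.const_nonneg
  have hl : LipschitzOnWith (Real.toNNReal (C / c))
      (fun s => pair (fun x => f (x - svc ζ s b)) S.ν) (Icc a b) := by
    refine LipschitzOnWith.of_dist_le_mul fun x hx y hy => ?_
    rw [Real.coe_toNNReal _ (by positivity), Real.dist_eq, Real.dist_eq]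
    rcases le_total x y with hxy | hxy
    · rw [abs_sub_comm x y, abs_of_nonneg (sub_nonneg.2 hxy)]
      exact h.abs_pair_svc_sub_le ha hb hc hm hf hx.1 hxy hy.2
    · rw [abs_sub_comm, abs_of_nonneg (sub_nonneg.2 hxy)]
      exact h.abs_pair_svc_sub_le ha hb hc hm hf hy.1 hxy hx.2
  exact hl.continuousOn

/-- The evolution of the limit path over a busy interval in terms of test functions. -/
lemma Setting.Lim.pair_eq_of_testFun (hab : a ≤ b) {C : ℝ} {f : ℝ → ℝ} (hf : TestFun C f) :
    pair f (ζ b) = pair (fun x => f (x - svc ζ a b)) (ζ a)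
      + S.α * ∫ s in a..b, pair (fun x => f (x - svc ζ s b)) S.ν := by
  have hν := S.hν
  have hC0 := hf.const_nonneg
  have hα := S.hα
  set ψ : ℝ → ℝ := fun s => pair (fun x => f (x - svc ζ s b)) S.ν with hψ
  have hbI : b ∈ Icc a b := ⟨hab, le_rfl⟩
  have hψl : ∀ s t, a ≤ s → s ≤ t → t ≤ b → |ψ s - ψ t| ≤ C / c * (t - s) :=
    fun s t has hst htb => h.abs_pair_svc_sub_le ha hb hc hm hf has hst htb
  have hψc : ContinuousOn ψ (Icc a b) := h.continuousOn_pair_svc ha hb hc hm hf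
  have hψi : ∀ s t, s ∈ Icc a b → t ∈ Icc a b → IntervalIntegrable ψ volume s t :=
    fun s t hs ht => (hψc.mono (uIcc_subset_Icc hs ht)).intervalIntegrable
  have haI : a ∈ Icc a b := ⟨le_rfl, hab⟩
  have key := eq_of_abs_sub_le_sq (a := a) (b := b) (K := C * S.α / c + S.α * (C / c))
    (G := fun t => pair (fun x => f (x - svc ζ t b)) (ζ t) - S.α * ∫ s in a..t, ψ s) hab
    fun s t has hst htb => by
      have hsI : s ∈ Icc a b := ⟨has, hst.trans htb⟩
      have htI : t ∈ Icc a b := ⟨has.trans hst, htb⟩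
      have e1 := h.abs_increment_le ha hb hc hm has hst htb (hf.shift (svc_nonneg (ζ := ζ) htb))
      have e2 : ∀ x, x - svc ζ s t - svc ζ t b = x - svc ζ s b := fun x => by
        rw [sub_sub, h.svc_add ha hb hc hm hsI htI hbI]
      simp only [e2] at e1
      have e3 : (∫ u in a..t, ψ u) - ∫ u in a..s, ψ u = ∫ u in s..t, ψ u :=
        intervalIntegral.integral_interval_sub_left (hψi _ _ haI htI) (hψi _ _ haI hsI)
      have e4 : |(∫ u in s..t, ψ u) - (t - s) * ψ t| ≤ C / c * (t - s) * (t - s) := by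
        have : (t - s) * ψ t = ∫ u in s..t, ψ t := by simp
        rw [this, ← intervalIntegral.integral_sub (hψi _ _ hsI htI) intervalIntegrable_const]
        have hle := intervalIntegral.norm_integral_le_of_norm_le_const (C := C / c * (t - s))
          (a := s) (b := t) (f := fun u => ψ u - ψ t) fun u hu => ?_
        · rwa [abs_of_nonneg (sub_nonneg.2 hst)] at hle
        rw [uIoc_of_le hst] at hu
        refine (hψl u t (has.trans hu.1.le) hu.2 htb).trans ?_
        exact mul_le_mul_of_nonneg_left (by linarith [hu.1]) (by positivity)
      have e5 : S.α * |(∫ u in s..t, ψ u) - (t - s) * ψ t| ≤ S.α * (C / c * (t - s) * (t - s)) :=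
        mul_le_mul_of_nonneg_left e4 hα.le
      rw [← abs_of_pos hα, ← abs_mul, abs_of_pos hα] at e5
      have e6 : S.α * (∫ u in a..t, ψ u) - S.α * ∫ u in a..s, ψ u = S.α * ∫ u in s..t, ψ u := by
        rw [← e3]; ring
      have e7 : (C * S.α / c + S.α * (C / c)) * (t - s) ^ 2 =
        C * S.α / c * (t - s) ^ 2 + S.α * (C / c * (t - s) * (t - s)) := by ring
      rw [e7]
      have e8 : S.α * (t - s) * pair (fun x => f (x - svc ζ t b)) S.ν = S.α * ((t - s) * ψ t) := by
        rw [hψ]; ring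
      rw [e8] at e1
      rw [mul_sub] at e5
      rw [abs_le] at e1 e5 ⊢
      constructor <;> linarith
  have hbb : svc ζ b b = 0 := intervalIntegral.integral_same
  simp only [hbb, sub_zero, intervalIntegral.integral_same, mul_zero] at key
  linarith

end busy

end PSQ

namespace PSQ

lemma integrable_id_of_truncations {ζ : Measure ℝ} (hζ : IsMF ζ) {M : ℝ}
    (hM : ∀ n : ℕ, pair (fun x => min (pos x) n) ζ ≤ M) : Integrable (fun x => x) ζ := by
  have := hζ.1
  have h1 : Tendsto (fun n : ℕ => ∫⁻ x, ENNReal.ofReal (min (pos x) n) ∂ζ) atTop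
      (nhds (∫⁻ x, ENNReal.ofReal (pos x) ∂ζ)) := by
    refine lintegral_tendsto_of_tendsto_of_monotone (fun n => ?_)
      (Eventually.of_forall fun x n m hnm => ?_) (Eventually.of_forall fun x => ?_)
    · unfold pos
      exact Measurable.aemeasurable (by fun_prop)
    · exact ENNReal.ofReal_le_ofReal (min_le_min_left _ (by exact_mod_cast hnm))
    · refine (ENNReal.continuous_ofReal.tendsto _).comp (tendsto_const_nhds.congr' ?_)
      filter_upwards [eventually_ge_atTop ⌈pos x⌉₊] with n hn
      rw [min_eq_left (Nat.ceil_le.1 hn)]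
  have h2 : ∫⁻ x, ENNReal.ofReal (pos x) ∂ζ ≤ ENNReal.ofReal M := by
    refine le_of_tendsto h1 (Eventually.of_forall fun n => ?_)
    rw [← ofReal_integral_eq_lintegral_ofReal]
    · exact ENNReal.ofReal_le_ofReal (hM n)
    · refine integrable_of_bdd (C := n) (by unfold pos; fun_prop) fun x => ?_
      rw [abs_of_nonneg (le_min (le_max_right _ _) (Nat.cast_nonneg _))]
      exact min_le_right _ _
    · exact Eventually.of_forall fun x => le_min (le_max_right _ _) (Nat.cast_nonneg _)
  refine ⟨by fun_prop, ?_⟩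
  rw [hasFiniteIntegral_iff_norm]
  refine lt_of_le_of_lt (lintegral_mono_ae ?_) (h2.trans_lt ENNReal.ofReal_lt_top)
  filter_upwards [hζ.ae_nonneg] with x hx
  rw [Real.norm_eq_abs, abs_of_nonneg hx]
  exact ENNReal.ofReal_le_ofReal (le_max_left _ _)

lemma sub_min_le_rpow {x K p : ℝ} (hx : 0 ≤ x) (hK : 0 < K) (hp : 0 < p) :
    |x - min (pos x) K| ≤ K ^ (-p) * x ^ (1 + p) := by
  rw [pos, max_eq_left hx]
  have hr : 0 ≤ K ^ (-p) * x ^ (1 + p) := by positivity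
  rcases le_or_gt x K with h | h
  · rwa [min_eq_left h, sub_self, abs_zero]
  · rw [min_eq_right h.le, abs_of_pos (sub_pos.2 h)]
    have h1 : K ^ (-p) * x ^ (1 + p) = x * (x / K) ^ p := by
      rw [Real.rpow_add (hK.trans h), Real.rpow_one, Real.rpow_neg hK.le, Real.div_rpow hx hK.le]
      field_simp
    have h2 : 1 ≤ (x / K) ^ p := Real.one_le_rpow ((one_le_div hK).2 h.le) hp.le
    rw [h1]
    nlinarith

section general

variable {S : Setting} {L : ℝ} {ζ : ℝ → Measure ℝ} {P : ℕ → Path} (h : S.Lim L ζ P)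
include h

omit h in
lemma abs_min_pos_le {x K : ℝ} (hK : 0 ≤ K) : |min (pos x) K| ≤ K := by
  rw [abs_of_nonneg (le_min (show 0 ≤ pos x from le_max_right _ _) hK)]
  exact min_le_right _ _

omit h in
lemma continuous_min_pos (K : ℝ) : Continuous fun x => min (pos x) K := by
  unfold pos
  fun_prop

lemma Setting.Lim.integrable_id {t : ℝ} (ht : t ∈ Icc 0 L) : Integrable (fun x => x) (ζ t) := by
  refine integrable_id_of_truncations (h.mf t ht) (M := S.M) fun n => ?_
  refine le_of_tendsto (h.tendsto_st (continuous_min_pos n)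
    ⟨n, fun x => abs_min_pos_le (Nat.cast_nonneg _)⟩ ht) (Eventually.of_forall fun j => ?_)
  refine le_trans ?_ (h.approx.moment j t ht).1
  refine integral_mono_ae (Path.integrable_st ht.1 _) (Path.integrable_st ht.1 _) ?_
  filter_upwards [(Path.isMF_st (P := P j) ht.1).ae_nonneg] with x hx
  exact (min_le_left _ _).trans_eq (max_eq_left hx)

lemma Setting.Lim.tendsto_workload {t : ℝ} (ht : t ∈ Icc 0 L) :
    Tendsto (fun j => pair id ((P j).st t)) atTop (nhds (pair id (ζ t))) := by
  have hM : 0 < S.M := zero_lt_one.trans S.hM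
  have hmf := (h.mf t ht).1
  have h1 : Tendsto (fun n : ℕ => pair (fun x => min (pos x) n) (ζ t)) atTop
      (nhds (pair id (ζ t))) := by
    refine tendsto_integral_of_dominated_convergence (fun x => |x|)
      (fun n => (continuous_min_pos n).aestronglyMeasurable) (h.integrable_id ht).abs
      (fun n => ?_) ?_
    · filter_upwards [(h.mf t ht).ae_nonneg] with x hx
      rw [Real.norm_eq_abs, abs_of_nonneg (le_min (le_max_right _ _) (Nat.cast_nonneg _)),
        abs_of_nonneg hx]
      exact (min_le_left _ _).trans_eq (max_eq_left hx)
    · filter_upwards [(h.mf t ht).ae_nonneg] with x hx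
      refine tendsto_const_nhds.congr' ?_
      filter_upwards [eventually_ge_atTop ⌈x⌉₊] with n hn
      rw [pos, max_eq_left hx, min_eq_left (Nat.ceil_le.1 hn), id]
  have h2 : Tendsto (fun n : ℕ => (n:ℝ) ^ (-S.p) * S.M) atTop (nhds (0 * S.M)) :=
    ((tendsto_rpow_neg_atTop S.hp).comp tendsto_natCast_atTop_atTop).mul_const _
  rw [zero_mul] at h2
  rw [Metric.tendsto_nhds]
  intro ε hε
  obtain ⟨n, hn1, hn2, hn3⟩ := ((Metric.tendsto_nhds.1 h1 (ε / 3) (by positivity)).and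
    ((h2.eventually_lt_const (by positivity : 0 < ε / 3)).and (eventually_gt_atTop 0))).exists
  have hn0 : (0:ℝ) < n := by exact_mod_cast hn3
  filter_upwards [Metric.tendsto_nhds.1 (h.tendsto_st (continuous_min_pos n)
    ⟨n, fun x => abs_min_pos_le (Nat.cast_nonneg _)⟩ ht) (ε / 3) (by positivity)] with j hj
  have h3 : |pair id ((P j).st t) - pair (fun x => min (pos x) n) ((P j).st t)|
      ≤ (n:ℝ) ^ (-S.p) * S.M := by
    unfold pair
    rw [← integral_sub (Path.integrable_st ht.1 _) (Path.integrable_st ht.1 _)]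
    have h4 : pair (fun x => (n:ℝ) ^ (-S.p) * x ^ (1 + S.p)) ((P j).st t)
        ≤ (n:ℝ) ^ (-S.p) * S.M := by
      unfold pair
      rw [integral_const_mul]
      exact mul_le_mul_of_nonneg_left (h.approx.moment j t ht).2 (by positivity)
    refine (abs_integral_le_integral_abs).trans (le_trans ?_ h4)
    refine integral_mono_ae (Path.integrable_st ht.1 _) (Path.integrable_st ht.1 _) ?_
    filter_upwards [(Path.isMF_st (P := P j) ht.1).ae_nonneg] with x hx
    exact sub_min_le_rpow hx hn0 S.hp
  rw [Real.dist_eq, abs_lt] at hn1 hj ⊢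
  rw [abs_le] at h3
  constructor <;> linarith

/-- The workload of the limit path is constant. -/
lemma Setting.Lim.workload_eq {t : ℝ} (ht : t ∈ Icc 0 L) : pair id (ζ t) = pair id (ζ 0) := by
  have h0 : (0:ℝ) ∈ Icc 0 L := ⟨le_rfl, ht.1.trans ht.2⟩
  have := tendsto_nhds_unique ((h.tendsto_workload ht).sub (h.tendsto_workload h0))
    (h.approx.workload t ht)
  linarith

end general

/-- Smooth cutoffs increasing to the indicator function of `(x₀, ∞)`. -/
noncomputable def ramp (x₀ : ℝ) (n : ℕ) (y : ℝ) : ℝ :=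
  Real.smoothTransition ((n + 1) * (y - x₀) - 1) * Real.smoothTransition (n + 1 - y)

lemma ramp_mem (x₀ : ℝ) (n : ℕ) (y : ℝ) : 0 ≤ ramp x₀ n y ∧ ramp x₀ n y ≤ 1 :=
  ⟨mul_nonneg (Real.smoothTransition.nonneg _) (Real.smoothTransition.nonneg _),
    mul_le_one₀ (Real.smoothTransition.le_one _) (Real.smoothTransition.nonneg _)
      (Real.smoothTransition.le_one _)⟩

lemma tendsto_ramp (x₀ y : ℝ) :
    Tendsto (fun n => ramp x₀ n y) atTop (nhds ((Ioi x₀).indicator (fun _ => 1) y)) := by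
  refine tendsto_const_nhds.congr' ?_
  rcases le_or_gt y x₀ with h | h
  · refine Eventually.of_forall fun n => ?_
    have : ((n:ℝ) + 1) * (y - x₀) - 1 ≤ 0 := by
      have : ((n:ℝ) + 1) * (y - x₀) ≤ 0 := mul_nonpos_of_nonneg_of_nonpos (by positivity) (by linarith)
      linarith
    have h3 : ramp x₀ n y = 0 := by
      unfold ramp
      rw [Real.smoothTransition.zero_of_nonpos this, zero_mul]
    simp only [h3, indicator_of_notMem (show y ∉ Ioi x₀ from not_lt.2 h)]
  · filter_upwards [eventually_ge_atTop ⌈2 / (y - x₀)⌉₊, eventually_ge_atTop ⌈y⌉₊] with n h1 h2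
    have hd := sub_pos.2 h
    have h1' := Nat.ceil_le.1 h1
    rw [div_le_iff₀ hd] at h1'
    have h2' := Nat.ceil_le.1 h2
    have h3 : ramp x₀ n y = 1 := by
      unfold ramp
      rw [Real.smoothTransition.one_of_one_le (by nlinarith),
        Real.smoothTransition.one_of_one_le (by linarith), one_mul]
    simp only [h3, indicator_of_mem (show y ∈ Ioi x₀ from h)]

lemma exists_testFun_mul_ramp {F : ℝ → ℝ} (hF : ContDiff ℝ 1 F) {x₀ : ℝ} (hx₀ : 0 ≤ x₀) (n : ℕ) :
    ∃ C, TestFun C (fun y => F y * ramp x₀ n y) := by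
  have hn : (0:ℝ) < n + 1 := by positivity
  have h0 : ∀ y ≤ x₀ + 1 / (n + 1), F y * ramp x₀ n y = 0 := fun y hy => by
    have : ((n:ℝ) + 1) * (y - x₀) - 1 ≤ 0 := by
      have h1 := mul_le_mul_of_nonneg_left (sub_le_iff_le_add'.2 hy) hn.le
      rw [mul_one_div_cancel hn.ne'] at h1
      linarith
    rw [ramp, Real.smoothTransition.zero_of_nonpos this, zero_mul, mul_zero]
  have hK : ∀ y, (n:ℝ) + 1 ≤ y → F y * ramp x₀ n y = 0 := fun y hy => by
    rw [ramp, Real.smoothTransition.zero_of_nonpos (sub_nonpos.2 hy), mul_zero, mul_zero]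
  have hd : ContDiff ℝ 1 (fun y => F y * ramp x₀ n y) := by
    refine hF.mul (ContDiff.mul ?_ ?_)
    · exact Real.smoothTransition.contDiff.comp (by fun_prop)
    · exact Real.smoothTransition.contDiff.comp (by fun_prop)
  have hs : HasCompactSupport (fun y => F y * ramp x₀ n y) := by
    refine HasCompactSupport.intro (isCompact_Icc (a := 0) (b := (n:ℝ) + 1)) fun x hx => ?_
    by_contra hcon
    refine hx ⟨?_, ?_⟩
    · by_contra h1
      have : 0 < 1 / ((n:ℝ) + 1) := by positivity
      exact hcon (h0 x (by linarith))
    · by_contra h1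
      exact hcon (hK x (by linarith))
  obtain ⟨C, hC⟩ := hd.lipschitzWith_of_hasCompactSupport hs one_ne_zero
  exact ⟨C, hd, fun x y => by simpa only [Real.dist_eq] using hC.dist_le_mul x y,
    x₀ + 1 / (n + 1), n + 1, by positivity, h0, hK⟩

section busy

variable {S : Setting} {L : ℝ} {ζ : ℝ → Measure ℝ} {P : ℕ → Path} (h : S.Lim L ζ P)
  {a b c : ℝ} (ha : 0 ≤ a) (hb : b ≤ L) (hc : 0 < c) (hm : ∀ t ∈ Icc a b, c ≤ mass (ζ t))
include h ha hb hc hm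

/-- The evolution of the limit path over a busy interval for truncated functions of at most
linear growth. -/
lemma Setting.Lim.pair_eq_of_linear_growth (hab : a ≤ b) {F : ℝ → ℝ} (hF : ContDiff ℝ 1 F)
    (hFb : ∀ y, |F y| ≤ 1 + |y|) {x₀ : ℝ} (hx₀ : 0 ≤ x₀) :
    pair (fun x => F x * (Ioi x₀).indicator (fun _ => 1) x) (ζ b)
      = pair (fun x => F (x - svc ζ a b) * (Ioi x₀).indicator (fun _ => 1) (x - svc ζ a b)) (ζ a)
      + S.α * ∫ s in a..b,
        pair (fun x => F (x - svc ζ s b) * (Ioi x₀).indicator (fun _ => 1) (x - svc ζ s b)) S.ν := by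
  have hν := S.hν
  choose C hC using fun n => exists_testFun_mul_ramp hF hx₀ n
  have hbd : ∀ n y, |F y * ramp x₀ n y| ≤ 1 + |y| := fun n y => by
    rw [abs_mul, abs_of_nonneg (ramp_mem x₀ n y).1]
    exact (mul_le_of_le_one_right (abs_nonneg _) (ramp_mem x₀ n y).2).trans (hFb y)
  have hlim : ∀ (μ : Measure ℝ) (u : ℝ), IsFiniteMeasure μ → Integrable (fun x => x) μ →
      Tendsto (fun n => pair (fun x => F (x - u) * ramp x₀ n (x - u)) μ) atTop
      (nhds (pair (fun x => F (x - u) * (Ioi x₀).indicator (fun _ => 1) (x - u)) μ)) := by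
    intro μ u hμ hi
    refine tendsto_integral_of_dominated_convergence (fun x => 1 + |x - u|) (fun n => ?_) ?_
      (fun n => Eventually.of_forall fun x => hbd n _)
      (Eventually.of_forall fun x => (tendsto_ramp x₀ (x - u)).const_mul _)
    · exact ((hC n).continuous.comp (by fun_prop : Continuous fun x => x - u)).aestronglyMeasurable
    · exact (integrable_const _).add (hi.sub (integrable_const u)).abs
  have haI : a ∈ Icc 0 L := ⟨ha, hab.trans hb⟩
  have hbI : b ∈ Icc 0 L := ⟨ha.trans hab, hb⟩
  have h1 := hlim (ζ b) 0 (h.mf b hbI).1 (h.integrable_id hbI)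
  simp only [sub_zero] at h1
  have h2 := hlim (ζ a) (svc ζ a b) (h.mf a haI).1 (h.integrable_id haI)
  have h3 : Tendsto (fun n => ∫ s in a..b,
      pair (fun x => F (x - svc ζ s b) * ramp x₀ n (x - svc ζ s b)) S.ν) atTop
      (nhds (∫ s in a..b,
        pair (fun x => F (x - svc ζ s b) * (Ioi x₀).indicator (fun _ => 1) (x - svc ζ s b)) S.ν)) := by
    refine intervalIntegral.tendsto_integral_filter_of_dominated_convergence
      (fun _ => 1 + (∫ x, |x| ∂S.ν) + svc ζ a b) (Eventually.of_forall fun n => ?_)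
      (Eventually.of_forall fun n => Eventually.of_forall fun s hs => ?_)
      intervalIntegrable_const (Eventually.of_forall fun s _ =>
        hlim S.ν _ inferInstance S.hνint)
    · have := (h.continuousOn_pair_svc ha hb hc hm (hC n)).mono
        (uIcc_subset_Icc (left_mem_Icc.2 hab) (right_mem_Icc.2 hab))
      exact (intervalIntegrable_iff.1 this.intervalIntegrable).aestronglyMeasurable
    · rw [uIoc_of_le hab] at hs
      have hs0 : 0 ≤ svc ζ s b := svc_nonneg hs.2
      have hs1 : svc ζ s b ≤ svc ζ a b := by
        have e1 := h.svc_add ha hb hc hm (left_mem_Icc.2 hab) ⟨hs.1.le, hs.2⟩ (right_mem_Icc.2 hab)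
        have := svc_nonneg (ζ := ζ) hs.1.le
        linarith
      have e2 : ∫ x, (1 + svc ζ a b + |x|) ∂S.ν = 1 + (∫ x, |x| ∂S.ν) + svc ζ a b := by
        rw [integral_add (integrable_const _) S.hνint.abs, integral_const, probReal_univ, one_smul]
        ring
      rw [← e2]
      refine (norm_integral_le_integral_norm _).trans ?_
      refine integral_mono ((hC n).integrable_shift _).norm
        ((integrable_const _).add S.hνint.abs) fun x => ?_
      refine (hbd n _).trans ?_
      have := abs_sub x (svc ζ s b)
      rw [abs_of_nonneg hs0] at this
      linarith
  refine tendsto_nhds_unique h1 ?_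
  refine (h2.add (h3.const_mul S.α)).congr fun n => ?_
  exact (h.pair_eq_of_testFun ha hb hc hm hab (hC n)).symm

end busy

end PSQ

namespace PSQ

/-- The tail `ζ((x, ∞))` as a real number. -/
noncomputable def tail (ζ : Measure ℝ) (x : ℝ) : ℝ := ζ.real (Ioi x)

lemma tail_nonneg (ζ : Measure ℝ) (x : ℝ) : 0 ≤ tail ζ x := measureReal_nonneg

lemma tail_le_mass (ζ : Measure ℝ) [IsFiniteMeasure ζ] (x : ℝ) : tail ζ x ≤ mass ζ :=
  measureReal_mono (subset_univ _)

lemma tail_antitone (ζ : Measure ℝ) [IsFiniteMeasure ζ] : Antitone (tail ζ) :=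
  fun _ _ hxy => measureReal_mono (Ioi_subset_Ioi hxy)

lemma tail_smul (c : ENNReal) (ζ : Measure ℝ) (x : ℝ) : tail (c • ζ) x = c.toReal * tail ζ x := by
  simp [tail, Measure.real]

lemma pair_indicator_shift (ζ : Measure ℝ) (x₀ u : ℝ) :
    pair (fun x => 1 * (Ioi x₀).indicator (fun _ => 1) (x - u)) ζ = tail ζ (x₀ + u) := by
  have : (fun x : ℝ => 1 * (Ioi x₀).indicator (fun _ => (1:ℝ)) (x - u))
      = (Ioi (x₀ + u)).indicator 1 := by
    funext x
    simp only [indicator, mem_Ioi, one_mul, Pi.one_apply, lt_sub_iff_add_lt]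
  rw [this, pair, integral_indicator_one measurableSet_Ioi, tail]

lemma pair_pos_eq {ζ : Measure ℝ} (hζ : IsMF ζ) : pair pos ζ = pair id ζ := by
  refine integral_congr_ae ?_
  filter_upwards [hζ.ae_nonneg] with x hx using max_eq_left hx

lemma mul_indicator_eq_pos (y : ℝ) : y * (Ioi (0:ℝ)).indicator (fun _ => 1) y = pos y := by
  rcases le_or_gt y 0 with h | h
  · rw [indicator_of_notMem (show y ∉ Ioi 0 from not_lt.2 h), mul_zero, pos, max_eq_right h]
  · rw [indicator_of_mem (show y ∈ Ioi 0 from h), mul_one, pos, max_eq_left h.le]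

section busy

variable {S : Setting} {L : ℝ} {ζ : ℝ → Measure ℝ} {P : ℕ → Path} (h : S.Lim L ζ P)
  {a b c : ℝ} (ha : 0 ≤ a) (hb : b ≤ L) (hc : 0 < c) (hm : ∀ t ∈ Icc a b, c ≤ mass (ζ t))
include h ha hb hc hm

/-- The evolution of the tails over a busy interval. -/
lemma Setting.Lim.tail_eq (hab : a ≤ b) {x : ℝ} (hx : 0 ≤ x) :
    tail (ζ b) x = tail (ζ a) (x + svc ζ a b)
      + S.α * ∫ s in a..b, tail S.ν (x + svc ζ s b) := by
  have := h.pair_eq_of_linear_growth ha hb hc hm hab (F := fun _ => 1) contDiff_const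
    (fun y => by simp) hx
  simp only [pair_indicator_shift] at this
  have e := pair_indicator_shift (ζ b) x 0
  simp only [sub_zero, add_zero] at e
  rw [← e, this]

/-- The evolution of the workload over a busy interval. -/
lemma Setting.Lim.pair_pos_eq (hab : a ≤ b) :
    pair pos (ζ b) = pair (fun x => pos (x - svc ζ a b)) (ζ a)
      + S.α * ∫ s in a..b, pair (fun x => pos (x - svc ζ s b)) S.ν := by
  have := h.pair_eq_of_linear_growth ha hb hc hm hab (F := fun y => y) contDiff_id
    (fun y => by linarith [abs_nonneg y]) le_rfl
  simpa only [mul_indicator_eq_pos] using this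

lemma Setting.Lim.svc_antitoneOn : AntitoneOn (fun s => svc ζ s b) (Icc a b) := by
  intro s hs t ht hst
  have := h.svc_add ha hb hc hm hs ht (right_mem_Icc.2 (hs.1.trans hs.2))
  have := svc_nonneg (ζ := ζ) hst
  show svc ζ t b ≤ svc ζ s b
  linarith

lemma Setting.Lim.le_svc_mul_tail (hab : a ≤ b) :
    (b - a) * (1 - S.α * svc ζ a b) ≤ svc ζ a b * tail (ζ a) 0 := by
  have haI : a ∈ Icc 0 L := ⟨ha, hab.trans hb⟩
  have hbI : b ∈ Icc 0 L := ⟨ha.trans hab, hb⟩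
  have hν := S.hν
  have hma := (h.mf a haI).1
  have hα := S.hα
  have hS0 : 0 ≤ svc ζ a b := svc_nonneg hab
  have h1 := h.pair_pos_eq ha hb hc hm hab
  have h2 : pair pos (ζ b) = pair pos (ζ a) := by
    rw [PSQ.pair_pos_eq (h.mf b hbI), PSQ.pair_pos_eq (h.mf a haI), h.workload_eq hbI,
      h.workload_eq haI]
  have hpi : ∀ (μ : Measure ℝ) (u : ℝ), IsFiniteMeasure μ → Integrable (fun x => x) μ →
      Integrable (fun x => pos (x - u)) μ := fun μ u _ hi =>
    (hi.sub (integrable_const u)).pos_part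
  have h3 : pair pos (ζ a) - pair (fun x => pos (x - svc ζ a b)) (ζ a) ≤ svc ζ a b * tail (ζ a) 0 := by
    have e1 : svc ζ a b * tail (ζ a) 0 = ∫ x, (Ioi (0:ℝ)).indicator (fun _ => svc ζ a b) x ∂(ζ a) := by
      rw [integral_indicator measurableSet_Ioi, setIntegral_const, smul_eq_mul, mul_comm, tail]
    have hp0 := hpi (ζ a) 0 hma (h.integrable_id haI)
    simp only [sub_zero] at hp0
    rw [e1, pair, pair, ← integral_sub hp0 (hpi _ _ hma (h.integrable_id haI))]
    refine integral_mono (hp0.sub (hpi _ _ hma (h.integrable_id haI)))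
      ((integrable_const _).indicator measurableSet_Ioi) fun x => ?_
    simp only [pos]
    rcases le_or_gt x 0 with hx | hx
    · rw [indicator_of_notMem (show x ∉ Ioi 0 from not_lt.2 hx),
      max_eq_right hx, max_eq_right (by linarith), sub_self]
    · rw [indicator_of_mem (show x ∈ Ioi 0 from hx), max_eq_left hx.le]
      linarith [le_max_left (x - svc ζ a b) 0]
  have hmean : ∫ x, x ∂S.ν = 1 / S.α := by
    rw [eq_div_iff hα.ne', mul_comm]
    exact S.hcrit
  have h4 : ∀ s ∈ Icc a b, 1 / S.α - svc ζ a b ≤ pair (fun x => pos (x - svc ζ s b)) S.ν := by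
    intro s hs
    have e1 : svc ζ s b ≤ svc ζ a b :=
      h.svc_antitoneOn ha hb hc hm (left_mem_Icc.2 hab) hs hs.1
    have e2 : 1 / S.α - svc ζ a b = ∫ x, (x - svc ζ a b) ∂S.ν := by
      rw [integral_sub S.hνint (integrable_const _), hmean]
      simp
    rw [e2]
    refine integral_mono (S.hνint.sub (integrable_const _)) (hpi _ _ inferInstance S.hνint) fun x => ?_
    exact le_trans (by linarith) (le_max_left _ _)
  have h5 : AntitoneOn (fun u => pair (fun x => pos (x - u)) S.ν) univ := fun u _ w _ huw =>
    integral_mono (hpi _ _ inferInstance S.hνint) (hpi _ _ inferInstance S.hνint) fun x =>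
      max_le_max_right _ (by linarith)
  have h6 : (b - a) * (1 / S.α - svc ζ a b)
      ≤ ∫ s in a..b, pair (fun x => pos (x - svc ζ s b)) S.ν := by
    have e1 : (b - a) * (1 / S.α - svc ζ a b) = ∫ _ in a..b, (1 / S.α - svc ζ a b) := by
      rw [intervalIntegral.integral_const, smul_eq_mul]
    rw [e1]
    refine intervalIntegral.integral_mono_on hab intervalIntegrable_const ?_ h4
    have : MonotoneOn (fun s => pair (fun x => pos (x - svc ζ s b)) S.ν) (uIcc a b) := by
      rw [uIcc_of_le hab]
      exact fun s hs t ht hst => h5 (mem_univ _) (mem_univ _)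
        (h.svc_antitoneOn ha hb hc hm hs ht hst)
    exact this.intervalIntegrable
  have h7 : (b - a) * (1 - S.α * svc ζ a b) = S.α * ((b - a) * (1 / S.α - svc ζ a b)) := by
    field_simp
  rw [h7]
  have := mul_le_mul_of_nonneg_left h6 hα.le
  linarith

end busy

/-- Before the end of the time interval the limit path has no atom at the origin. -/
lemma Setting.Lim.tail_zero {S : Setting} {L : ℝ} {ζ : ℝ → Measure ℝ} {P : ℕ → Path}
    (h : S.Lim L ζ P) {a : ℝ} (ha : a ∈ Ico 0 L) : tail (ζ a) 0 = mass (ζ a) := by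
  have haI : a ∈ Icc 0 L := ⟨ha.1, ha.2.le⟩
  have hma := (h.mf a haI).1
  have hα := S.hα
  refine le_antisymm (tail_le_mass _ _) (le_of_forall_pos_le_add fun η hη => ?_)
  rcases le_or_gt (mass (ζ a)) η with h0 | h0
  · linarith [tail_nonneg (ζ a) 0]
  have hz : 0 < mass (ζ a) := hη.trans h0
  obtain ⟨δ, hδ, hd⟩ := Metric.continuousOn_iff.1 h.continuousOn_mass a haI (η / 2) (by positivity)
  set d := min (min (δ / 2) (L - a)) (η / (2 * S.α)) with hdd
  have hd0 : 0 < d := lt_min (lt_min (by positivity) (sub_pos.2 ha.2)) (by positivity)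
  have hd1 : d < δ := ((min_le_left _ _).trans (min_le_left _ _)).trans_lt (by linarith)
  have hd2 : d ≤ L - a := (min_le_left _ _).trans (min_le_right _ _)
  have hd3 : S.α * d ≤ η / 2 := by
    have : d ≤ η / (2 * S.α) := min_le_right _ _
    rw [le_div_iff₀ (by positivity)] at this
    linarith
  have hbL : a + d ≤ L := by linarith
  have hm : ∀ t ∈ Icc a (a + d), mass (ζ a) - η / 2 ≤ mass (ζ t) := fun t ht => by
    have := hd t ⟨ha.1.trans ht.1, ht.2.trans hbL⟩ (by
      rw [Real.dist_eq, abs_of_nonneg (sub_nonneg.2 ht.1)]; linarith [ht.2])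
    rw [Real.dist_eq, abs_lt] at this
    linarith
  have hc : 0 < mass (ζ a) - η / 2 := by linarith
  have hab : a ≤ a + d := by linarith
  have e1 := h.le_svc_mul_tail ha.1 hbL hc hm hab
  have e2 := svc_le hc hm le_rfl hab le_rfl
  rw [add_sub_cancel_left] at e1 e2
  rw [le_div_iff₀ hc] at e2
  have hs0 := svc_nonneg (ζ := ζ) hab
  set s := svc ζ a (a + d)
  have hs : 0 < s := by
    by_contra hcon
    have : s = 0 := le_antisymm (not_lt.1 hcon) hs0
    rw [this] at e1
    linarith
  have e3 : s * (mass (ζ a) - η / 2 - S.α * d) ≤ s * tail (ζ a) 0 := by nlinarith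
  have := le_of_mul_le_mul_left e3 hs
  linarith

end PSQ

namespace PSQ

section excess

variable (S : Setting)

lemma Setting.integral_id : ∫ x, x ∂S.ν = 1 / S.α := by
  rw [eq_div_iff S.hα.ne', mul_comm]
  exact S.hcrit

lemma Setting.measurable_measure_Ioi : Measurable fun y => S.ν (Ioi y) :=
  Antitone.measurable fun _ _ hxy => measure_mono (Ioi_subset_Ioi hxy)

lemma Setting.nuE_Iic : S.nuE (Iic 0) = 0 := by
  refine withDensity_absolutelyContinuous _ _ ?_
  rw [Measure.restrict_apply measurableSet_Iic, inter_comm, Ici_inter_Iic, Icc_self]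
  simp

lemma Setting.nuE_univ : S.nuE univ = 1 := by
  have hν := S.hν
  have hα := S.hα
  have hnn : 0 ≤ᵐ[S.ν] fun x => x := by
    have : IsMF S.ν := ⟨inferInstance, S.hνsupp⟩
    exact this.ae_nonneg
  have e1 : ∫⁻ y in Ioi 0, S.ν (Ioi y) = ENNReal.ofReal (∫ x, x ∂S.ν) := by
    rw [ofReal_integral_eq_lintegral_ofReal S.hνint hnn,
      lintegral_eq_lintegral_meas_lt _ hnn aemeasurable_id']
    rfl
  rw [Setting.nuE, nue, withDensity_apply _ MeasurableSet.univ, Measure.restrict_univ,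
    lintegral_mul_const _ S.measurable_measure_Ioi, ← setLIntegral_congr Ioi_ae_eq_Ici, e1]
  refine ENNReal.mul_inv_cancel ?_ ENNReal.ofReal_ne_top
  rw [S.integral_id]
  simpa using hα

lemma Setting.isMF_nuE : IsMF S.nuE :=
  ⟨⟨by rw [S.nuE_univ]; exact ENNReal.one_lt_top⟩,
    measure_mono_null (Iio_subset_Iic_self) S.nuE_Iic⟩

lemma Setting.mass_nuE : mass S.nuE = 1 := by rw [mass, S.nuE_univ, ENNReal.toReal_one]

lemma Setting.tail_nuE_zero : tail S.nuE 0 = 1 := by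
  have := S.isMF_nuE.1
  have h : S.nuE (Ioi 0) = S.nuE univ := by
    rw [← compl_Iic, measure_compl measurableSet_Iic (measure_ne_top _ _), S.nuE_Iic, tsub_zero]
  rw [tail, Measure.real, h, S.nuE_univ, ENNReal.toReal_one]

lemma Setting.tail_nuE_sub {x y : ℝ} (hx : 0 ≤ x) (hxy : x ≤ y) :
    tail S.nuE x - tail S.nuE y = S.α * ∫ u in x..y, tail S.ν u := by
  have := S.isMF_nuE.1
  have hν := S.hν
  have hα := S.hα
  have e1 : tail S.nuE x - tail S.nuE y = S.nuE.real (Ioc x y) := by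
    rw [tail, tail, ← measureReal_sdiff (Ioi_subset_Ioi hxy) measurableSet_Ioi, Ioi_sdiff_Ioi]
  have e2 : S.nuE (Ioc x y) = (∫⁻ u in Ioc x y, S.ν (Ioi u)) * ENNReal.ofReal S.α := by
    rw [Setting.nuE, nue, withDensity_apply _ measurableSet_Ioc,
      lintegral_mul_const _ S.measurable_measure_Ioi, Measure.restrict_restrict measurableSet_Ioc,
      inter_eq_left.2 (show Ioc x y ⊆ Ici 0 from fun u hu => hx.trans hu.1.le), S.integral_id]
    congr 1
    rw [one_div, ENNReal.ofReal_inv_of_pos hα, inv_inv]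
  rw [e1, Measure.real, e2, ENNReal.toReal_mul, ENNReal.toReal_ofReal hα.le, mul_comm,
    intervalIntegral.integral_of_le hxy]
  congr 1
  exact (integral_toReal S.measurable_measure_Ioi.aemeasurable
    (Eventually.of_forall fun u => measure_lt_top _ _)).symm

lemma Setting.tail_nuE_sub_le {x y : ℝ} (hx : 0 ≤ x) (hxy : x ≤ y) :
    tail S.nuE x - tail S.nuE y ≤ S.α * (y - x) := by
  have hν := S.hν
  rw [S.tail_nuE_sub hx hxy]
  refine mul_le_mul_of_nonneg_left ?_ S.hα.le
  have := intervalIntegral.norm_integral_le_of_norm_le_const (a := x) (b := y) (C := 1)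
    (f := tail S.ν) fun u _ => by
      rw [Real.norm_eq_abs, abs_of_nonneg (tail_nonneg _ _)]
      exact measureReal_le_one
  rw [abs_of_nonneg (sub_nonneg.2 hxy), one_mul] at this
  exact (le_abs_self _).trans this

end excess

section busy

variable {S : Setting} {L : ℝ} {ζ : ℝ → Measure ℝ} {P : ℕ → Path} (h : S.Lim L ζ P)
  {a b c : ℝ} (ha : 0 ≤ a) (hb : b ≤ L) (hc : 0 < c) (hm : ∀ t ∈ Icc a b, c ≤ mass (ζ t))
include h ha hb hc hm

lemma Setting.Lim.tail_nuE_sub_svc (hab : a ≤ b) {x : ℝ} (hx : 0 ≤ x) :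
    tail S.nuE x - tail S.nuE (x + svc ζ a b)
      = S.α * ∫ s in a..b, (mass (ζ s))⁻¹ * tail S.ν (x + svc ζ s b) := by
  have hS0 : 0 ≤ svc ζ a b := svc_nonneg hab
  rw [S.tail_nuE_sub hx (by linarith)]
  congr 1
  have hI := h.intervalIntegrable_inv_mass ha hb hc hm (left_mem_Icc.2 hab) (right_mem_Icc.2 hab)
  have hsv : ∀ s ∈ Icc a b, x + svc ζ s b = x + svc ζ a b - svc ζ a s := fun s hs => by
    rw [← h.svc_add ha hb hc hm (left_mem_Icc.2 hab) hs (right_mem_Icc.2 hab)]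
    ring
  have key := intervalIntegral.integral_deriv_smul_comp_of_deriv_nonpos (a := a) (b := b)
    (f := fun s => x + svc ζ a b - svc ζ a s) (f' := fun s => -(mass (ζ s))⁻¹) (g := tail S.ν) ?_ ?_ ?_
  · have haa : svc ζ a a = 0 := intervalIntegral.integral_same
    simp only [haa, sub_zero, add_sub_cancel_right, Function.comp_apply, smul_eq_mul] at key
    rw [intervalIntegral.integral_symm, ← key, ← intervalIntegral.integral_neg]
    refine intervalIntegral.integral_congr fun s hs => ?_
    rw [uIcc_of_le hab] at hs
    simp only [hsv s hs, neg_mul, neg_neg]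
  · rw [uIcc_of_le hab]
    refine continuousOn_const.sub ?_
    have := intervalIntegral.continuousOn_primitive_interval' hI left_mem_uIcc
    rwa [uIcc_of_le hab] at this
  · rw [min_eq_left hab, max_eq_right hab]
    intro s hs
    refine HasDerivAt.const_sub _ ?_
    have hcs : ContinuousAt (fun u => (mass (ζ u))⁻¹) s :=
      (h.continuousOn_inv_mass ha hb hc hm).continuousAt (Icc_mem_nhds hs.1 hs.2)
    refine intervalIntegral.integral_hasDerivAt_right
      (h.intervalIntegrable_inv_mass ha hb hc hm (left_mem_Icc.2 hab) ⟨hs.1.le, hs.2.le⟩) ?_ hcs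
    exact ((h.continuousOn_inv_mass ha hb hc hm).mono Ioo_subset_Icc_self).stronglyMeasurableAtFilter
      isOpen_Ioo s hs
  · exact fun s _ => neg_nonpos.2 (inv_nonneg.2 (mass_nonneg _))

/-- The deviation of the tails from a multiple of the excess lifetime distribution grows at most
by the relative deviation of the masses. -/
lemma Setting.Lim.abs_tail_sub_le (hab : a ≤ b) {x : ℝ} (hx : 0 ≤ x) (e : ℝ) :
    |tail (ζ b) x - e * tail S.nuE x|
      ≤ |tail (ζ a) (x + svc ζ a b) - e * tail S.nuE (x + svc ζ a b)|
        + S.α / c * ∫ s in a..b, |mass (ζ s) - e| := by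
  have hν := S.hν
  have hα := S.hα
  have h1 := h.tail_eq ha hb hc hm hab hx
  have h2 := h.tail_nuE_sub_svc ha hb hc hm hab hx
  have hI := h.continuousOn_inv_mass ha hb hc hm
  have hTi : IntervalIntegrable (fun s => tail S.ν (x + svc ζ s b)) volume a b := by
    have : MonotoneOn (fun s => tail S.ν (x + svc ζ s b)) (uIcc a b) := by
      rw [uIcc_of_le hab]
      intro s hs t ht hst
      have := h.svc_antitoneOn ha hb hc hm hs ht hst
      exact tail_antitone _ (by simp only at this; linarith)
    exact this.intervalIntegrable
  have hTi' : IntervalIntegrable (fun s => (mass (ζ s))⁻¹ * tail S.ν (x + svc ζ s b)) volume a b :=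
    hTi.continuousOn_mul (by rwa [uIcc_of_le hab])
  have hmi : IntervalIntegrable (fun s => |mass (ζ s) - e|) volume a b := by
    refine ContinuousOn.intervalIntegrable ?_
    rw [uIcc_of_le hab]
    exact ((h.continuousOn_mass.mono (Icc_subset_Icc ha hb)).sub continuousOn_const).abs
  have h3 : tail (ζ b) x - e * tail S.nuE x
      = (tail (ζ a) (x + svc ζ a b) - e * tail S.nuE (x + svc ζ a b))
      + S.α * ∫ s in a..b, (tail S.ν (x + svc ζ s b)
        - e * ((mass (ζ s))⁻¹ * tail S.ν (x + svc ζ s b))) := by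
    rw [intervalIntegral.integral_sub hTi (hTi'.const_mul e), intervalIntegral.integral_const_mul, h1,
      sub_eq_iff_eq_add'.1 h2]
    ring
  rw [h3]
  refine (abs_add_le _ _).trans (add_le_add le_rfl ?_)
  rw [abs_mul, abs_of_pos hα, div_mul_eq_mul_div, mul_div_assoc]
  refine mul_le_mul_of_nonneg_left ?_ hα.le
  rw [← intervalIntegral.integral_div]
  refine (intervalIntegral.abs_integral_le_integral_abs hab).trans ?_
  refine intervalIntegral.integral_mono_on hab (hTi.sub (hTi'.const_mul e)).abs (hmi.div_const c) ?_
  intro s hs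
  have hz := hc.trans_le (hm s hs)
  have e1 : tail S.ν (x + svc ζ s b) - e * ((mass (ζ s))⁻¹ * tail S.ν (x + svc ζ s b))
      = (mass (ζ s) - e) * (mass (ζ s))⁻¹ * tail S.ν (x + svc ζ s b) := by
    field_simp
  rw [e1, abs_mul, abs_mul, abs_of_pos (inv_pos.2 hz), abs_of_nonneg (tail_nonneg _ _), div_eq_mul_inv]
  calc |mass (ζ s) - e| * (mass (ζ s))⁻¹ * tail S.ν (x + svc ζ s b)
      ≤ |mass (ζ s) - e| * (mass (ζ s))⁻¹ * 1 :=
        mul_le_mul_of_nonneg_left measureReal_le_one (by positivity)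
    _ ≤ |mass (ζ s) - e| * c⁻¹ := by
        rw [mul_one]
        exact mul_le_mul_of_nonneg_left (inv_anti₀ hc (hm s hs)) (abs_nonneg _)

end busy

end PSQ

namespace PSQ

lemma pair_comp_min_eq {ζ : Measure ℝ} (hζ : IsMF ζ) {f : ℝ → ℝ} (hf : ContDiff ℝ 1 f) {C : ℝ}
    (hC : ∀ x, |deriv f x| ≤ C) {X : ℝ} (hX : 0 ≤ X) :
    pair (fun y => f (min y X)) ζ = f 0 * mass ζ + ∫ x in 0..X, deriv f x * tail ζ x := by
  have := hζ.1
  have hfc : Continuous (deriv f) := hf.continuous_deriv le_rfl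
  have hC0 : 0 ≤ C := (abs_nonneg _).trans (hC 0)
  set G : ℝ → ℝ → ℝ := fun y x => (Iio y).indicator (deriv f) x with hG
  have hGb : ∀ y x, |G y x| ≤ C := fun y x => by
    by_cases hx : x ∈ Iio y
    · simpa only [hG, indicator_of_mem hx] using hC x
    · simpa only [hG, indicator_of_notMem hx, abs_zero] using hC0
  have e1 : ∀ y, 0 ≤ y → f (min y X) = f 0 + ∫ x in Ioc 0 X, G y x := by
    intro y hy
    have h0 : ∫ x in Ioc 0 X, G y x = ∫ x in (0:ℝ)..(min y X), deriv f x := by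
      rw [setIntegral_indicator measurableSet_Iio,
        intervalIntegral.integral_of_le (le_min hy hX), integral_Ioc_eq_integral_Ioo,
        ← integral_Ioc_eq_integral_Ioo]
      refine setIntegral_congr_set ?_
      have : Ioc 0 (min y X) =ᵐ[volume] Ioo 0 (min y X) := Ioo_ae_eq_Ioc.symm
      refine EventuallyEq.trans ?_ this.symm
      have h2 : (Ioo 0 X ∩ Iio y : Set ℝ) = Ioo 0 (min y X) := by
        ext u
        simp only [mem_inter_iff, mem_Ioo, mem_Iio, lt_min_iff]
        tauto
      rw [← h2]
      exact Ioo_ae_eq_Ioc.symm.inter (ae_eq_refl _)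
    rw [h0, intervalIntegral.integral_deriv_eq_sub (fun x _ => hf.differentiable one_ne_zero x)
      (hfc.intervalIntegrable _ _)]
    ring
  have hinteg : Integrable (Function.uncurry G) (ζ.prod (volume.restrict (Ioc 0 X))) := by
    refine Integrable.of_bound (C := C) (Measurable.aestronglyMeasurable ?_)
      (Eventually.of_forall fun z => hGb z.1 z.2)
    have : Function.uncurry G = {z : ℝ × ℝ | z.2 < z.1}.indicator fun z => deriv f z.2 := by
      funext z
      simp only [Function.uncurry, hG, indicator, mem_Iio, mem_ofPred_eq]
    rw [this]
    exact (hfc.measurable.comp measurable_snd).indicator (measurableSet_lt measurable_snd measurable_fst)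
  have e2 : pair (fun y => f (min y X)) ζ = ∫ y, (f 0 + ∫ x in Ioc 0 X, G y x) ∂ζ := by
    refine integral_congr_ae ?_
    filter_upwards [hζ.ae_nonneg] with y hy using e1 y hy
  have hinteg' : Integrable (fun y => ∫ x in Ioc 0 X, G y x) ζ := hinteg.integral_prod_left
  rw [e2, integral_add (integrable_const _) hinteg', integral_integral_swap hinteg,
    intervalIntegral.integral_of_le hX]
  congr 1
  · rw [integral_const, smul_eq_mul, mul_comm]
    rfl
  · refine integral_congr_ae (Eventually.of_forall fun x => ?_)
    have : (fun y => G y x) = (Ioi x).indicator fun _ => deriv f x := by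
      funext y
      simp only [hG, indicator, mem_Iio, mem_Ioi]
    simp only [this]
    rw [integral_indicator measurableSet_Ioi, setIntegral_const, smul_eq_mul, mul_comm, tail]

lemma intervalIntegrable_deriv_mul_tail {f : ℝ → ℝ} (hf : ContDiff ℝ 1 f) (ζ : Measure ℝ)
    [IsFiniteMeasure ζ] (X Y : ℝ) :
    IntervalIntegrable (fun x => deriv f x * tail ζ x) volume X Y :=
  (tail_antitone ζ).intervalIntegrable.continuousOn_mul (hf.continuous_deriv le_rfl).continuousOn

/-- Closeness of masses and tails controls integrals of smooth functions frozen beyond `X`. -/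
lemma abs_pair_comp_min_sub_le {ζ ξ : Measure ℝ} (hζ : IsMF ζ) (hξ : IsMF ξ) {f : ℝ → ℝ}
    (hf : ContDiff ℝ 1 f) {C : ℝ} (hC : ∀ x, |deriv f x| ≤ C) {X Y : ℝ} (hY : 0 ≤ Y) (hXY : Y ≤ X)
    (hd : ∀ x ∈ Ioo 0 Y, deriv f x = 0) {η : ℝ} 
    (ht : ∀ x, 0 ≤ x → |tail ζ x - tail ξ x| ≤ η) :
    |pair (fun y => f (min y X)) ζ - pair (fun y => f (min y X)) ξ|
      ≤ |f 0| * |mass ζ - mass ξ| + C * η * (X - Y) := by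
  have := hζ.1
  have := hξ.1
  have hC0 : 0 ≤ C := (abs_nonneg _).trans (hC 0)
  have hz : ∀ ρ : Measure ℝ, ∫ x in (0:ℝ)..Y, deriv f x * tail ρ x = 0 := fun ρ => by
    rw [intervalIntegral.integral_of_le hY, integral_Ioc_eq_integral_Ioo]
    refine (setIntegral_congr_fun measurableSet_Ioo fun x hx => ?_).trans (integral_zero _ _)
    simp only [hd x hx, zero_mul]
  have hs : ∀ ρ : Measure ℝ, IsFiniteMeasure ρ → ∫ x in (0:ℝ)..X, deriv f x * tail ρ x
      = ∫ x in Y..X, deriv f x * tail ρ x := fun ρ _ => by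
    rw [← intervalIntegral.integral_add_adjacent_intervals
      (intervalIntegrable_deriv_mul_tail hf ρ 0 Y) (intervalIntegrable_deriv_mul_tail hf ρ Y X),
      hz, zero_add]
  rw [pair_comp_min_eq hζ hf hC (hY.trans hXY), pair_comp_min_eq hξ hf hC (hY.trans hXY), hs ζ hζ.1,
    hs ξ hξ.1, add_sub_add_comm, ← mul_sub, ← intervalIntegral.integral_sub
      (intervalIntegrable_deriv_mul_tail hf ζ _ _) (intervalIntegrable_deriv_mul_tail hf ξ _ _)]
  refine (abs_add_le _ _).trans (add_le_add (abs_mul _ _).le ?_)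
  have := intervalIntegral.norm_integral_le_of_norm_le_const (a := Y) (b := X) (C := C * η)
    (f := fun x => deriv f x * tail ζ x - deriv f x * tail ξ x) fun x hx => by
      rw [uIoc_of_le hXY] at hx
      rw [← mul_sub, Real.norm_eq_abs, abs_mul]
      exact mul_le_mul (hC x) (ht x (hY.trans hx.1.le)) (abs_nonneg _) hC0
  rwa [abs_of_nonneg (sub_nonneg.2 hXY)] at this

lemma abs_pair_sub_comp_min_le {ζ : Measure ℝ} [IsFiniteMeasure ζ] {f : ℝ → ℝ} (hf : Continuous f)
    (h01 : ∀ x, 0 ≤ f x ∧ f x ≤ 1) (X : ℝ) :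
    |pair f ζ - pair (fun y => f (min y X)) ζ| ≤ tail ζ X := by
  have hb : ∀ x, |f x| ≤ 1 := fun x => abs_le.2 ⟨by linarith [(h01 x).1], (h01 x).2⟩
  have i1 : Integrable f ζ := integrable_of_bdd hf.measurable hb
  have i2 : Integrable (fun y => f (min y X)) ζ :=
    integrable_of_bdd (hf.comp (continuous_id.min continuous_const)).measurable fun _ => hb _
  have e1 : tail ζ X = ∫ x, (Ioi X).indicator 1 x ∂ζ := (integral_indicator_one measurableSet_Ioi).symm
  rw [pair, pair, ← integral_sub i1 i2, e1]
  refine abs_integral_le_integral_abs.trans (integral_mono (i1.sub i2).abs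
    ((integrable_const (1:ℝ)).indicator measurableSet_Ioi) fun x => ?_)
  rcases le_or_gt x X with hx | hx
  · simp only [min_eq_left hx, sub_self, abs_zero, indicator_of_notMem (show x ∉ Ioi X from not_lt.2 hx),
      le_refl]
  · simp only [indicator_of_mem (show x ∈ Ioi X from hx), Pi.one_apply]
    rw [abs_le]
    constructor <;> linarith [(h01 x).1, (h01 x).2, (h01 (min x X)).1, (h01 (min x X)).2]

lemma tendsto_tail_atTop (ζ : Measure ℝ) [IsFiniteMeasure ζ] : Tendsto (tail ζ) atTop (nhds 0) := by
  have h1 : Tendsto (fun x : ℝ => ζ (Ioi x)) atTop (nhds (ζ (⋂ x : ℝ, Ioi x))) :=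
    tendsto_measure_iInter_atTop (fun _ => measurableSet_Ioi.nullMeasurableSet)
      (fun _ _ hxy => Ioi_subset_Ioi hxy) ⟨0, measure_ne_top _ _⟩
  have h2 : (⋂ x : ℝ, Ioi x) = ∅ := by
    ext y
    simp only [mem_iInter, mem_Ioi, mem_empty_iff_false, iff_false, not_forall, not_lt]
    exact ⟨y, le_rfl⟩
  rw [h2, measure_empty] at h1
  exact (ENNReal.tendsto_toReal ENNReal.zero_ne_top).comp h1

variable (S : Setting)

lemma Setting.tail_nuE_of_nonpos {x : ℝ} (hx : x ≤ 0) : tail S.nuE x = 1 := by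
  have := S.isMF_nuE.1
  refine le_antisymm ((tail_le_mass _ _).trans S.mass_nuE.le) ?_
  rw [← S.tail_nuE_zero]
  exact tail_antitone _ hx

lemma Setting.tail_nuE_sub_le_mul {x y : ℝ} (hxy : x ≤ y) :
    tail S.nuE x - tail S.nuE y ≤ S.α * (y - x) := by
  have hα := S.hα
  rcases le_total 0 x with hx | hx
  · exact S.tail_nuE_sub_le hx hxy
  rw [S.tail_nuE_of_nonpos hx]
  rcases le_total 0 y with hy | hy
  · have := S.tail_nuE_sub_le le_rfl hy
    rw [S.tail_nuE_zero] at this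
    nlinarith
  · rw [S.tail_nuE_of_nonpos hy, sub_self]
    exact mul_nonneg hα.le (by linarith)

lemma isMF_smul_nuE (e : ℝ) : IsMF (ENNReal.ofReal e • S.nuE) := by
  have := S.isMF_nuE.1
  refine ⟨S.nuE.smul_finite ENNReal.ofReal_ne_top, ?_⟩
  rw [Measure.smul_apply, S.isMF_nuE.2, smul_zero]

/-- Closeness of masses and tails to a multiple of the excess lifetime distribution implies
closeness in the metric. -/
lemma Setting.exists_dmet_le (C : ℝ) {ε : ℝ} (hε : 0 < ε) : ∃ η > 0, ∀ ζ : Measure ℝ, IsMF ζ →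
    ∀ e ∈ Icc 0 C, |mass ζ - e| ≤ η → (∀ x, 0 ≤ x → |tail ζ x - e * tail S.nuE x| ≤ η) →
      dmet S.gmet S.hmet ζ (ENNReal.ofReal e • S.nuE) ≤ ε := by
  by_contra! hcon
  have hη : ∀ n : ℕ, (0:ℝ) < 1 / (n + 1) := fun n => by positivity
  choose ζ hζ e he hm ht hd using fun n : ℕ => hcon _ (hη n)
  have hξ := fun n => isMF_smul_nuE S (e n)
  have hη0 : Tendsto (fun n : ℕ => 1 / ((n:ℝ) + 1)) atTop (nhds 0) := tendsto_one_div_add_atTop_nhds_zero_nat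
  have hm' : ∀ n, |mass (ζ n) - mass (ENNReal.ofReal (e n) • S.nuE)| ≤ 1 / (n + 1) := fun n => by
    rw [mass_smul, S.mass_nuE, mul_one, ENNReal.toReal_ofReal (he n).1]
    exact hm n
  have ht' : ∀ n x, 0 ≤ x → |tail (ζ n) x - tail (ENNReal.ofReal (e n) • S.nuE) x| ≤ 1 / (n + 1) :=
    fun n x hx => by
      rw [tail_smul, ENNReal.toReal_ofReal (he n).1]
      exact ht n x hx
  have hg : ∀ k, Tendsto (fun n => pair (S.gmet k) (ζ n)
      - pair (S.gmet k) (ENNReal.ofReal (e n) • S.nuE)) atTop (nhds 0) := by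
    intro k
    obtain ⟨h01, hcd, D, hD⟩ := S.hmetfam.1 k
    have hEf := S.isMF_nuE.1
    rw [Metric.tendsto_atTop']
    intro θ hθ
    have hCt : Tendsto (fun X => 2 * (C * tail S.nuE X)) atTop (nhds 0) := by
      simpa using ((tendsto_tail_atTop S.nuE).const_mul C).const_mul 2
    obtain ⟨X, hX, hX0⟩ := ((hCt.eventually_lt_const (half_pos hθ)).and (eventually_ge_atTop 0)).exists
    have hlim : Tendsto (fun n : ℕ => |S.gmet k 0| * (1 / ((n:ℝ) + 1)) + D * (1 / ((n:ℝ) + 1)) * (X - 0)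
        + 1 / ((n:ℝ) + 1)) atTop (nhds 0) := by
      simpa using ((hη0.const_mul |S.gmet k 0|).add ((hη0.const_mul D).mul_const (X - 0))).add hη0
    obtain ⟨N, hN⟩ := (hlim.eventually_lt_const (half_pos hθ)).exists_forall_of_atTop
    refine ⟨N, fun n hn => ?_⟩
    have := (hζ n).1
    have := (hξ n).1
    rw [Real.dist_eq, sub_zero]
    have b1 := abs_pair_sub_comp_min_le (ζ := ζ n) hcd.continuous h01 X
    have b2 := abs_pair_sub_comp_min_le (ζ := ENNReal.ofReal (e n) • S.nuE) hcd.continuous h01 X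
    have b3 := abs_pair_comp_min_sub_le (hζ n) (hξ n) hcd hD le_rfl hX0 (by simp) (ht' n)
    have b4 := mul_le_mul_of_nonneg_left (hm' n) (abs_nonneg (S.gmet k 0))
    have b5 := (abs_le.1 (ht n X hX0)).2
    rw [tail_smul, ENNReal.toReal_ofReal (he n).1] at b2
    have b6 : e n * tail S.nuE X ≤ C * tail S.nuE X :=
      mul_le_mul_of_nonneg_right (he n).2 (tail_nonneg _ _)
    have b7 := hN n hn.le
    rw [abs_le] at b1 b2 b3
    refine abs_lt.2 ⟨?_, ?_⟩ <;> linarith [b1.1, b1.2, b2.1, b2.2, b3.1, b3.2]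
  have hh : ∀ n, (⨆ k : ℕ, |pair (S.hmet k) (ζ n)
      - pair (S.hmet k) (ENNReal.ofReal (e n) • S.nuE)|) ≤ 2 * (1 / ((n:ℝ) + 1)) := by
    intro n
    refine ciSup_le fun k => ?_
    obtain ⟨-, hcd, h0, h1, hD⟩ := S.hmetfam.2.1 k
    have hk : (0:ℝ) ≤ k := k.cast_nonneg
    have heq : ∀ ρ : Measure ℝ, pair (S.hmet k) ρ = pair (fun y => S.hmet k (min y (k+1))) ρ := by
      intro ρ
      congr 1
      funext y
      rcases le_or_gt y (k+1) with hy | hy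
      · rw [min_eq_left hy]
      · rw [min_eq_right hy.le, h1 _ hy.le, h1 _ le_rfl]
    have hd0 : ∀ x ∈ Ioo (0:ℝ) k, deriv (S.hmet k) x = 0 := fun x hx => by
      have : S.hmet k =ᶠ[nhds x] fun _ => 0 := by
        filter_upwards [Ioo_mem_nhds hx.1 hx.2] with y hy using h0 y ⟨hy.1.le, hy.2.le⟩
      rw [this.deriv_eq, deriv_const]
    have := abs_pair_comp_min_sub_le (hζ n) (hξ n) hcd hD hk (by linarith : (k:ℝ) ≤ k + 1) hd0 (ht' n)
    rw [h0 0 ⟨le_rfl, hk⟩, abs_zero, zero_mul, zero_add, add_sub_cancel_left, mul_one] at this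
    rwa [heq, heq]
  have hsum : Tendsto (fun n => ∑' k : ℕ, (2:ℝ)⁻¹^(k+1) * min |pair (S.gmet k) (ζ n)
      - pair (S.gmet k) (ENNReal.ofReal (e n) • S.nuE)| 1) atTop (nhds 0) := by
    have hs : Summable fun k : ℕ => (2:ℝ)⁻¹^(k+1) :=
      (summable_nat_add_iff 1).2 (summable_geometric_of_lt_one (by norm_num) (by norm_num))
    have := tendsto_tsum_of_dominated_convergence (𝓕 := atTop)
      (f := fun (n : ℕ) (k : ℕ) => (2:ℝ)⁻¹^(k+1) * min |pair (S.gmet k) (ζ n)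
        - pair (S.gmet k) (ENNReal.ofReal (e n) • S.nuE)| 1) (g := fun _ => (0:ℝ)) hs
      (fun k => ?_) (Eventually.of_forall fun n k => ?_)
    · simpa using this
    · have := (((hg k).abs).min (tendsto_const_nhds (x := (1:ℝ)))).const_mul ((2:ℝ)⁻¹^(k+1))
      simpa using this
    · rw [Real.norm_eq_abs, abs_of_nonneg (by positivity)]
      exact mul_le_of_le_one_right (by positivity) (min_le_right _ _)
  have hfin : Tendsto (fun n => (∑' k : ℕ, (2:ℝ)⁻¹^(k+1) * min |pair (S.gmet k) (ζ n)
      - pair (S.gmet k) (ENNReal.ofReal (e n) • S.nuE)| 1) + 2 * (1 / ((n:ℝ) + 1))) atTop (nhds 0) := by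
    simpa using hsum.add (hη0.const_mul 2)
  obtain ⟨n, hn⟩ := (hfin.eventually_lt_const hε).exists
  have h1 := hd n
  have h2 := hh n
  unfold dmet at h1
  linarith

end PSQ

namespace PSQ

/-- The piecewise linear function rising from `0` at `x` to `1` at `x + w`. -/
noncomputable def rise (x w y : ℝ) : ℝ := max 0 (min ((y - x) / w) 1)

lemma continuous_rise (x w : ℝ) : Continuous (rise x w) := by
  unfold rise
  fun_prop

lemma rise_nonneg (x w y : ℝ) : 0 ≤ rise x w y := le_max_left _ _

lemma rise_le_one (x w y : ℝ) : rise x w y ≤ 1 := max_le zero_le_one (min_le_right _ _)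

lemma abs_rise_le (x w y : ℝ) : |rise x w y| ≤ 1 := by
  rw [abs_of_nonneg (rise_nonneg _ _ _)]
  exact rise_le_one _ _ _

lemma pair_rise_le (ζ : Measure ℝ) [IsFiniteMeasure ζ] (x : ℝ) {w : ℝ} (hw : 0 < w) :
    pair (rise x w) ζ ≤ tail ζ x := by
  have e1 : tail ζ x = ∫ y, (Ioi x).indicator 1 y ∂ζ := (integral_indicator_one measurableSet_Ioi).symm
  rw [e1]
  refine integral_mono (integrable_of_bdd (continuous_rise x w).measurable (abs_rise_le x w))
    ((integrable_const (1:ℝ)).indicator measurableSet_Ioi) fun y => ?_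
  rcases le_or_gt y x with hy | hy
  · rw [indicator_of_notMem (show y ∉ Ioi x from not_lt.2 hy)]
    exact max_le le_rfl ((min_le_left _ _).trans (div_nonpos_of_nonpos_of_nonneg (by linarith) hw.le))
  · rw [indicator_of_mem (show y ∈ Ioi x from hy)]
    exact rise_le_one _ _ _

lemma tail_le_pair_rise (ζ : Measure ℝ) [IsFiniteMeasure ζ] (x : ℝ) {w : ℝ} (hw : 0 < w) :
    tail ζ (x + w) ≤ pair (rise x w) ζ := by
  have e1 : tail ζ (x + w) = ∫ y, (Ioi (x + w)).indicator 1 y ∂ζ :=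
    (integral_indicator_one measurableSet_Ioi).symm
  rw [e1]
  refine integral_mono ((integrable_const (1:ℝ)).indicator measurableSet_Ioi)
    (integrable_of_bdd (continuous_rise x w).measurable (abs_rise_le x w)) fun y => ?_
  rcases le_or_gt y (x + w) with hy | hy
  · rw [indicator_of_notMem (show y ∉ Ioi (x + w) from not_lt.2 hy)]
    exact rise_nonneg _ _ _
  · rw [indicator_of_mem (show y ∈ Ioi (x + w) from hy)]
    have : 1 ≤ (y - x) / w := by
      rw [le_div_iff₀ hw]
      linarith
    exact (le_min this le_rfl).trans (le_max_right _ _)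

variable (S : Setting)

/-- Weak convergence to a multiple of the excess lifetime distribution makes the tails converge
uniformly. -/
lemma Setting.eventually_tail_close {ζ : ℕ → Measure ℝ} (hζ : ∀ n, IsMF (ζ n)) {e : ℝ} (he : 0 ≤ e)
    (hw : ∀ f : ℝ → ℝ, Continuous f → (∃ C, ∀ x, |f x| ≤ C) →
      Tendsto (fun n => pair f (ζ n)) atTop (nhds (e * pair f S.nuE))) {η : ℝ} (hη : 0 < η) :
    ∀ᶠ n in atTop, ∀ x, 0 ≤ x → |tail (ζ n) x - e * tail S.nuE x| ≤ η := by
  have hα := S.hα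
  have hE := S.isMF_nuE.1
  set w := η / (4 * S.α * (e + 1)) with hwd
  have hw0 : 0 < w := by positivity
  have hwe : e * (S.α * (2 * w)) ≤ η / 2 := by
    have : S.α * (2 * w) * (e + 1) = η / 2 := by
      rw [hwd]
      field_simp
      norm_num
    nlinarith [mul_pos hα hw0]
  obtain ⟨K, hK⟩ : ∃ K : ℕ, e * tail S.nuE ((K - 1) * w) ≤ η / 2 := by
    have h1 : Tendsto (fun K : ℕ => ((K:ℝ) - 1) * w) atTop atTop :=
      (tendsto_atTop_add_const_right _ (-1) tendsto_natCast_atTop_atTop).atTop_mul_const hw0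
    have h2 : Tendsto (fun K : ℕ => e * tail S.nuE (((K:ℝ) - 1) * w)) atTop (nhds 0) := by
      simpa using ((tendsto_tail_atTop S.nuE).comp h1).const_mul e
    obtain ⟨K, hK⟩ := (h2.eventually_lt_const (half_pos hη)).exists
    exact ⟨K, hK.le⟩
  have hgrid : ∀ᶠ n in atTop, ∀ i ∈ Finset.range (K + 3),
      |pair (rise ((i - 1) * w) w) (ζ n) - e * pair (rise ((i - 1) * w) w) S.nuE| < η / 2 := by
    refine (Finset.eventually_all _).2 fun i _ => ?_
    have := hw (rise ((i - 1) * w) w) (continuous_rise _ _) ⟨1, abs_rise_le _ _⟩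
    exact (Metric.tendsto_nhds.1 this) _ (half_pos hη)
  filter_upwards [hgrid] with n hn x hx
  have := (hζ n).1
  set i := ⌊x / w⌋₊ with hi
  have hi1 : i * w ≤ x := by
    have := Nat.floor_le (div_nonneg hx hw0.le)
    rwa [le_div_iff₀ hw0] at this
  have hi2 : x < (i + 1) * w := by
    have := Nat.lt_floor_add_one (x / w)
    rwa [div_lt_iff₀ hw0] at this
  have hup : ∀ j : ℕ, j ≤ K → j * w ≤ x → tail (ζ n) x ≤ e * tail S.nuE ((j - 1) * w) + η / 2 := by
    intro j hj hjx
    have h1 := (abs_lt.1 (hn j (Finset.mem_range.2 (by omega)))).2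
    have h2 := tail_le_pair_rise (ζ n) ((j - 1) * w) hw0
    have h3 := mul_le_mul_of_nonneg_left (pair_rise_le S.nuE ((j - 1) * w) hw0) he
    have h4 : tail (ζ n) x ≤ tail (ζ n) ((j - 1) * w + w) := tail_antitone _ (by linarith)
    linarith
  rw [abs_le]
  rcases le_or_gt i K with hiK | hiK
  · have h1 := hup i hiK hi1
    have h2 := S.tail_nuE_sub_le_mul (x := (i - 1) * w) (y := x) (by linarith)
    have h3 : S.α * (x - (i - 1) * w) ≤ S.α * (2 * w) := mul_le_mul_of_nonneg_left (by linarith) hα.le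
    have h4 := mul_le_mul_of_nonneg_left (h2.trans h3) he
    have k1 := (abs_lt.1 (hn (i + 2) (Finset.mem_range.2 (by omega)))).1
    have hc : (((i + 2 : ℕ) : ℝ) - 1) * w = (i + 1) * w := by push_cast; ring
    rw [hc] at k1
    have k2 := pair_rise_le (ζ n) ((i + 1) * w) hw0
    have k3 := mul_le_mul_of_nonneg_left (tail_le_pair_rise S.nuE ((i + 1) * w) hw0) he
    have k4 : tail (ζ n) ((i + 1) * w) ≤ tail (ζ n) x := tail_antitone _ hi2.le
    have k5 := S.tail_nuE_sub_le_mul (x := x) (y := (i + 1) * w + w) (by linarith)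
    have k6 : S.α * ((i + 1) * w + w - x) ≤ S.α * (2 * w) := mul_le_mul_of_nonneg_left (by linarith) hα.le
    have k7 := mul_le_mul_of_nonneg_left (k5.trans k6) he
    constructor <;> linarith
  · have hKx : K * w ≤ x := by
      have : (K:ℝ) ≤ i := by exact_mod_cast hiK.le
      nlinarith
    have h1 := hup K le_rfl hKx
    have h2 := mul_le_mul_of_nonneg_left (tail_antitone S.nuE (show ((K:ℝ) - 1) * w ≤ x by linarith)) he
    have h3 := tail_nonneg (ζ n) x
    have h4 := mul_nonneg he (tail_nonneg S.nuE x)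
    constructor <;> linarith

/-- Closeness in the metric to a multiple of the excess lifetime distribution implies closeness of
masses and tails. -/
lemma Setting.exists_tail_close (C : ℝ) {η : ℝ} (hη : 0 < η) : ∃ δ > 0, ∀ ζ : Measure ℝ, IsMF ζ →
    ∀ e ∈ Icc 0 C, dmet S.gmet S.hmet ζ (ENNReal.ofReal e • S.nuE) ≤ δ →
      |mass ζ - e| ≤ η ∧ ∀ x, 0 ≤ x → |tail ζ x - e * tail S.nuE x| ≤ η := by
  by_contra! hcon
  choose ζ hζ e he hd ht using fun n : ℕ => hcon (1 / (n + 1)) (by positivity)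
  obtain ⟨e₀, he₀, φ, hφ, hlim⟩ := isCompact_Icc.tendsto_subseq he
  have hd' : Tendsto (fun n => dmet S.gmet S.hmet (ζ n) (ENNReal.ofReal (e n) • S.nuE)) atTop (nhds 0) :=
    squeeze_zero (fun n => dmet_nonneg _ _) hd tendsto_one_div_add_atTop_nhds_zero_nat
  have hw : ∀ f : ℝ → ℝ, Continuous f → (∃ D, ∀ x, |f x| ≤ D) →
      Tendsto (fun n => pair f (ζ (φ n))) atTop (nhds (e₀ * pair f S.nuE)) := by
    intro f hf hb
    have := tendsto_pair S.hmetfam (ζs := fun n => ζ (φ n)) (fun n => hζ (φ n)) (isMF_smul_nuE S e₀)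
      (fun k => ?_) hf hb
    · rwa [pair_smul, ENNReal.toReal_ofReal he₀.1] at this
    · have h1 := ((tendsto_pair_g_sub hd' k).comp hφ.tendsto_atTop).add
        (hlim.mul_const (pair (S.gmet k) S.nuE))
      rw [zero_add] at h1
      rw [pair_smul, ENNReal.toReal_ofReal he₀.1]
      refine h1.congr fun n => ?_
      simp only [Function.comp_apply, pair_smul, ENNReal.toReal_ofReal (he _).1, sub_add_cancel]
  have h1 := S.eventually_tail_close (fun n => hζ (φ n)) he₀.1 hw (half_pos hη)
  have h2 : Tendsto (fun n => mass (ζ (φ n)) - e (φ n)) atTop (nhds 0) := by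
    have := hw (fun _ => 1) continuous_const ⟨1, by simp⟩
    simp only [pair_const, one_mul, S.mass_nuE, mul_one] at this
    simpa using this.sub hlim
  have h3 : Tendsto (fun n => e (φ n) - e₀) atTop (nhds 0) := by
    simpa using hlim.sub_const e₀
  obtain ⟨n, hn1, hn2, hn3⟩ := (h1.and ((h2.eventually (Metric.ball_mem_nhds 0 hη)).and
    (h3.eventually (Metric.ball_mem_nhds 0 (half_pos hη))))).exists
  rw [Real.dist_eq, sub_zero] at hn2 hn3
  obtain ⟨x, hx, hx'⟩ := ht (φ n) hn2.le
  have hE := S.isMF_nuE.1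
  have h4 : tail S.nuE x ≤ 1 := (tail_le_mass _ _).trans S.mass_nuE.le
  have h5 : |(e (φ n) - e₀) * tail S.nuE x| ≤ η / 2 := by
    rw [abs_mul, abs_of_nonneg (tail_nonneg _ _)]
    exact (mul_le_of_le_one_right (abs_nonneg _) h4).trans hn3.le
  have h6 := hn1 x hx
  rw [abs_le] at h5 h6
  refine absurd hx' (not_lt.2 (abs_le.2 ⟨?_, ?_⟩)) <;> linarith [h5.1, h5.2, h6.1, h6.2]

/-- Measures of bounded mass can only be close to bounded multiples of the excess lifetime
distribution. -/
lemma Setting.exists_multiple_le (D : ℝ) : ∃ C δ : ℝ, 0 < δ ∧ ∀ ζ : Measure ℝ, IsMF ζ → mass ζ ≤ D →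
    ∀ e, 0 ≤ e → dmet S.gmet S.hmet ζ (ENNReal.ofReal e • S.nuE) ≤ δ → e ≤ C := by
  have hE := S.isMF_nuE
  obtain ⟨k, hk⟩ : ∃ k, pair (S.gmet k) S.nuE ≠ 0 := by
    by_contra! h0
    have := tendsto_pair S.hmetfam (ζs := fun _ => (0 : Measure ℝ)) (ζ := S.nuE)
      (fun _ => ⟨inferInstance, by simp⟩) hE (fun k => by rw [h0 k]; simp [pair])
      (f := fun _ => 1) continuous_const ⟨1, by simp⟩
    simp only [pair_const, S.mass_nuE, one_mul] at this
    have h1 : mass (0 : Measure ℝ) = 0 := by simp [mass]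
    rw [h1] at this
    exact zero_ne_one (tendsto_nhds_unique tendsto_const_nhds this)
  have hg := (S.hmetfam.1 k).1
  have hpos : 0 < pair (S.gmet k) S.nuE :=
    lt_of_le_of_ne (integral_nonneg fun x => (hg x).1) (Ne.symm hk)
  refine ⟨(D + 1) / pair (S.gmet k) S.nuE, (2:ℝ)⁻¹^(k+1) / 2, by positivity, ?_⟩
  intro ζ hζ hD e he hd
  have := hζ.1
  have h1 := (dmet_term_le (g := S.gmet) (h := S.hmet) ζ (ENNReal.ofReal e • S.nuE) k).trans hd
  have h2 : min |pair (S.gmet k) ζ - pair (S.gmet k) (ENNReal.ofReal e • S.nuE)| 1 ≤ 1 / 2 := by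
    have hq : (0:ℝ) < (2:ℝ)⁻¹^(k+1) := by positivity
    refine le_of_mul_le_mul_left ?_ hq
    linarith
  have h3 : |pair (S.gmet k) ζ - pair (S.gmet k) (ENNReal.ofReal e • S.nuE)| ≤ 1 / 2 := by
    rcases min_le_iff.1 h2 with h | h
    · exact h
    · norm_num at h
  rw [pair_smul, ENNReal.toReal_ofReal he] at h3
  have h4 : |pair (S.gmet k) ζ| ≤ 1 * mass ζ := abs_pair_le (Eventually.of_forall fun x =>
    abs_le.2 ⟨by linarith [(hg x).1], (hg x).2⟩)
  rw [le_div_iff₀ hpos]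
  linarith [(abs_le.1 h3).1, (abs_le.1 h4).2]

end PSQ

namespace PSQ

variable {S : Setting} {L : ℝ} {ζ : ℝ → Measure ℝ} {P : ℕ → Path} (h : S.Lim L ζ P)
include h

/-- While the mass stays above `c`, the deviation from an invariant state grows at most
exponentially. -/
lemma Setting.Lim.abs_tail_sub_le_exp {b c : ℝ} (hb : b < L) (hc : 0 < c)
    (hm : ∀ t ∈ Icc 0 b, c ≤ mass (ζ t)) {e η : ℝ}
    (h0 : ∀ x, 0 ≤ x → |tail (ζ 0) x - e * tail S.nuE x| ≤ η) {t : ℝ} (ht : t ∈ Icc 0 b)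
    {x : ℝ} (hx : 0 ≤ x) : |tail (ζ t) x - e * tail S.nuE x| ≤ η * Real.exp (S.α / c * t) := by
  have hα := S.hα
  have hL : 0 ≤ L := (ht.1.trans ht.2).trans hb.le
  have hη : 0 ≤ η := (abs_nonneg _).trans (h0 0 le_rfl)
  set Y : ℝ → ℝ := fun s => |mass (ζ (max 0 (min s L))) - e| with hY
  have hYc : Continuous Y := by
    have : Continuous fun s => mass (ζ (max 0 (min s L))) :=
      h.continuousOn_mass.comp_continuous (by fun_prop)
        fun s => ⟨le_max_left _ _, max_le hL (min_le_right _ _)⟩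
    exact (this.sub continuous_const).abs
  have hYe : ∀ s ∈ Icc 0 L, Y s = |mass (ζ s) - e| := fun s hs => by
    simp only [hY, min_eq_left hs.2, max_eq_right hs.1]
  set G : ℝ → ℝ := fun t => η + S.α / c * ∫ s in (0:ℝ)..t, Y s with hG
  have hGd : ∀ t, HasDerivAt G (S.α / c * Y t) t := fun t =>
    ((hYc.integral_hasStrictDerivAt 0 t).hasDerivAt.const_mul _).const_add _
  have hdev : ∀ s ∈ Icc 0 b, ∀ x, 0 ≤ x → |tail (ζ s) x - e * tail S.nuE x| ≤ G s := by
    intro s hs x hx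
    have h1 := h.abs_tail_sub_le le_rfl (hs.2.trans hb.le) hc
      (fun u hu => hm u ⟨hu.1, hu.2.trans hs.2⟩) hs.1 hx e
    have h2 := h0 (x + svc ζ 0 s) (add_nonneg hx (svc_nonneg hs.1))
    have h3 : ∫ u in (0:ℝ)..s, |mass (ζ u) - e| = ∫ u in (0:ℝ)..s, Y u := by
      refine intervalIntegral.integral_congr fun u hu => ?_
      rw [uIcc_of_le hs.1] at hu
      exact (hYe u ⟨hu.1, (hu.2.trans hs.2).trans hb.le⟩).symm
    rw [h3] at h1
    linarith
  have hG0 : ∀ s ∈ Icc 0 b, 0 ≤ G s := fun s hs => (abs_nonneg _).trans (hdev s hs 0 le_rfl)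
  have hgr := norm_le_gronwallBound_of_norm_deriv_right_le (f := G) (f' := fun t => S.α / c * Y t)
    (δ := η) (K := S.α / c) (ε := 0) (a := 0) (b := b)
    (fun s _ => (hGd s).continuousAt.continuousWithinAt) (fun s _ => (hGd s).hasDerivWithinAt)
    (by simp [hG, abs_of_nonneg hη]) (fun s hs => ?_) t ht
  · rw [gronwallBound_ε0, sub_zero, Real.norm_eq_abs] at hgr
    exact (hdev t ht x hx).trans ((le_abs_self _).trans hgr)
  · have hsI : s ∈ Icc 0 b := ⟨hs.1, hs.2.le⟩
    have h1 := hdev s hsI 0 le_rfl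
    rw [h.tail_zero ⟨hs.1, hs.2.trans hb⟩, S.tail_nuE_zero, mul_one,
      ← hYe s ⟨hs.1, (hs.2.trans hb).le⟩] at h1
    have hY0 : 0 ≤ Y s := abs_nonneg _
    rw [add_zero, Real.norm_eq_abs, Real.norm_eq_abs, abs_of_nonneg (hG0 s hsI),
      abs_of_nonneg (by positivity)]
    exact mul_le_mul_of_nonneg_left h1 (by positivity)

/-- A path starting near an invariant state whose mass is bounded away from zero stays near it. -/
lemma Setting.Lim.abs_tail_sub_le_of_le {c e η : ℝ} (hc : 0 < c) (he : 2 * c ≤ e)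
    (hη : η * Real.exp (S.α / c * L) < c)
    (h0 : ∀ x, 0 ≤ x → |tail (ζ 0) x - e * tail S.nuE x| ≤ η) {t : ℝ} (ht : t ∈ Ico 0 L)
    {x : ℝ} (hx : 0 ≤ x) :
    |tail (ζ t) x - e * tail S.nuE x| ≤ η * Real.exp (S.α / c * L) := by
  have hα := S.hα
  have hη0 : 0 ≤ η := (abs_nonneg _).trans (h0 0 le_rfl)
  have hexp : ∀ s ∈ Ico 0 L, η * Real.exp (S.α / c * s) ≤ η * Real.exp (S.α / c * L) := fun s hs =>
    mul_le_mul_of_nonneg_left (Real.exp_le_exp.2 (mul_le_mul_of_nonneg_left hs.2.le (by positivity))) hη0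
  have hmass : ∀ s ∈ Ico 0 L, |tail (ζ s) 0 - e * tail S.nuE 0| ≤ η * Real.exp (S.α / c * L) →
      c < mass (ζ s) := fun s hs h1 => by
    rw [h.tail_zero hs, S.tail_nuE_zero, mul_one] at h1
    linarith [(abs_le.1 h1).1]
  have hcont : ContinuousOn (fun s => mass (ζ s)) (Icc 0 t) :=
    h.continuousOn_mass.mono (Icc_subset_Icc le_rfl ht.2.le)
  have hm : ∀ s ∈ Icc 0 t, c ≤ mass (ζ s) := by
    by_contra! hcon
    obtain ⟨u, hu, huc⟩ := hcon
    have hcl : IsCompact (Icc 0 t ∩ (fun s => mass (ζ s)) ⁻¹' Iic c) :=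
      isCompact_Icc.of_isClosed_subset (hcont.preimage_isClosed_of_isClosed isClosed_Icc isClosed_Iic)
        inter_subset_left
    obtain ⟨τ, ⟨hτ, hτc⟩, hleast⟩ := hcl.exists_isLeast ⟨u, hu, huc.le⟩
    have hτL : τ < L := hτ.2.trans_lt ht.2
    have hm' : ∀ s ∈ Icc 0 τ, c ≤ mass (ζ s) := by
      have h1 : c < mass (ζ 0) := by
        refine hmass 0 ⟨le_rfl, ht.1.trans_lt ht.2⟩ ((h0 0 le_rfl).trans ?_)
        simpa using hexp 0 ⟨le_rfl, ht.1.trans_lt ht.2⟩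
      obtain ⟨s₀, hs₀, hs₀c⟩ := intermediate_value_Icc' hτ.1
        (hcont.mono (Icc_subset_Icc le_rfl hτ.2)) ⟨hτc, h1.le⟩
      have hs₀τ : s₀ = τ := le_antisymm hs₀.2 (hleast ⟨⟨hs₀.1, hs₀.2.trans hτ.2⟩, hs₀c.le⟩)
      intro s hs
      rcases hs.2.eq_or_lt with hsτ | hsτ
      · rw [hsτ, ← hs₀τ]
        exact hs₀c.ge
      · by_contra! hlt
        exact hsτ.not_ge (hleast ⟨⟨hs.1, hs.2.trans hτ.2⟩, hlt.le⟩)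
    have h2 := h.abs_tail_sub_le_exp hτL hc hm' h0 (right_mem_Icc.2 hτ.1) le_rfl
    exact absurd hτc (not_le.2 (hmass τ ⟨hτ.1, hτL⟩ (h2.trans (hexp τ ⟨hτ.1, hτL⟩))))
  exact (h.abs_tail_sub_le_exp ht.2 hc hm h0 (right_mem_Icc.2 ht.1) hx).trans (hexp t ht)

lemma Setting.Lim.mul_tail_le {t : ℝ} (ht : t ∈ Icc 0 L) {κ : ℝ} (hκ : 0 < κ) :
    κ * tail (ζ t) κ ≤ pair id (ζ t) := by
  have := (h.mf t ht).1
  exact (mul_le_mul_of_nonneg_left (measureReal_mono (Ioi_subset_Ici_self)) hκ.le).trans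
    (mul_meas_ge_le_integral_of_nonneg (h.mf t ht).ae_nonneg (h.integrable_id ht) κ)

/-- A path starting with small mass and small workload keeps a small mass. -/
lemma Setting.Lim.mass_lt_of_small {D θ : ℝ} (hD : 0 < D) (hmD : ∀ t ∈ Icc 0 L, mass (ζ t) ≤ D)
    (hθ : 0 < θ) (h0 : mass (ζ 0) ≤ θ / 2) (hw : pair id (ζ 0) ≤ θ ^ 2 / (64 * D * S.α))
    {t : ℝ} (ht : t ∈ Ico 0 L) : mass (ζ t) < θ := by
  by_contra! hcon
  have hα := S.hα
  have hν := S.hν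
  have hcont : ContinuousOn (fun s => mass (ζ s)) (Icc 0 t) :=
    h.continuousOn_mass.mono (Icc_subset_Icc le_rfl ht.2.le)
  have hcl : IsCompact (Icc 0 t ∩ (fun s => mass (ζ s)) ⁻¹' Iic (θ / 2)) :=
    isCompact_Icc.of_isClosed_subset (hcont.preimage_isClosed_of_isClosed isClosed_Icc isClosed_Iic)
      inter_subset_left
  obtain ⟨τ, ⟨hτ, hτc⟩, hgreat⟩ := hcl.exists_isGreatest ⟨0, left_mem_Icc.2 ht.1, h0⟩
  have hτc' : mass (ζ τ) ≤ θ / 2 := hτc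
  have hm : ∀ s ∈ Icc τ t, θ / 2 ≤ mass (ζ s) := by
    obtain ⟨s₀, hs₀, hs₀c⟩ := intermediate_value_Icc hτ.2
      (hcont.mono (Icc_subset_Icc hτ.1 le_rfl)) ⟨hτc', (half_le_self hθ.le).trans hcon⟩
    have hs₀τ : s₀ = τ := le_antisymm (hgreat ⟨⟨hτ.1.trans hs₀.1, hs₀.2⟩, hs₀c.le⟩) hs₀.1
    intro s hs
    rcases hs.1.eq_or_lt with hsτ | hsτ
    · rw [← hsτ, ← hs₀τ]
      exact hs₀c.ge
    · by_contra! hlt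
      exact hsτ.not_ge (hgreat ⟨⟨hτ.1.trans hs.1, hs.2⟩, hlt.le⟩)
  have hc : 0 < θ / 2 := half_pos hθ
  set κ := θ / (8 * D * S.α) with hκ
  have hκ0 : 0 < κ := by positivity
  have hmτ := (h.mf τ ⟨hτ.1, hτ.2.trans ht.2.le⟩).1
  have a1 := h.tail_eq hτ.1 ht.2.le hc hm hτ.2 le_rfl
  have a2 := h.tail_eq hτ.1 ht.2.le hc hm hτ.2 hκ0.le
  have b1 := h.tail_nuE_sub_svc hτ.1 ht.2.le hc hm hτ.2 le_rfl
  have b2 := h.tail_nuE_sub_svc hτ.1 ht.2.le hc hm hτ.2 hκ0.le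
  have hTi : ∀ x, IntervalIntegrable (fun s => tail S.ν (x + svc ζ s t)) volume τ t := fun x => by
    have : MonotoneOn (fun s => tail S.ν (x + svc ζ s t)) (uIcc τ t) := by
      rw [uIcc_of_le hτ.2]
      intro s hs u hu hsu
      have := h.svc_antitoneOn hτ.1 ht.2.le hc hm hs hu hsu
      exact tail_antitone _ (by simp only at this; linarith)
    exact this.intervalIntegrable
  have hTi' : ∀ x, IntervalIntegrable (fun s => (mass (ζ s))⁻¹ * tail S.ν (x + svc ζ s t)) volume τ t :=
    fun x => (hTi x).continuousOn_mul (by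
      rw [uIcc_of_le hτ.2]
      exact h.continuousOn_inv_mass hτ.1 ht.2.le hc hm)
  have hinteg : (∫ s in τ..t, tail S.ν (0 + svc ζ s t)) - ∫ s in τ..t, tail S.ν (κ + svc ζ s t)
      ≤ D * ((∫ s in τ..t, (mass (ζ s))⁻¹ * tail S.ν (0 + svc ζ s t))
        - ∫ s in τ..t, (mass (ζ s))⁻¹ * tail S.ν (κ + svc ζ s t)) := by
    rw [← intervalIntegral.integral_sub (hTi 0) (hTi κ),
      ← intervalIntegral.integral_sub (hTi' 0) (hTi' κ), ← intervalIntegral.integral_const_mul]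
    refine intervalIntegral.integral_mono_on hτ.2 ((hTi 0).sub (hTi κ))
      (((hTi' 0).sub (hTi' κ)).const_mul D) fun s hs => ?_
    have hz : 0 < mass (ζ s) := hc.trans_le (hm s hs)
    have h1 : 1 ≤ D * (mass (ζ s))⁻¹ := by
      rw [← div_eq_mul_inv, one_le_div hz]
      exact hmD s ⟨hτ.1.trans hs.1, hs.2.trans ht.2.le⟩
    have h2 : tail S.ν (κ + svc ζ s t) ≤ tail S.ν (0 + svc ζ s t) := tail_antitone _ (by linarith)
    rw [← mul_sub, ← mul_assoc]
    exact le_mul_of_one_le_left (sub_nonneg.2 h2) h1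
  have c1 := S.tail_nuE_sub_le_mul hκ0.le
  have hE := S.isMF_nuE.1
  have c2 : tail S.nuE (κ + svc ζ τ t) ≤ tail S.nuE (0 + svc ζ τ t) :=
    tail_antitone _ (by linarith)
  have c3 : tail (ζ τ) (0 + svc ζ τ t) ≤ θ / 2 := (tail_le_mass _ _).trans hτc'
  have c4 := tail_nonneg (ζ τ) (κ + svc ζ τ t)
  have d1 : D * (S.α * (κ - 0)) = θ / 8 := by
    rw [hκ]
    field_simp
    norm_num
  have d2 : tail (ζ t) κ ≤ θ / 8 := by
    have htI : t ∈ Icc 0 L := ⟨ht.1, ht.2.le⟩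
    have k1 := h.mul_tail_le htI hκ0
    rw [h.workload_eq htI] at k1
    have k2 : θ ^ 2 / (64 * D * S.α) = κ * (θ / 8) := by
      rw [hκ]
      field_simp
      norm_num
    rw [k2] at hw
    exact le_of_mul_le_mul_left (k1.trans hw) hκ0
  rw [h.tail_zero ht] at a1
  have d3 : mass (ζ t) - tail (ζ t) κ ≤ θ / 2 + D * (S.α * (κ - 0)) := by
    have k1 := mul_le_mul_of_nonneg_left hinteg hα.le
    have k2 : S.α * (D * ((∫ s in τ..t, (mass (ζ s))⁻¹ * tail S.ν (0 + svc ζ s t))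
        - ∫ s in τ..t, (mass (ζ s))⁻¹ * tail S.ν (κ + svc ζ s t)))
        = D * ((tail S.nuE 0 - tail S.nuE (0 + svc ζ τ t))
          - (tail S.nuE κ - tail S.nuE (κ + svc ζ τ t))) := by
      rw [b1, b2]
      ring
    have k3 : (tail S.nuE 0 - tail S.nuE (0 + svc ζ τ t))
          - (tail S.nuE κ - tail S.nuE (κ + svc ζ τ t)) ≤ S.α * (κ - 0) := by linarith
    have k4 := mul_le_mul_of_nonneg_left k3 hD.le
    linarith
  linarith

end PSQ

open PSQ MeasureTheory in
/-- Lemma 4.6: uniform continuity near the truncated invariant manifold: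
good-path limits starting δ-close to an invariant state ξ ∈ M_ν^1 stay ε-close to ξ
(the fluid model solution started at ξ) on [0,L]. -/
theorem stmt_15 (S : PSQ.Setting) (q Mq : ℝ) (hq : q ∈ Set.Ioo 0 S.p) (hMq : 1 < Mq)
    (hbound : ∀ L : ℝ, 1 < L → ∀ ζ : ℝ → Measure ℝ, S.memBL L ζ →
      ∀ t ∈ Set.Icc (0:ℝ) L,
        max (max (mass (ζ t)) (pair id (ζ t)))
          (pair (fun x => x ^ ((1:ℝ)+q)) (ζ t)) ≤ Mq)
    (L : ℝ) (hL : 1 < L) (M1 : ℝ) (hM1 : Mq ≤ M1) :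
    ∀ ε : ℝ, 0 < ε → ∃ δ : ℝ, 0 < δ ∧
      ∀ ζ : ℝ → Measure ℝ, S.memBL L ζ →
        ∀ ξ : Measure ℝ, S.onManifold ξ → pair id ξ ≤ M1 →
          max (dmet S.gmet S.hmet (ζ 0) ξ) |pair id (ζ 0) - pair id ξ| ≤ δ →
          ∀ t ∈ Set.Icc (0:ℝ) L, dmet S.gmet S.hmet (ζ t) ξ ≤ ε := by
  intro ε hε
  have hα := S.hα
  have hL0 : 0 < L := zero_lt_one.trans hL
  have hMq0 : 0 < Mq := zero_lt_one.trans hMq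
  have hE := S.isMF_nuE.1
  obtain ⟨C, δ₁, hδ₁, hC⟩ := S.exists_multiple_le Mq
  obtain ⟨θ, hθ, hclose⟩ := S.exists_dmet_le C (half_pos hε)
  set ρ := θ ^ 2 / (64 * Mq * S.α) with hρ
  have hρ0 : 0 < ρ := by positivity
  set m := |pair id S.nuE| with hm
  have hm0 : 0 ≤ m := abs_nonneg _
  set c := min (θ / 4) (ρ / (2 * (m + 1))) / 2 with hc
  have hc0 : 0 < c := by positivity
  have hc1 : 2 * c ≤ θ / 4 := by
    rw [hc, mul_div_cancel₀ _ two_ne_zero]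
    exact min_le_left _ _
  have hc2 : 2 * c * m ≤ ρ / 2 := by
    have h1 : 2 * c ≤ ρ / (2 * (m + 1)) := by
      rw [hc, mul_div_cancel₀ _ two_ne_zero]
      exact min_le_right _ _
    rw [le_div_iff₀ (by positivity)] at h1
    nlinarith
  set K := Real.exp (S.α / c * L) with hK
  have hK0 : 0 < K := Real.exp_pos _
  set η := min (θ / 4) (min θ (c / 2) / K) with hη
  have hη0 : 0 < η := by positivity
  have hη1 : η * K ≤ min θ (c / 2) := by
    rw [← le_div_iff₀ hK0]
    exact min_le_right _ _
  obtain ⟨δ₂, hδ₂, htail⟩ := S.exists_tail_close C hη0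
  refine ⟨min δ₁ (min δ₂ (ρ / 2)), by positivity, ?_⟩
  intro ζ hζ ξ hξ _ hd
  obtain ⟨e, he, rfl⟩ := hξ
  obtain ⟨P, h⟩ := S.exists_lim hL0.le hζ
  have h0I : (0:ℝ) ∈ Icc 0 L := ⟨le_rfl, hL0.le⟩
  have hmD : ∀ t ∈ Icc 0 L, mass (ζ t) ≤ Mq := fun t ht =>
    ((le_max_left _ _).trans (le_max_left _ _)).trans (hbound L hL ζ hζ t ht)
  have hd0 := (le_max_left _ _).trans hd
  have hdw := ((le_max_right _ _).trans hd).trans ((min_le_right _ _).trans (min_le_right _ _))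
  have heC : e ≤ C := hC (ζ 0) (h.mf 0 h0I) (hmD 0 h0I) e he (hd0.trans (min_le_left _ _))
  obtain ⟨hmass, htl⟩ := htail (ζ 0) (h.mf 0 h0I) e ⟨he, heC⟩
    (hd0.trans ((min_le_right _ _).trans (min_le_left _ _)))
  have hmain : ∀ t ∈ Ico 0 L,
      dmet S.gmet S.hmet (ζ t) (ENNReal.ofReal e • S.nuE) ≤ ε / 2 := by
    intro t ht
    have htI : t ∈ Icc 0 L := ⟨ht.1, ht.2.le⟩
    have hmt := (h.mf t htI).1
    rcases le_or_gt (2 * c) e with hce | hce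
    · have hη2 : η * K < c := hη1.trans_lt ((min_le_right _ _).trans_lt (half_lt_self hc0))
      have hdev := fun x (hx : 0 ≤ x) =>
        (h.abs_tail_sub_le_of_le hc0 hce hη2 htl ht hx).trans (hη1.trans (min_le_left _ _))
      refine hclose (ζ t) (h.mf t htI) e ⟨he, heC⟩ ?_ hdev
      have := hdev 0 le_rfl
      rwa [h.tail_zero ht, S.tail_nuE_zero, mul_one] at this
    · have hmθ : mass (ζ t) < θ := by
        refine h.mass_lt_of_small hMq0 hmD hθ ?_ ?_ ht
        · have := (abs_le.1 hmass).2
          have hηθ : η ≤ θ / 4 := min_le_left _ _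
          linarith
        · have h1 := (abs_le.1 hdw).2
          rw [pair_smul, ENNReal.toReal_ofReal he] at h1
          have h2 : e * pair id S.nuE ≤ 2 * c * m :=
            (mul_le_mul_of_nonneg_left (le_abs_self _) he).trans
              (mul_le_mul_of_nonneg_right hce.le hm0)
          linarith
      refine hclose (ζ t) (h.mf t htI) e ⟨he, heC⟩ ?_ fun x _ => ?_
      · have := mass_nonneg (ζ t)
        rw [abs_le]
        constructor <;> linarith
      · have h1 := tail_nonneg (ζ t) x
        have h2 := tail_le_mass (ζ t) x
        have h3 := mul_nonneg he (tail_nonneg S.nuE x)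
        have h4 : e * tail S.nuE x ≤ e :=
          mul_le_of_le_one_right he ((tail_le_mass _ _).trans S.mass_nuE.le)
        rw [abs_le]
        constructor <;> linarith
  intro t ht
  rcases ht.2.lt_or_eq with htL | htL
  · exact (hmain t ⟨ht.1, htL⟩).trans (half_le_self hε.le)
  · obtain ⟨δ, hδ, hcont⟩ := hζ.2.1 t ht (ε / 2) (half_pos hε)
    obtain ⟨s, hs1, hs2⟩ := exists_between (max_lt hL0 (sub_lt_self L hδ))
    have hs : s ∈ Ico 0 L := ⟨(le_max_left _ _).trans hs1.le, hs2⟩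
    have hsI : s ∈ Icc 0 L := ⟨hs.1, hs.2.le⟩
    have h1 := hcont s hsI (by
      rw [htL, abs_sub_comm, abs_of_pos (sub_pos.2 hs2)]
      linarith [(le_max_right _ _).trans_lt hs1])
    have h2 := dmet_triangle S.hmetfam (h.mf t ht) (h.mf s hsI) (isMF_smul_nuE S e)
    rw [dmet_comm (ζ t) (ζ s)] at h2
    linarith [hmain s hs]
end

section
/- Let (α, ν) be critical data and L > 1. If ζ is a fluid model solution on [0,L] for (α, ν) with ζ(0) ≠ 0, and c > 0, then the map ζ̃ : [0, cL] → M_F defined by ζ̃(t) = c · ζ(t/c) (the measure assigning mass c·ζ(t/c)(A) to each Borel set A) is a fluid model solution on [0, cL] for (α, ν). -/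
open MeasureTheory Filter Set
namespace PSQ

theorem pair_ofReal_smul {c : ℝ} (hc : 0 ≤ c) (g : ℝ → ℝ) (μ : Measure ℝ) :
    pair g (ENNReal.ofReal c • μ) = c * pair g μ := by
  simp [pair, integral_smul_measure, ENNReal.toReal_ofReal hc]

theorem mass_ofReal_smul {c : ℝ} (hc : 0 ≤ c) (μ : Measure ℝ) :
    mass (ENNReal.ofReal c • μ) = c * mass μ := by
  simp [mass, ENNReal.toReal_mul, ENNReal.toReal_ofReal hc]

end PSQ

open PSQ MeasureTheory in
/-- scaling invariance of fluid model solutions: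
if ζ is a fluid model solution on [0,L] with ζ(0) ≠ 0 and c > 0, then
t ↦ c·ζ(t/c) is a fluid model solution on [0,cL]. -/
theorem stmt_16 (α : ℝ) (hα : 0 < α) (ν : Measure ℝ) (hν : IsProbabilityMeasure ν)
    (hν0 : ν {0} = 0) (hνsupp : ν (Set.Iio 0) = 0)
    (hνint : Integrable (fun x => x) ν) (hcrit : α * ∫ x, x ∂ν = 1)
    (L : ℝ) (hL : 1 < L) (ζ : ℝ → Measure ℝ) (hζ : IsFluidSol α ν L ζ)
    (hne : ζ 0 ≠ 0) (c : ℝ) (hc : 0 < c) :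
    IsFluidSol α ν (c*L) (fun t => ENNReal.ofReal c • ζ (t/c)) := by
  have hmem : ∀ t ∈ Set.Icc (0 : ℝ) (c * L), t / c ∈ Set.Icc (0 : ℝ) L := fun t ht =>
    ⟨div_nonneg ht.1 hc.le, by rw [div_le_iff₀ hc, mul_comm]; exact ht.2⟩
  obtain ⟨hfin, hcont, hsol⟩ := hζ
  refine ⟨fun t ht => ?_, fun f hf hbdd => ?_, Or.inr ?_⟩
  · obtain ⟨hfinite, hneg, hzero⟩ := hfin _ (hmem t ht)
    refine ⟨Measure.smul_finite _ ENNReal.ofReal_ne_top, ?_, ?_⟩ <;> simp [hneg, hzero]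
  · simp only [pair_ofReal_smul hc.le]
    exact continuousOn_const.mul
      ((hcont f hf hbdd).comp (continuous_id.div_const c).continuousOn hmem)
  · obtain ⟨hz, -⟩ | ⟨hnz, heq⟩ := hsol
    · exact absurd hz hne
    refine ⟨fun t ht h => hnz _ (hmem t ht) ?_, fun t ht g hg hbdd hg0 hdg0 => ?_⟩
    · rw [← Measure.measure_univ_eq_zero] at h ⊢
      simpa [hc.not_ge] using h
    · have hint : (∫ s in (0 : ℝ)..t, pair (deriv g) (ENNReal.ofReal c • ζ (s / c)) /
          mass (ENNReal.ofReal c • ζ (s / c))) =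
          c * ∫ s in (0 : ℝ)..(t / c), pair (deriv g) (ζ s) / mass (ζ s) := by
        simp only [pair_ofReal_smul hc.le, mass_ofReal_smul hc.le,
          mul_div_mul_left _ _ hc.ne']
        rw [intervalIntegral.integral_comp_div
          (fun s => pair (deriv g) (ζ s) / mass (ζ s)) hc.ne', zero_div, smul_eq_mul]
      have key := heq _ (hmem t ht) g hg hbdd hg0 hdg0
      simp only [hint]
      simp only [pair_ofReal_smul hc.le, zero_div, key]
      field_simp
end
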